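/- arXiv:2009.12803 — 2 statements merged into one kernel-verified Lean document; each statement's English description precedes it below -/
import Mathlib

section
/- For all integers k ≥ 0 and l ≥ 1 there exists a positive integer N' (depending only on k and l) such that for all integers p ≥ N' and all integers q with 2 ≤ q, p−k−2l ≤ q and q < p−k−l, there does not exist any proper holomorphic map from D^I_{p,q} to D^I_{p−l, p−k−l}. -/
open Matrix
open scoped ComplexOrder

attribute [local instance] Matrix.normedAddCommGroup Matrix.normedSpace

/-- The type-I irreducible bounded symmetric domain `D^I_{m,n}`,
realized as the set of complex `m × n` matrices `Z` with `I - Zᴴ Z` positive definite. -/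
def typeIDomain (m n : ℕ) : Set (Matrix (Fin m) (Fin n) ℂ) :=
  {Z | (1 - Zᴴ * Z).PosDef}

/-- `f` maps `D` into `D'` and the `f`-preimage of every compact subset of `D'`
is a compact subset of `D`. -/
def ProperOn {E F : Type*} [TopologicalSpace E] [TopologicalSpace F]
    (f : E → F) (D : Set E) (D' : Set F) : Prop :=
  Set.MapsTo f D D' ∧ ∀ K : Set F, K ⊆ D' → IsCompact K → IsCompact (D ∩ f ⁻¹' K)

set_option linter.unusedSectionVars false


/-! ### Preliminaries: determinants and selection -/

theorem ax_continuous_det {V : Type*} [NormedAddCommGroup V] [InnerProductSpace ℂ V]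
    [FiniteDimensional ℂ V] :
    Differentiable ℂ (fun A : V →L[ℂ] V => LinearMap.det (A : V →ₗ[ℂ] V)) := by
  classical
  let b := Module.finBasis ℂ V
  have h : (fun A : V →L[ℂ] V => LinearMap.det (A : V →ₗ[ℂ] V)) =
      fun A => ∑ σ : Equiv.Perm (Fin (Module.finrank ℂ V)),
        (Equiv.Perm.sign σ : ℂ) * ∏ i, (b.coord (σ i)).toContinuousLinearMap (A (b i)) := by
    funext A
    rw [← LinearMap.det_toMatrix b, Matrix.det_apply']
    simp [LinearMap.toMatrix_apply]
  rw [h]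
  fun_prop

theorem ax_det_ne_of_inj {V : Type*} [NormedAddCommGroup V] [InnerProductSpace ℂ V]
    [FiniteDimensional ℂ V] {A : V →L[ℂ] V} {x : V} (hx : x ≠ 0) (h : A x = 0) :
    LinearMap.det (A : V →ₗ[ℂ] V) = 0 := by
  by_contra hd
  have := (LinearMap.equivOfDetNeZero (A : V →ₗ[ℂ] V) hd).injective
  apply hx
  apply this
  simpa [LinearMap.equivOfDetNeZero] using h

theorem ax_exists_ker_of_det {V : Type*} [NormedAddCommGroup V] [InnerProductSpace ℂ V]
    [FiniteDimensional ℂ V] {A : V →L[ℂ] V}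
    (h : LinearMap.det (A : V →ₗ[ℂ] V) = 0) : ∃ x, x ≠ 0 ∧ A x = 0 := by
  have := LinearMap.bot_lt_ker_of_det_eq_zero h
  obtain ⟨x, hx, hx0⟩ := (Submodule.ne_bot_iff _).1 this.ne'
  exact ⟨x, hx0, by simpa using hx⟩

theorem ax_ker_adjoint {V : Type*} [NormedAddCommGroup V] [InnerProductSpace ℂ V]
    [FiniteDimensional ℂ V] [CompleteSpace V] {A : V →L[ℂ] V} {x : V} (hx : x ≠ 0)
    (h : ContinuousLinearMap.adjoint A x = 0) : LinearMap.det (A : V →ₗ[ℂ] V) = 0 := by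
  by_contra hd
  obtain ⟨y, hy⟩ := (LinearMap.equivOfDetNeZero (A : V →ₗ[ℂ] V) hd).surjective x
  have hy' : A y = x := by simpa [LinearMap.equivOfDetNeZero] using hy
  apply hx
  have : inner ℂ (ContinuousLinearMap.adjoint A x) y = 0 := by rw [h, inner_zero_left]
  rw [ContinuousLinearMap.adjoint_inner_left, hy'] at this
  exact inner_self_eq_zero.1 this

/-- quantitative: almost-kernel forces small determinant -/
theorem ax_det_small {V : Type*} [NormedAddCommGroup V] [InnerProductSpace ℂ V]
    [FiniteDimensional ℂ V] [CompleteSpace V] (K ε : ℝ) (hε : 0 < ε) :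
    ∃ η > 0, ∀ A : V →L[ℂ] V, ‖A‖ ≤ K →
      (∃ x : V, ‖x‖ = 1 ∧ (‖A x‖ ≤ η ∨ ‖ContinuousLinearMap.adjoint A x‖ ≤ η)) →
      ‖LinearMap.det (A : V →ₗ[ℂ] V)‖ ≤ ε := by
  classical
  let φ : (V →L[ℂ] V) × V → ℝ :=
    fun p => min ‖p.1 p.2‖ ‖ContinuousLinearMap.adjoint p.1 p.2‖
  have hdet : Continuous (fun A : V →L[ℂ] V => LinearMap.det (A : V →ₗ[ℂ] V)) :=
    ax_continuous_det.continuous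
  have hadj : Continuous (fun A : V →L[ℂ] V => ContinuousLinearMap.adjoint A) :=
    (ContinuousLinearMap.adjoint (𝕜 := ℂ) (E := V) (F := V)).continuous
  have hφ : Continuous φ := by
    apply Continuous.min
    · exact (continuous_fst.clm_apply continuous_snd).norm
    · exact ((hadj.comp continuous_fst).clm_apply continuous_snd).norm
  let S : Set ((V →L[ℂ] V) × V) :=
    (Metric.closedBall 0 K ×ˢ Metric.sphere 0 1) ∩
      {p | ε ≤ ‖LinearMap.det (p.1 : V →ₗ[ℂ] V)‖}
  have : ProperSpace V := FiniteDimensional.proper ℂ V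
  have : ProperSpace (V →L[ℂ] V) := FiniteDimensional.proper ℂ _
  have hS : IsCompact S := by
    apply IsCompact.inter_right
    · exact (isCompact_closedBall _ _).prod (isCompact_sphere _ _)
    · exact isClosed_le continuous_const (hdet.comp continuous_fst).norm
  rcases S.eq_empty_or_nonempty with he | hne
  · refine ⟨1, one_pos, ?_⟩
    rintro A hA ⟨x, hx, -⟩
    by_contra hlt
    have : (A, x) ∈ S := ⟨⟨by simpa using hA, by simpa using hx⟩, (not_le.1 hlt).le⟩
    rw [he] at this
    exact this
  · obtain ⟨p, hp, hmin⟩ := hS.exists_isMinOn hne hφ.continuousOn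
    have hx0 : p.2 ≠ 0 := by
      have : ‖p.2‖ = 1 := by simpa using hp.1.2
      intro h0
      rw [h0] at this; simp at this
    have hpdet : LinearMap.det (p.1 : V →ₗ[ℂ] V) ≠ 0 := by
      have : ε ≤ ‖LinearMap.det (p.1 : V →ₗ[ℂ] V)‖ := hp.2
      intro h0
      rw [h0, norm_zero] at this
      linarith
    have hpos : 0 < φ p := by
      apply lt_min
      · exact norm_pos_iff.2 fun h => hpdet (ax_det_ne_of_inj hx0 h)
      · exact norm_pos_iff.2 fun h => hpdet (ax_ker_adjoint hx0 h)
    refine ⟨φ p / 2, by linarith, ?_⟩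
    rintro A hA ⟨x, hx, h⟩
    by_contra hlt
    have hm : (A, x) ∈ S := ⟨⟨by simpa using hA, by simpa using hx⟩, (not_le.1 hlt).le⟩
    have h1 : φ p ≤ φ (A, x) := hmin hm
    have h2 : φ (A, x) ≤ φ p / 2 := by
      rcases h with h | h
      · exact (min_le_left _ _).trans h
      · exact (min_le_right _ _).trans h
    linarith

/-- A bounded holomorphic family of endomorphisms over the disc with almost kernels near the
boundary is singular at the origin. -/
theorem ax_det_lemma {V : Type*} [NormedAddCommGroup V] [InnerProductSpace ℂ V]
    [FiniteDimensional ℂ V] [CompleteSpace V] (M : ℂ → (V →L[ℂ] V))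
    (hM : DifferentiableOn ℂ M (Metric.ball 0 1)) (K : ℝ) (hK : ∀ t, ‖t‖ < 1 → ‖M t‖ ≤ K)
    (h : ∀ η : ℝ, 0 < η → ∃ r < 1, ∀ t : ℂ, r < ‖t‖ → ‖t‖ < 1 →
      ∃ x : V, ‖x‖ = 1 ∧ (‖M t x‖ ≤ η ∨ ‖ContinuousLinearMap.adjoint (M t) x‖ ≤ η)) :
    LinearMap.det (M 0 : V →ₗ[ℂ] V) = 0 := by
  have hd : DifferentiableOn ℂ (fun t => LinearMap.det (M t : V →ₗ[ℂ] V)) (Metric.ball 0 1) :=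
    (ax_continuous_det (V := V)).comp_differentiableOn hM
  rw [← norm_le_zero_iff]
  apply le_of_forall_pos_le_add
  intro ε hε
  obtain ⟨η, hη, H⟩ := ax_det_small (V := V) K ε hε
  obtain ⟨r, hr, hx⟩ := h η hη
  obtain ⟨s, hs, hs1⟩ := exists_between (max_lt hr one_pos)
  have hs0 : 0 < s := (le_max_right _ _).trans_lt hs
  have hsr : r < s := (le_max_left _ _).trans_lt hs
  have : ‖LinearMap.det (M 0 : V →ₗ[ℂ] V)‖ ≤ ε := by
    refine Complex.norm_le_of_forall_mem_frontier_norm_le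
      (f := fun t => LinearMap.det (M t : V →ₗ[ℂ] V)) (U := Metric.ball (0:ℂ) s)
      Metric.isBounded_ball ?_ ?_ ?_
    · apply DifferentiableOn.diffContOnCl_ball (R := s) _ subset_rfl
      exact hd.mono (Metric.closedBall_subset_ball hs1)
    · intro t ht
      have ht' : ‖t‖ = s := by simpa using Metric.frontier_ball_subset_sphere ht
      apply H _ (hK t (by linarith)) (hx t (by linarith) (by linarith))
    · exact subset_closure (by simpa using hs0)
  linarith

/-- Selection lemma. -/
theorem ax_select {ι V W G : Type*} [NormedAddCommGroup V] [InnerProductSpace ℂ V]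
    [FiniteDimensional ℂ V] [NormedAddCommGroup W] [InnerProductSpace ℂ W]
    [FiniteDimensional ℂ W] [NormedAddCommGroup G] [InnerProductSpace ℂ G]
    [FiniteDimensional ℂ G]
    (T : ι → (V →L[ℂ] W)) (M : V →L[ℂ] G) (h : ∀ x, (∀ i, T i x = 0) → M x = 0) :
    ∃ (s : Finset ι) (Λ : ι → (W →L[ℂ] G)), ∀ x, M x = ∑ i ∈ s, Λ i (T i x) := by
  classical
  -- choose finset minimizing the dimension of the common kernel
  let kr : Finset ι → Submodule ℂ V := fun s => ⨅ i ∈ s, LinearMap.ker (T i : V →ₗ[ℂ] W)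
  have hkr : ∀ s x, x ∈ kr s ↔ ∀ i ∈ s, T i x = 0 := by
    intro s x; simp [kr, Submodule.mem_iInf]
  obtain ⟨s, hs⟩ : ∃ s, ∀ s', Module.finrank ℂ (kr s) ≤ Module.finrank ℂ (kr s') := by
    obtain ⟨s, hs⟩ := (wellFounded_lt (α := ℕ)).has_min
      (Set.range fun s => Module.finrank ℂ (kr s)) (Set.range_nonempty _)
    obtain ⟨⟨s, rfl⟩, h2⟩ := And.intro hs.1 hs.2
    exact ⟨s, fun s' => not_lt.1 (h2 _ ⟨s', rfl⟩)⟩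
  have hall : ∀ x ∈ kr s, ∀ i, T i x = 0 := by
    intro x hx i
    have hle : kr (insert i s) ≤ kr s := by
      intro y hy; rw [hkr] at hy ⊢
      exact fun j hj => hy j (Finset.mem_insert_of_mem hj)
    have := Submodule.eq_of_le_of_finrank_le hle (hs _)
    rw [← this, hkr] at hx
    exact hx i (Finset.mem_insert_self _ _)
  let N : V →ₗ[ℂ] (s → W) := LinearMap.pi fun i => (T i : V →ₗ[ℂ] W)
  have hN : LinearMap.ker N ≤ LinearMap.ker (M : V →ₗ[ℂ] G) := by
    intro x hx
    have hx' : ∀ i : s, T i x = 0 := fun i => congrFun (LinearMap.mem_ker.1 hx) i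
    exact h x (hall x ((hkr s x).2 fun i hi => hx' ⟨i, hi⟩))
  obtain ⟨Λ, hΛ⟩ : ∃ Λ : (s → W) →ₗ[ℂ] G, Λ ∘ₗ N = M := by
    obtain ⟨Λ₀, hΛ₀⟩ := LinearMap.exists_leftInverse_of_injective
      ((LinearMap.ker N).liftQ N le_rfl) (Submodule.ker_liftQ_eq_bot _ _ _ le_rfl)
    refine ⟨(LinearMap.ker N).liftQ (M : V →ₗ[ℂ] G) hN ∘ₗ Λ₀, ?_⟩
    ext x
    have := LinearMap.congr_fun hΛ₀ (Submodule.Quotient.mk x)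
    simp only [LinearMap.comp_apply, Submodule.liftQ_apply, LinearMap.id_apply] at this ⊢
    rw [this, Submodule.liftQ_apply]
  refine ⟨s, fun i => if hi : i ∈ s then
    LinearMap.toContinuousLinearMap (Λ ∘ₗ LinearMap.single ℂ (fun _ : s => W) ⟨i, hi⟩) else 0, ?_⟩
  intro x
  have : M x = Λ (N x) := by
    rw [← ContinuousLinearMap.coe_coe, ← hΛ]; rfl
  rw [this, ← Finset.sum_attach]
  have h2 : N x = ∑ i, Pi.single i (N x i) := (Finset.univ_sum_single (N x)).symm
  rw [h2, map_sum]
  apply Finset.sum_congr rfl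
  intro i _
  simp [N]

/-- Continuity of the derivative of a holomorphic map. -/
theorem ax_fderiv_cont {X Y : Type*} [NormedAddCommGroup X] [NormedSpace ℂ X]
    [FiniteDimensional ℂ X] [NormedAddCommGroup Y] [NormedSpace ℂ Y] (f : X → Y)
    (hf : DifferentiableOn ℂ f (Metric.ball 0 1)) : ContinuousAt (fderiv ℂ f) 0 := by
  have : ProperSpace X := FiniteDimensional.proper ℂ X
  rw [Metric.continuousAt_iff]
  intro ε hε
  have huc : UniformContinuousOn f (Metric.closedBall 0 (1/2)) :=
    (isCompact_closedBall _ _).uniformContinuousOn_of_continuous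
      (hf.continuousOn.mono (Metric.closedBall_subset_ball (by norm_num)))
  rw [Metric.uniformContinuousOn_iff] at huc
  obtain ⟨δ, hδ, H⟩ := huc (ε/16) (by positivity)
  refine ⟨min δ (1/4), lt_min hδ (by norm_num), ?_⟩
  intro Z hZ
  rw [dist_zero_right] at hZ
  have hZ1 := hZ.trans_le (min_le_left _ _)
  have hZ2 := hZ.trans_le (min_le_right _ _)
  have hdat : ∀ W : X, ‖W‖ < 1 → DifferentiableAt ℂ f W := fun W hW =>
    hf.differentiableAt (Metric.isOpen_ball.mem_nhds (by simpa using hW))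
  let h : X → Y := fun W => f (W + Z) - f W
  have hb : ∀ W : X, ‖W‖ < 1/4 → ‖W + Z‖ < 1/2 := fun W hW =>
    (norm_add_le _ _).trans_lt (by linarith)
  have hsmall : ∀ W : X, ‖W‖ < 1/4 → ‖h W‖ ≤ ε/16 := by
    intro W hW
    have := H (W + Z) (by simpa using (hb W hW).le) W (by
      simp only [Metric.mem_closedBall, dist_zero_right]; linarith) (by simpa [dist_eq_norm] using hZ1)
    rw [dist_eq_norm] at this
    exact this.le
  have hdiff : DifferentiableOn ℂ h (Metric.ball 0 (1/4)) := by
    intro W hW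
    have hW' : ‖W‖ < 1/4 := by simpa using hW
    apply DifferentiableAt.differentiableWithinAt
    apply DifferentiableAt.sub
    · exact DifferentiableAt.comp (f := fun W => W + Z) W (hdat _ (by linarith [hb W hW']))
        (by fun_prop)
    · exact hdat _ (by linarith)
  have hmaps : Set.MapsTo h (Metric.ball 0 (1/4)) (Metric.closedBall (h 0) (ε/8)) := by
    intro W hW
    have hW' : ‖W‖ < 1/4 := by simpa using hW
    rw [Metric.mem_closedBall, dist_eq_norm]
    refine (norm_sub_le _ _).trans ?_
    linarith [hsmall W hW', hsmall 0 (by simp)]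
  have key := Complex.norm_fderiv_le_div_of_mapsTo_ball hdiff hmaps (by norm_num)
  have hfd : fderiv ℂ h 0 = fderiv ℂ f Z - fderiv ℂ f 0 := by
    have h1 : HasFDerivAt (fun W => f (W + Z)) (fderiv ℂ f Z) 0 := by
      rw [hasFDerivAt_comp_add_right, zero_add]
      exact (hdat Z (by linarith)).hasFDerivAt
    exact (h1.sub (hdat 0 (by simp)).hasFDerivAt).fderiv
  rw [hfd] at key
  rw [dist_eq_norm]
  linarith


/-! ### A point of maximal rank -/

/-- smooth function vanishing exactly on the boundary of the operator unit ball -/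
noncomputable def axDelta {E F : Type*} [NormedAddCommGroup E] [InnerProductSpace ℂ E]
    [FiniteDimensional ℂ E] [NormedAddCommGroup F] [InnerProductSpace ℂ F]
    (W : E →L[ℂ] F) : ℝ :=
  Complex.normSq (Matrix.det (Matrix.of fun i j =>
    inner ℂ (stdOrthonormalBasis ℂ E i) (stdOrthonormalBasis ℂ E j)
      - inner ℂ (W (stdOrthonormalBasis ℂ E i)) (W (stdOrthonormalBasis ℂ E j))))

section
variable {E F E' F' : Type*} [NormedAddCommGroup E] [InnerProductSpace ℂ E]
  [FiniteDimensional ℂ E] [CompleteSpace E]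
  [NormedAddCommGroup F] [InnerProductSpace ℂ F] [FiniteDimensional ℂ F] [CompleteSpace F]
  [NormedAddCommGroup E'] [InnerProductSpace ℂ E'] [FiniteDimensional ℂ E'] [CompleteSpace E']
  [NormedAddCommGroup F'] [InnerProductSpace ℂ F'] [FiniteDimensional ℂ F'] [CompleteSpace F']

theorem axDelta_diff : Differentiable ℝ (axDelta : (E →L[ℂ] F) → ℝ) := by
  have h : (axDelta : (E →L[ℂ] F) → ℝ) = fun W =>
     ‖∑ σ : Equiv.Perm (Fin (Module.finrank ℂ E)), (Equiv.Perm.sign σ : ℂ) * ∏ i,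
      (inner ℂ (stdOrthonormalBasis ℂ E (σ i)) (stdOrthonormalBasis ℂ E i)
      - inner ℂ (W (stdOrthonormalBasis ℂ E (σ i))) (W (stdOrthonormalBasis ℂ E i)))‖^2 := by
    funext W
    rw [axDelta, Complex.normSq_eq_norm_sq, Matrix.det_apply']
    simp
  rw [h]
  apply Differentiable.norm_sq ℂ
  refine Differentiable.fun_sum fun σ _ => Differentiable.const_mul ?_ _
  have hent : ∀ i j, Differentiable ℝ (fun W : E →L[ℂ] F =>
      inner ℂ (stdOrthonormalBasis ℂ E j) (stdOrthonormalBasis ℂ E i)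
      - inner ℂ (W (stdOrthonormalBasis ℂ E j)) (W (stdOrthonormalBasis ℂ E i))) := by
    intro i j
    refine (differentiable_const _).sub (Differentiable.inner ℂ ?_ ?_)
    · exact ((ContinuousLinearMap.apply ℂ F
        (stdOrthonormalBasis ℂ E j)).restrictScalars ℝ).differentiable
    · exact ((ContinuousLinearMap.apply ℂ F
        (stdOrthonormalBasis ℂ E i)).restrictScalars ℝ).differentiable
  induction (Finset.univ : Finset (Fin (Module.finrank ℂ E))) using Finset.induction_on with
  | empty => simp
  | insert i s hi ih =>
    simp only [Finset.prod_insert hi]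
    exact (hent _ _).mul ih

theorem axDelta_mulVec (W : E →L[ℂ] F) (c : Fin (Module.finrank ℂ E) → ℂ)
    (i : Fin (Module.finrank ℂ E)) :
    ((Matrix.of fun i j =>
    inner ℂ (stdOrthonormalBasis ℂ E i) (stdOrthonormalBasis ℂ E j)
      - inner ℂ (W (stdOrthonormalBasis ℂ E i)) (W (stdOrthonormalBasis ℂ E j))) *ᵥ c) i
    = inner ℂ (stdOrthonormalBasis ℂ E i) (∑ j, c j • stdOrthonormalBasis ℂ E j)
      - inner ℂ (W (stdOrthonormalBasis ℂ E i)) (W (∑ j, c j • stdOrthonormalBasis ℂ E j)) := by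
  simp only [Matrix.mulVec, dotProduct, Matrix.of_apply, map_sum, map_smul, inner_sum,
    inner_smul_right, ← Finset.sum_sub_distrib]
  apply Finset.sum_congr rfl
  intro j _
  ring

theorem axDelta_pos {W : E →L[ℂ] F} (hW : ‖W‖ < 1) : 0 < axDelta W := by
  rw [axDelta, Complex.normSq_pos]
  intro h0
  obtain ⟨c, hc, hc0⟩ := Matrix.exists_mulVec_eq_zero_iff.2 h0
  set b := stdOrthonormalBasis ℂ E
  set x : E := ∑ j, c j • b j with hx
  have h1 : ∀ i, inner ℂ (b i) x - inner ℂ (W (b i)) (W x) = 0 := by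
    intro i
    rw [← axDelta_mulVec, hc0]; rfl
  have h2 : inner ℂ x x - inner ℂ (W x) (W x) = 0 := by
    have : inner ℂ x x - inner ℂ (W x) (W x) =
       ∑ i, (starRingEnd ℂ) (c i) * (inner ℂ (b i) x - inner ℂ (W (b i)) (W x)) := by
      conv_lhs => rw [show inner ℂ x x = inner ℂ (∑ j, c j • b j) x from rfl,
        show inner ℂ (W x) (W x) = inner ℂ (W (∑ j, c j • b j)) (W x) from rfl]
      simp only [map_sum, map_smul, sum_inner, inner_smul_left, ← Finset.sum_sub_distrib, mul_sub]
    rw [this]; simp [h1]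
  have hx0 : x ≠ 0 := by
    intro hx0
    apply hc
    have := Fintype.linearIndependent_iff.1 b.orthonormal.linearIndependent c (by rw [← hx0])
    funext i; exact this i
  have h3 : ‖x‖^2 - ‖W x‖^2 = 0 := by
    have := congrArg RCLike.re h2
    rwa [map_sub, inner_self_eq_norm_sq, inner_self_eq_norm_sq, map_zero] at this
  have h4 : ‖W x‖ < ‖x‖ := by
    have := W.le_opNorm x
    have hxp := norm_pos_iff.2 hx0
    nlinarith
  nlinarith [norm_nonneg (W x)]

theorem ax_exists_norming (W : E →L[ℂ] F) (hW : 0 < ‖W‖) : ∃ x : E, ‖x‖ = 1 ∧ ‖W x‖ = ‖W‖ := by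
  have : ProperSpace E := FiniteDimensional.proper ℂ E
  have hnt : Nontrivial E := by
    by_contra h
    rw [not_nontrivial_iff_subsingleton] at h
    have : W = 0 := by ext x; rw [Subsingleton.elim x 0]; simp
    rw [this] at hW; simp at hW
  obtain ⟨x, hx, hmax⟩ := (isCompact_sphere (0:E) 1).exists_isMaxOn
    (NormedSpace.sphere_nonempty.2 zero_le_one) (W.continuous.norm.continuousOn)
  have hx1 : ‖x‖ = 1 := by simpa using hx
  refine ⟨x, hx1, le_antisymm ?_ ?_⟩
  · simpa [hx1] using W.le_opNorm x
  · apply W.opNorm_le_of_unit_norm (norm_nonneg _)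
    intro y hy
    exact hmax (by simpa using hy)

theorem axDelta_zero {W : E →L[ℂ] F} (hW : ‖W‖ = 1) : axDelta W = 0 := by
  rw [axDelta, Complex.normSq_eq_zero]
  obtain ⟨x, hx, hWx⟩ := ax_exists_norming W (by rw [hW]; exact one_pos)
  rw [hW] at hWx
  rw [← Matrix.exists_mulVec_eq_zero_iff]
  set b := stdOrthonormalBasis ℂ E
  refine ⟨fun i => b.repr x i, ?_, ?_⟩
  · intro h
    have : x = 0 := by
      rw [← b.sum_repr x]
      simp [fun i => congrFun h i]
    rw [this] at hx; simp at hx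
  · funext i
    rw [axDelta_mulVec, b.sum_repr x]
    have h1 : ContinuousLinearMap.adjoint W (W x) = x := by
      rw [← sub_eq_zero, ← norm_eq_zero, ← sq_eq_zero_iff]
      have h2 : ‖ContinuousLinearMap.adjoint W (W x)‖ ≤ 1 := by
        have := (ContinuousLinearMap.adjoint W).le_opNorm (W x)
        rwa [LinearIsometryEquiv.norm_map, hW, hWx, one_mul] at this
      have h3 := @norm_sub_sq ℂ _ _ _ _ (ContinuousLinearMap.adjoint W (W x)) x
      rw [ContinuousLinearMap.adjoint_inner_left, inner_self_eq_norm_sq, hWx, hx] at h3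
      have h4 : ‖ContinuousLinearMap.adjoint W (W x)‖^2 ≤ 1 := by
        nlinarith [norm_nonneg (ContinuousLinearMap.adjoint W (W x))]
      apply le_antisymm _ (by positivity)
      rw [h3]; linarith
    rw [← ContinuousLinearMap.adjoint_inner_right, h1, sub_self]; rfl

theorem axDelta_bound {c : ℝ} (hc : 0 < c) :
    ∃ ρ < 1, ∀ W : E →L[ℂ] F, ‖W‖ < 1 → c ≤ axDelta W → ‖W‖ ≤ ρ := by
  have : ProperSpace (E →L[ℂ] F) := FiniteDimensional.proper ℂ _
  let S : Set (E →L[ℂ] F) := Metric.closedBall 0 1 ∩ {W | c ≤ axDelta W}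
  have hS : IsCompact S := (isCompact_closedBall _ _).inter_right
    (isClosed_le continuous_const axDelta_diff.continuous)
  rcases S.eq_empty_or_nonempty with he | hne
  · refine ⟨0, one_pos, fun W hW hd => ?_⟩
    have : W ∈ S := ⟨by simpa using hW.le, hd⟩
    rw [he] at this; exact this.elim
  · obtain ⟨W, hW, hmax⟩ := hS.exists_isMaxOn hne continuous_norm.continuousOn
    refine ⟨‖W‖, ?_, fun W' hW' hd => hmax ⟨by simpa using hW'.le, hd⟩⟩
    have h1 : ‖W‖ ≤ 1 := by simpa using hW.1
    refine lt_of_le_of_ne h1 fun h => ?_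
    have h2 : c ≤ axDelta W := hW.2
    rw [axDelta_zero h] at h2
    linarith

/-- Proper holomorphic maps between operator unit balls. -/
structure AxPH (f : (E →L[ℂ] F) → (E' →L[ℂ] F')) : Prop where
  diff : DifferentiableOn ℂ f (Metric.ball 0 1)
  maps : ∀ Z, ‖Z‖ < 1 → ‖f Z‖ < 1
  proper : ∀ ρ < 1, ∃ r < 1, ∀ Z, ‖Z‖ < 1 → ‖f Z‖ ≤ ρ → ‖Z‖ ≤ r

theorem AxPH.diffAt {f : (E →L[ℂ] F) → (E' →L[ℂ] F')} (hf : AxPH f) {Z : E →L[ℂ] F}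
    (hZ : ‖Z‖ < 1) : DifferentiableAt ℂ f Z :=
  hf.diff.differentiableAt (Metric.isOpen_ball.mem_nhds (by simpa using hZ))

theorem ax_hasDeriv_aux {Y : Type*} [NormedAddCommGroup Y] [NormedSpace ℝ Y] (G0 : Y) (h : ℝ → Y)
    (hh : ContinuousAt h 0) : HasDerivAt (fun τ : ℝ => G0 + τ • h τ) (h 0) 0 := by
  rw [hasDerivAt_iff_tendsto_slope]
  have : Filter.Tendsto h (nhdsWithin 0 {0}ᶜ) (nhds (h 0)) := hh.tendsto.mono_left nhdsWithin_le_nhds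
  refine this.congr' ?_
  filter_upwards [self_mem_nhdsWithin] with τ hτ
  have hτ' : τ ≠ 0 := hτ
  simp [slope_def_module, smul_smul, hτ']

theorem ax_four {Y : Type*} [NormedAddCommGroup Y] [NormedSpace ℂ Y] [CompleteSpace Y]
    (δ : Y → ℝ) (hδ : Differentiable ℝ δ)
    (G : ℂ → Y) {R : ℝ} (hR : 0 < R) (hG : DifferentiableOn ℂ G (Metric.ball 0 R))
    (hG' : deriv G 0 = 0) (c : ℝ) (hc : 0 < c) :
    ∃ r : ℝ, 0 < r ∧ r < R ∧ -(c * r^2) < δ (G r) + δ (G (-r)) + δ (G (Complex.I * r))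
      + δ (G (-(Complex.I * r))) - 4 * δ (G 0) := by
  let H : ℂ → Y := dslope (dslope G 0) 0
  have hnb : Metric.ball (0:ℂ) R ∈ nhds 0 := Metric.ball_mem_nhds _ hR
  have hd1 : DifferentiableOn ℂ (dslope G 0) (Metric.ball 0 R) :=
    (Complex.differentiableOn_dslope hnb).2 hG
  have hd2 : DifferentiableOn ℂ H (Metric.ball 0 R) :=
    (Complex.differentiableOn_dslope hnb).2 hd1
  have hHc : ContinuousAt H 0 := (hd2.differentiableAt hnb).continuousAt
  have hform : ∀ s, G s = G 0 + (s^2) • H s := by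
    intro s
    have h1 := sub_smul_dslope G 0 s
    have h2 := sub_smul_dslope (dslope G 0) 0 s
    rw [dslope_same, hG', sub_zero, sub_zero] at h2
    rw [← h2, sub_zero, smul_smul, ← sq] at h1
    rw [show H s = dslope (dslope G 0) 0 s from rfl, h1]; abel
  let ph : ℂ → ℝ → Y := fun u τ => (u^2) • H (u * (Real.sqrt τ : ℝ))
  have hph : ∀ u, ContinuousAt (ph u) 0 := by
    intro u
    refine ContinuousAt.const_smul ?_ _
    apply ContinuousAt.comp (g := H)
    · simpa using hHc
    · fun_prop
  have hder : ∀ u, HasDerivAt (fun τ : ℝ => δ (G 0 + τ • ph u τ))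
      (fderiv ℝ δ (G 0) ((u^2) • H 0)) 0 := by
    intro u
    have h1 := ax_hasDeriv_aux (G 0) (ph u) (hph u)
    have h2 : HasFDerivAt δ (fderiv ℝ δ (G 0)) (G 0 + (0:ℝ) • ph u 0) := by
      rw [zero_smul, add_zero]; exact (hδ _).hasFDerivAt
    have := h2.comp_hasDerivAt (0:ℝ) h1
    simpa [ph, Function.comp_def] using this
  have hval : ∀ u, ∀ r : ℝ, 0 ≤ r → G 0 + (r^2) • ph u (r^2) = G (u * r) := by
    intro u r hr
    rw [hform (u * r)]
    simp only [ph, Real.sqrt_sq hr, mul_pow]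
    congr 1
    rw [mul_smul, ← Complex.ofReal_pow, Complex.coe_smul, smul_comm]
  have hsum := (((hder 1).add (hder (-1))).add (hder Complex.I)).add (hder (-Complex.I))
  have hzero : fderiv ℝ δ (G 0) ((1:ℂ)^2 • H 0) + fderiv ℝ δ (G 0) ((-1:ℂ)^2 • H 0)
      + fderiv ℝ δ (G 0) (Complex.I^2 • H 0) + fderiv ℝ δ (G 0) ((-Complex.I)^2 • H 0) = 0 := by
    simp
  rw [hzero, hasDerivAt_iff_tendsto_slope] at hsum
  have hev := hsum.eventually (lt_mem_nhds (show -c < 0 by linarith))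
  have hev' := (nhdsWithin_mono (0:ℝ) (show Set.Ioi (0:ℝ) ⊆ {0}ᶜ from fun x hx => ne_of_gt hx)) hev
  have hlim : Filter.Tendsto (fun r : ℝ => r^2) (nhdsWithin 0 (Set.Ioi 0))
      (nhdsWithin 0 (Set.Ioi 0)) := by
    apply tendsto_nhdsWithin_of_tendsto_nhds_of_eventually_within
    · have : Filter.Tendsto (fun r : ℝ => r^2) (nhds 0) (nhds 0) := by
        have : ContinuousAt (fun r : ℝ => r^2) 0 := by fun_prop
        simpa [ContinuousAt] using this
      exact this.mono_left nhdsWithin_le_nhds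
    · filter_upwards [self_mem_nhdsWithin] with r hr
      have : 0 < r := hr
      exact Set.mem_Ioi.2 (by positivity)
  obtain ⟨r, hr1, hr2⟩ := ((hlim.eventually hev').and (Ioo_mem_nhdsGT hR)).exists
  refine ⟨r, hr2.1, hr2.2, ?_⟩
  have hr0 : 0 ≤ r := hr2.1.le
  have hrsq : 0 < r^2 := by have := hr2.1; positivity
  simp only [Pi.add_apply, slope_def_field, hval _ _ hr0, zero_smul, add_zero, sub_zero] at hr1
  rw [lt_div_iff₀ hrsq] at hr1
  simp only [one_mul, neg_mul] at hr1
  linarith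

theorem AxPH.exists_inj {f : (E →L[ℂ] F) → (E' →L[ℂ] F')} (hf : AxPH f) :
    ∃ Z, ‖Z‖ < 1 ∧ Function.Injective (fderiv ℂ f Z) := by
  have : ProperSpace (E →L[ℂ] F) := FiniteDimensional.proper ℂ _
  let b := stdOrthonormalBasis ℂ E
  let qf : (E →L[ℂ] F) → ℝ := fun Z => ∑ i, ‖Z (b i)‖^2
  have hqfc : Continuous qf := by
    apply continuous_finsetSum
    intro i _
    exact ((ContinuousLinearMap.apply ℂ F (b i)).continuous.norm.pow 2)
  have hpar : ∀ Z A, qf (Z + A) + qf (Z - A) = 2 * qf Z + 2 * qf A := by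
    intro Z A
    simp only [qf, ← Finset.sum_add_distrib, Finset.mul_sum]
    apply Finset.sum_congr rfl
    intro i _
    have := parallelogram_law_with_norm ℂ (Z (b i)) (A (b i))
    simp only [_root_.add_apply, _root_.sub_apply]
    nlinarith
  have hsm : ∀ (s : ℂ) A, qf (s • A) = ‖s‖^2 * qf A := by
    intro s A
    simp [qf, Finset.mul_sum, norm_smul, mul_pow]
  have hqpos : ∀ A, A ≠ 0 → 0 < qf A := by
    intro A hA
    rcases (show 0 ≤ qf A from Finset.sum_nonneg fun i _ => by positivity).lt_or_eq with h | h
    · exact h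
    · exfalso; apply hA
      have := (Finset.sum_eq_zero_iff_of_nonneg (fun i _ => by positivity)).1 h.symm
      apply ContinuousLinearMap.coe_injective
      apply b.toBasis.ext
      intro i
      simpa using this i (Finset.mem_univ _)
  let n : ℝ := Module.finrank ℂ E
  have hn : 0 ≤ n := Nat.cast_nonneg _
  have hqb : ∀ Z, ‖Z‖ < 1 → qf Z ≤ n := by
    intro Z hZ
    have : qf Z ≤ ∑ i : Fin (Module.finrank ℂ E), (1:ℝ) := by
      apply Finset.sum_le_sum
      intro i _
      have h1 := Z.le_opNorm (b i)
      rw [b.orthonormal.1 i, mul_one] at h1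
      have := norm_nonneg (Z (b i))
      nlinarith
    simpa [n] using this
  have hqnn : ∀ Z, 0 ≤ qf Z := fun Z => Finset.sum_nonneg fun i _ => by positivity
  set δ0 := axDelta (f 0) with hδ0
  have hδ0p : 0 < δ0 := axDelta_pos (hf.maps 0 (by simp))
  obtain ⟨ρ, hρ, hρb⟩ := axDelta_bound (E := E') (F := F') (c := δ0/2) (by linarith)
  obtain ⟨r, hr, hrb⟩ := hf.proper ρ hρ
  have hr0 : 0 ≤ r := by
    have := hrb 0 (by simp) (hρb _ (hf.maps 0 (by simp)) (by linarith))
    simpa using this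
  set ε := δ0 / (4 * (n + 1)) with hε
  have hεp : 0 < ε := by positivity
  have hεn : ε * n ≤ δ0 / 4 := by
    rw [hε, div_mul_eq_mul_div, div_le_div_iff₀ (by positivity) (by norm_num)]
    nlinarith
  let u : (E →L[ℂ] F) → ℝ := fun Z => axDelta (f Z) + ε * qf Z
  have huc : ContinuousOn u (Metric.closedBall 0 r) := by
    apply ContinuousOn.add
    · exact axDelta_diff.continuous.comp_continuousOn
        (hf.diff.continuousOn.mono (Metric.closedBall_subset_ball hr))
    · exact (continuous_const.mul hqfc).continuousOn
  obtain ⟨Zs, hZs, hmax⟩ := (isCompact_closedBall (0 : E →L[ℂ] F) r).exists_isMaxOn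
    ⟨0, by simpa using hr0⟩ huc
  have hZs1 : ‖Zs‖ < 1 := by
    have : ‖Zs‖ ≤ r := by simpa using hZs
    linarith
  have hu0 : δ0 ≤ u Zs := by
    have h1 : u 0 ≤ u Zs := hmax (show (0 : E →L[ℂ] F) ∈ Metric.closedBall 0 r by simpa using hr0)
    have h2 : u 0 = δ0 := by simp [u, qf, δ0]
    linarith
  have hglob : ∀ Z, ‖Z‖ < 1 → u Z ≤ u Zs := by
    intro Z hZ
    by_cases h : ‖Z‖ ≤ r
    · exact hmax (show Z ∈ Metric.closedBall 0 r by simpa using h)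
    · have h1 : axDelta (f Z) < δ0/2 := by
        by_contra h2
        exact h (hrb Z hZ (hρb _ (hf.maps Z hZ) (not_lt.1 h2)))
      have h2 : ε * qf Z ≤ ε * n := by
        have := hqb Z hZ
        gcongr
      have : u Z = axDelta (f Z) + ε * qf Z := rfl
      linarith
  refine ⟨Zs, hZs1, ?_⟩
  rw [injective_iff_map_eq_zero]
  intro A hA
  by_contra hA0
  have hAn : 0 < ‖A‖ := norm_pos_iff.2 hA0
  set R := (1 - ‖Zs‖) / ‖A‖ with hR
  have hRp : 0 < R := div_pos (by linarith) hAn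
  have hin : ∀ s : ℂ, ‖s‖ < R → ‖Zs + s • A‖ < 1 := by
    intro s hs
    rw [hR, lt_div_iff₀ hAn] at hs
    have := norm_add_le Zs (s • A)
    rw [norm_smul] at this
    linarith
  let G : ℂ → (E' →L[ℂ] F') := fun s => f (Zs + s • A)
  have hline : ∀ s : ℂ, HasDerivAt (fun s : ℂ => Zs + s • A) A s := by
    intro s
    simpa using ((hasDerivAt_id s).smul_const A).const_add Zs
  have hGd : DifferentiableOn ℂ G (Metric.ball 0 R) := by
    intro s hs
    have hs' : ‖s‖ < R := by simpa using hs
    exact ((hf.diffAt (hin s hs')).comp s (hline s).differentiableAt).differentiableWithinAt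
  have hG' : deriv G 0 = 0 := by
    have h1 : HasFDerivAt f (fderiv ℂ f Zs) (Zs + (0:ℂ) • A) := by
      rw [zero_smul, add_zero]; exact (hf.diffAt hZs1).hasFDerivAt
    have := (h1.comp_hasDerivAt (0:ℂ) (hline 0)).deriv
    rw [hA] at this
    exact this
  obtain ⟨t, ht0, htR, hbad⟩ := ax_four axDelta axDelta_diff G hRp hGd hG' (4 * ε * qf A)
    (by have := hqpos A hA0; positivity)
  have e0 : G 0 = f Zs := by simp [G]
  have hb : ∀ s : ℂ, ‖s‖ = t → axDelta (G s) + ε * qf (Zs + s • A) ≤ axDelta (f Zs) + ε * qf Zs :=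
    fun s hs => hglob _ (hin s (by rw [hs]; exact htR))
  have n1 : ‖(t:ℂ)‖ = t := by simp [abs_of_pos ht0]
  have b1 := hb t n1
  have b2 := hb (-t) (by rw [norm_neg, n1])
  have b3 := hb (Complex.I * t) (by rw [norm_mul, n1]; simp)
  have b4 := hb (-(Complex.I * t)) (by rw [norm_neg, norm_mul, n1]; simp)
  have q1 := hpar Zs ((t:ℂ) • A)
  have q2 := hpar Zs ((Complex.I * t) • A)
  rw [hsm, n1] at q1
  rw [hsm, norm_mul, n1, Complex.norm_I, one_mul] at q2
  rw [neg_smul, ← sub_eq_add_neg] at b2 b4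
  rw [e0] at hbad
  nlinarith
end


/-! ### Boundary estimates at the origin -/
section
variable {E F E' F' : Type*} [NormedAddCommGroup E] [InnerProductSpace ℂ E]
  [FiniteDimensional ℂ E] [CompleteSpace E]
  [NormedAddCommGroup F] [InnerProductSpace ℂ F] [FiniteDimensional ℂ F] [CompleteSpace F]
  [NormedAddCommGroup E'] [InnerProductSpace ℂ E'] [FiniteDimensional ℂ E'] [CompleteSpace E']
  [NormedAddCommGroup F'] [InnerProductSpace ℂ F'] [FiniteDimensional ℂ F'] [CompleteSpace F']

noncomputable def axR (w : F) (v : E) : E →L[ℂ] F := (innerSL ℂ v).smulRight w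

@[simp] theorem axR_apply (w : F) (v x : E) : axR w v x = (inner ℂ v x) • w := by
  simp [axR]

/-- `W` kills `v` and has range orthogonal to `w` -/
def AxSlice (v : E) (w : F) (W : E →L[ℂ] F) : Prop := W v = 0 ∧ ∀ y, inner ℂ w (W y) = 0

theorem AxSlice.smul {v : E} {w : F} {W : E →L[ℂ] F} (h : AxSlice v w W) (s : ℂ) :
    AxSlice v w (s • W) := by
  refine ⟨by simp [h.1], fun y => by simp [h.2 y]⟩

theorem AxSlice.zero {v : E} {w : F} : AxSlice v w (0 : E →L[ℂ] F) := by
  refine ⟨by simp, fun y => by simp⟩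

theorem ax_norm_slice {v : E} {w : F} (hv : ‖v‖ = 1) (hw : ‖w‖ = 1) {W : E →L[ℂ] F}
    (hW : AxSlice v w W) (t : ℂ) {m : ℝ} (ht : ‖t‖ ≤ m) (hm : ‖W‖ ≤ m) :
    ‖t • axR w v + W‖ ≤ m := by
  have hm0 : 0 ≤ m := (norm_nonneg _).trans ht
  apply ContinuousLinearMap.opNorm_le_bound _ hm0
  intro x
  set a : ℂ := inner ℂ v x with ha
  set z := x - a • v with hz
  have hvv : inner ℂ v v = (1:ℂ) := by
    rw [inner_self_eq_norm_sq_to_K, hv]; simp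
  have hvz : inner ℂ (a • v) z = (0:ℂ) := by
    rw [hz, inner_smul_left, inner_sub_right, inner_smul_right, hvv, ← ha]; ring
  have hx : x = a • v + z := by rw [hz]; abel
  have hxn : ‖x‖ * ‖x‖ = ‖a‖ * ‖a‖ + ‖z‖ * ‖z‖ := by
    rw [hx, norm_add_sq_eq_norm_sq_add_norm_sq_of_inner_eq_zero _ _ hvz, norm_smul, hv]; ring
  have hWx : W x = W z := by rw [hz, map_sub, map_smul, hW.1]; simp
  have happ : (t • axR w v + W) x = (t * a) • w + W z := by
    simp [hWx, ← ha, smul_smul]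
  have hor : inner ℂ ((t * a) • w) (W z) = (0:ℂ) := by
    rw [inner_smul_left, hW.2, mul_zero]
  have hn : ‖(t • axR w v + W) x‖ * ‖(t • axR w v + W) x‖
      = ‖t * a‖ * ‖t * a‖ + ‖W z‖ * ‖W z‖ := by
    rw [happ, norm_add_sq_eq_norm_sq_add_norm_sq_of_inner_eq_zero _ _ hor, norm_smul, hw]; ring
  have h1 : ‖W z‖ ≤ m * ‖z‖ := (W.le_opNorm z).trans (by gcongr)
  have h2 : ‖t * a‖ ≤ m * ‖a‖ := by rw [norm_mul]; gcongr
  apply (sq_le_sq₀ (norm_nonneg _) (by positivity)).1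
  rw [sq, hn]
  have h3 : ‖W z‖ * ‖W z‖ ≤ (m * ‖z‖) * (m * ‖z‖) := by gcongr
  have h4 : ‖t * a‖ * ‖t * a‖ ≤ (m * ‖a‖) * (m * ‖a‖) := by gcongr
  have h5 : (m * ‖x‖)^2 = m^2 * (‖a‖ * ‖a‖ + ‖z‖ * ‖z‖) := by rw [← hxn]; ring
  rw [h5]
  linarith

theorem ax_norm_R {v : E} {w : F} (hv : ‖v‖ = 1) (hw : ‖w‖ = 1) (t : ℂ) :
    ‖t‖ ≤ ‖t • axR w v‖ := by
  have := (t • axR w v).le_opNorm v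
  have hvv : inner ℂ v v = (1:ℂ) := by
    rw [inner_self_eq_norm_sq_to_K, hv]; simp
  simpa [hvv, norm_smul, hv, hw] using this

theorem ax_close {a b : E} {μ : ℝ} (ha : ‖a‖ ≤ 1) (hb : ‖b‖ = 1)
    (h : 1 - μ ≤ (inner ℂ a b : ℂ).re) : ‖a - b‖ ≤ Real.sqrt (2 * μ) := by
  apply Real.le_sqrt_of_sq_le
  have h3 := @norm_sub_sq ℂ _ _ _ _ a b
  have h4 : RCLike.re (inner ℂ a b : ℂ) = (inner ℂ a b : ℂ).re := rfl
  rw [h3, hb, h4]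
  nlinarith [norm_nonneg a]

theorem AxPH.core {g : (E →L[ℂ] F) → (E' →L[ℂ] F')} (hg : AxPH g) {v : E} {w : F}
    (hv : ‖v‖ = 1) (hw : ‖w‖ = 1) {ρ : ℝ} (hρ : ρ < 1) {η : ℝ} (hη : 0 < η) :
    ∃ r < 1, ∀ t : ℂ, r < ‖t‖ → ‖t‖ < 1 → ∃ (x : E') (y : F'), ‖x‖ = 1 ∧ ‖y‖ = 1 ∧
      1 - η ≤ ‖g (t • axR w v) x‖ ∧ ∀ W, AxSlice v w W → ‖W‖ ≤ ρ →
        ‖(g (t • axR w v + W) - g (t • axR w v)) x‖ ≤ η ∧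
        ‖ContinuousLinearMap.adjoint (g (t • axR w v + W) - g (t • axR w v)) y‖ ≤ η := by
  wlog hρ2 : 1/2 ≤ ρ generalizing ρ
  · obtain ⟨r, hr, H⟩ := this (ρ := 1/2) (by norm_num) le_rfl
    refine ⟨r, hr, fun t h1 h2 => ?_⟩
    obtain ⟨x, y, hx, hy, hxy, h3⟩ := H t h1 h2
    exact ⟨x, y, hx, hy, hxy, fun W hW hWρ => h3 W hW (by linarith)⟩
  have hρ0 : 0 < ρ := by linarith
  set R := ρ⁻¹ with hR
  have hR1 : 1 < R := (one_lt_inv₀ hρ0).2 hρ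
  set C := 1 + 2 / (R - 1) with hC
  have hR1' : 0 < R - 1 := by linarith
  have hCp : 0 < C := by positivity
  set η' := min (min η (1/2)) (η^2 / (8 * C)) with hη'
  have hη'p : 0 < η' := by positivity
  have hη1 : η' ≤ η := (min_le_left _ _).trans (min_le_left _ _)
  have hη2 : η' ≤ 1/2 := (min_le_left _ _).trans (min_le_right _ _)
  have hη3 : 8 * (η' * C) ≤ η^2 := by
    have : η' ≤ η^2 / (8 * C) := min_le_right _ _
    rw [le_div_iff₀ (by positivity)] at this
    linarith
  obtain ⟨r, hr, hrb⟩ := hg.proper (1 - η') (by linarith)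
  refine ⟨r, hr, fun t ht1 ht2 => ?_⟩
  set Z := t • axR w v with hZ
  have hin : ∀ W : E →L[ℂ] F, AxSlice v w W → ‖W‖ < 1 → ‖Z + W‖ < 1 := fun W hW hW1 =>
    (ax_norm_slice hv hw hW t (le_max_left _ ‖W‖) (le_max_right _ _)).trans_lt (max_lt ht2 hW1)
  have hZ1 : ‖Z‖ < 1 := by simpa using hin 0 AxSlice.zero (by simp)
  set c := ‖g Z‖ with hc
  have hc1 : c < 1 := hg.maps Z hZ1
  have hc2 : 1 - η' < c := by
    by_contra h
    have := hrb Z hZ1 (not_lt.1 h)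
    have := ax_norm_R hv hw t
    linarith
  have hc0 : 0 < c := by linarith
  obtain ⟨x, hx, hxn⟩ := ax_exists_norming (g Z) hc0
  set y : F' := ((c⁻¹ : ℝ) : ℂ) • g Z x with hy
  have hyn : ‖y‖ = 1 := by
    rw [hy, norm_smul, hxn, Complex.norm_real, Real.norm_eq_abs, abs_of_pos (inv_pos.2 hc0)]
    exact inv_mul_cancel₀ hc0.ne'
  have hyx : inner ℂ y (g Z x) = (c : ℂ) := by
    rw [hy, inner_smul_left, inner_self_eq_norm_sq_to_K, hxn, Complex.conj_ofReal]
    have : (c:ℂ) ≠ 0 := by exact_mod_cast hc0.ne'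
    simp only [Complex.ofReal_inv, ← hc]
    change (c:ℂ)⁻¹ * (c:ℂ)^2 = c
    field_simp
  have hcon : ∀ W : E →L[ℂ] F, AxSlice v w W → ‖W‖ ≤ ρ →
      1 - C * η' ≤ (inner ℂ y (g (Z + W) x) : ℂ).re := by
    intro W hW hWρ
    let k : ℂ → ℂ := fun s => inner ℂ y (g (Z + s • W) x) - c
    have hin' : ∀ s : ℂ, ‖s‖ < R → ‖Z + s • W‖ < 1 := by
      intro s hs
      apply hin _ (hW.smul s)
      rw [norm_smul]
      calc ‖s‖ * ‖W‖ ≤ ‖s‖ * ρ := by gcongr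
        _ < R * ρ := by gcongr
        _ = 1 := inv_mul_cancel₀ hρ0.ne'
    have hkd : DifferentiableOn ℂ k (Metric.ball 0 R) := by
      intro s hs
      have hs' : ‖s‖ < R := by simpa using hs
      apply DifferentiableAt.differentiableWithinAt
      apply DifferentiableAt.sub_const
      have h1 : DifferentiableAt ℂ (fun s : ℂ => g (Z + s • W)) s :=
        (hg.diffAt (hin' s hs')).comp s (by fun_prop)
      exact (innerSL ℂ y).differentiableAt.comp s (h1.clm_apply (differentiableAt_const x))
    have hkm : Set.MapsTo k (Metric.ball 0 R) {z | z.re ≤ 1 - c} := by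
      intro s hs
      have hs' : ‖s‖ < R := by simpa using hs
      have h1 : ‖g (Z + s • W) x‖ ≤ 1 := by
        have h2 := (g (Z + s • W)).le_opNorm x
        rw [hx, mul_one] at h2
        linarith [hg.maps _ (hin' s hs')]
      have h3 : ‖(inner ℂ y (g (Z + s • W) x) : ℂ)‖ ≤ 1 := by
        have := norm_inner_le_norm (𝕜 := ℂ) y (g (Z + s • W) x)
        rw [hyn, one_mul] at this
        linarith
      have h4 := (Complex.abs_re_le_norm _).trans h3
      have h5 := (abs_le.1 h4).2
      simp only [k, Set.mem_ofPred_eq, Complex.sub_re, Complex.ofReal_re]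
      linarith
    have hb := Complex.borelCaratheodory_zero (M := 1 - c) (z := 1) (by linarith) hkd hkm
      (by linarith) (by simpa using hR1) (by simp [k, hyx])
    rw [norm_one, mul_one] at hb
    have h1 : -(2 * (1 - c) / (R - 1)) ≤ (k 1).re :=
      (abs_le.1 ((Complex.abs_re_le_norm _).trans hb)).1
    have h2 : (k 1).re = (inner ℂ y (g (Z + W) x) : ℂ).re - c := by simp [k]
    have h3 : 2 * (1 - c) / (R - 1) ≤ 2 / (R-1) * η' := by
      rw [div_mul_eq_mul_div]
      gcongr
      linarith
    have h4 : C * η' = η' + 2 / (R-1) * η' := by rw [hC]; ring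
    linarith
  have hsq : Real.sqrt (2 * (C * η')) ≤ η / 2 := by
    rw [Real.sqrt_le_left (by positivity)]
    nlinarith
  have hx1 : ∀ W : E →L[ℂ] F, AxSlice v w W → ‖W‖ ≤ ρ → ‖g (Z + W) x - y‖ ≤ η/2 := by
    intro W hW hWρ
    refine (ax_close (μ := C * η') ?_ hyn ?_).trans hsq
    · have h2 := (g (Z + W)).le_opNorm x
      rw [hx, mul_one] at h2
      linarith [hg.maps _ (hin W hW (by linarith))]
    · have := hcon W hW hWρ
      rwa [← inner_conj_symm, Complex.conj_re]
  have hy1 : ∀ W : E →L[ℂ] F, AxSlice v w W → ‖W‖ ≤ ρ →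
      ‖ContinuousLinearMap.adjoint (g (Z + W)) y - x‖ ≤ η/2 := by
    intro W hW hWρ
    refine (ax_close (μ := C * η') ?_ hx ?_).trans hsq
    · have h2 := (ContinuousLinearMap.adjoint (g (Z + W))).le_opNorm y
      rw [hyn, mul_one, LinearIsometryEquiv.norm_map] at h2
      linarith [hg.maps _ (hin W hW (by linarith))]
    · rw [ContinuousLinearMap.adjoint_inner_left]
      exact hcon W hW hWρ
  refine ⟨x, y, hx, hyn, by rw [hxn]; linarith, fun W hW hWρ => ⟨?_, ?_⟩⟩
  · have h1 := hx1 W hW hWρ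
    have h2 := hx1 0 AxSlice.zero (by simpa using hρ0.le)
    rw [add_zero] at h2
    have : (g (Z + W) - g Z) x = (g (Z + W) x - y) - (g Z x - y) := by
      rw [_root_.sub_apply]; abel
    rw [this]
    exact (norm_sub_le _ _).trans (by linarith)
  · have h1 := hy1 W hW hWρ
    have h2 := hy1 0 AxSlice.zero (by simpa using hρ0.le)
    rw [add_zero] at h2
    have : ContinuousLinearMap.adjoint (g (Z + W) - g Z) y
        = (ContinuousLinearMap.adjoint (g (Z + W)) y - x)
          - (ContinuousLinearMap.adjoint (g Z) y - x) := by
      rw [map_sub, _root_.sub_apply]; abel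
    rw [this]
    exact (norm_sub_le _ _).trans (by linarith)

theorem ax_finset_bound {ι : Type*} (s : Finset ι) (a : ι → ℝ) (h : ∀ i ∈ s, a i < 1) :
    ∃ ρ < 1, ∀ i ∈ s, a i ≤ ρ := by
  classical
  induction s using Finset.induction_on with
  | empty => exact ⟨0, one_pos, by simp⟩
  | insert i s hi ih =>
    obtain ⟨ρ, h1, h2⟩ := ih fun j hj => h j (Finset.mem_insert_of_mem hj)
    refine ⟨max ρ (a i), max_lt h1 (h i (Finset.mem_insert_self _ _)), ?_⟩
    intro j hj
    rcases Finset.mem_insert.1 hj with rfl | hj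
    · exact le_max_right _ _
    · exact (h2 j hj).trans (le_max_left _ _)

/-- holomorphy along the disc -/
theorem AxPH.disc_diff {g : (E →L[ℂ] F) → (E' →L[ℂ] F')} (hg : AxPH g) {v : E} {w : F}
    (hv : ‖v‖ = 1) (hw : ‖w‖ = 1) {W : E →L[ℂ] F} (hW : AxSlice v w W) (hW1 : ‖W‖ < 1) :
    DifferentiableOn ℂ (fun t : ℂ => g (t • axR w v + W)) (Metric.ball 0 1) := by
  intro t ht
  have ht' : ‖t‖ < 1 := by simpa using ht
  have h1 : ‖t • axR w v + W‖ < 1 :=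
    (ax_norm_slice hv hw hW t (le_max_left _ ‖W‖) (le_max_right _ _)).trans_lt (max_lt ht' hW1)
  exact ((hg.diffAt h1).comp t (by fun_prop)).differentiableWithinAt

theorem AxPH.disc_norm {g : (E →L[ℂ] F) → (E' →L[ℂ] F')} (hg : AxPH g) {v : E} {w : F}
    (hv : ‖v‖ = 1) (hw : ‖w‖ = 1) {W : E →L[ℂ] F} (hW : AxSlice v w W) (hW1 : ‖W‖ < 1)
    {t : ℂ} (ht : ‖t‖ < 1) : ‖g (t • axR w v + W)‖ < 1 :=
  hg.maps _ ((ax_norm_slice hv hw hW t (le_max_left _ ‖W‖) (le_max_right _ _)).trans_lt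
    (max_lt ht hW1))

theorem AxPH.B0_v {g : (E →L[ℂ] F) → (E' →L[ℂ] F')} (hg : AxPH g) {v : E} {w : F}
    (hv : ‖v‖ = 1) (hw : ‖w‖ = 1) :
    ∃ v' : E', v' ≠ 0 ∧ ∀ W, AxSlice v w W → ‖W‖ < 1 → (g W - g 0) v' = 0 := by
  by_contra hno
  push Not at hno
  let ι := {W : E →L[ℂ] F // AxSlice v w W ∧ ‖W‖ < 1}
  obtain ⟨s, Λ, hΛ⟩ := ax_select (ι := ι) (fun W => g W.1 - g 0) (ContinuousLinearMap.id ℂ E')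
    (by
      intro x hx
      by_contra hx0
      obtain ⟨W, h1, h2, h3⟩ := hno x (by simpa using hx0)
      exact h3 (hx ⟨W, h1, h2⟩))
  let M : ℂ → (E' →L[ℂ] E') := fun t =>
    ∑ W ∈ s, (Λ W) ∘L (g (t • axR w v + W.1) - g (t • axR w v + 0))
  have hM0 : M 0 = ContinuousLinearMap.id ℂ E' := by
    ext x
    rw [hΛ x]
    simp [M]
  have hd := ax_det_lemma M ?_ (∑ W ∈ s, ‖Λ W‖ * 2) ?_ ?_
  · rw [hM0] at hd
    simp at hd
  · refine DifferentiableOn.fun_sum fun W _ => ?_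
    have h1 := (hg.disc_diff hv hw W.2.1 W.2.2).sub (hg.disc_diff hv hw AxSlice.zero (by simp))
    exact (differentiableOn_const (Λ W)).clm_comp h1
  · intro t ht
    refine (norm_sum_le _ _).trans (Finset.sum_le_sum fun W _ => ?_)
    refine (ContinuousLinearMap.opNorm_comp_le _ _).trans ?_
    gcongr
    have := hg.disc_norm hv hw W.2.1 W.2.2 ht
    have := hg.disc_norm hv hw AxSlice.zero (by simp) ht
    exact (norm_sub_le _ _).trans (by linarith)
  · intro η hη
    obtain ⟨ρ, hρ, hρs⟩ := ax_finset_bound s (fun W => ‖W.1‖) (fun W _ => W.2.2)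
    set S := ∑ W ∈ s, ‖Λ W‖ with hS
    have hS0 : 0 ≤ S := Finset.sum_nonneg fun W _ => norm_nonneg _
    obtain ⟨r, hr, H⟩ := hg.core hv hw hρ (η := η / (S + 1)) (by positivity)
    refine ⟨r, hr, fun t h1 h2 => ?_⟩
    obtain ⟨x, y, hx, -, -, h3⟩ := H t h1 h2
    refine ⟨x, hx, Or.inl ?_⟩
    have : ‖M t x‖ ≤ S * (η / (S + 1)) := by
      simp only [M, _root_.sum_apply, hS, Finset.sum_mul]
      refine (norm_sum_le _ _).trans (Finset.sum_le_sum fun W hW => ?_)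
      rw [ContinuousLinearMap.comp_apply, add_zero]
      refine ((Λ W).le_opNorm _).trans ?_
      gcongr
      exact (h3 W.1 W.2.1 (hρs W hW)).1
    refine this.trans ?_
    rw [mul_div_assoc', div_le_iff₀ (by positivity)]
    nlinarith

theorem AxPH.B0_w {g : (E →L[ℂ] F) → (E' →L[ℂ] F')} (hg : AxPH g) {v : E} {w : F}
    (hv : ‖v‖ = 1) (hw : ‖w‖ = 1) :
    ∃ w' : F', w' ≠ 0 ∧ ∀ W, AxSlice v w W → ‖W‖ < 1 → ∀ y, inner ℂ w' ((g W - g 0) y) = 0 := by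
  by_contra hno
  push Not at hno
  let ι := {W : E →L[ℂ] F // AxSlice v w W ∧ ‖W‖ < 1}
  obtain ⟨s, Λ, hΛ⟩ := ax_select (ι := ι)
    (fun W => ContinuousLinearMap.adjoint (g W.1 - g 0)) (ContinuousLinearMap.id ℂ F')
    (by
      intro x hx
      by_contra hx0
      obtain ⟨W, h1, h2, y, h3⟩ := hno x (by simpa using hx0)
      apply h3
      rw [← ContinuousLinearMap.adjoint_inner_left, hx ⟨W, h1, h2⟩, inner_zero_left])
  let M : ℂ → (F' →L[ℂ] F') := fun t =>
    ∑ W ∈ s, (g (t • axR w v + W.1) - g (t • axR w v + 0)) ∘L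
      (ContinuousLinearMap.adjoint (Λ W))
  have hadj : ∀ t, ContinuousLinearMap.adjoint (M t) =
      ∑ W ∈ s, (Λ W) ∘L
        ContinuousLinearMap.adjoint (g (t • axR w v + W.1) - g (t • axR w v + 0)) := by
    intro t
    simp only [M, map_sum, ContinuousLinearMap.adjoint_comp, ContinuousLinearMap.adjoint_adjoint]
  have hM0 : M 0 = ContinuousLinearMap.id ℂ F' := by
    have h1 : ContinuousLinearMap.adjoint (M 0) = ContinuousLinearMap.id ℂ F' := by
      rw [hadj]
      ext x
      rw [hΛ x]
      simp
    rw [← ContinuousLinearMap.adjoint_adjoint (M 0), h1, ContinuousLinearMap.adjoint_id]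
  have hd := ax_det_lemma M ?_ (∑ W ∈ s, 2 * ‖Λ W‖) ?_ ?_
  · rw [hM0] at hd
    simp at hd
  · refine DifferentiableOn.fun_sum fun W _ => ?_
    have h1 := (hg.disc_diff hv hw W.2.1 W.2.2).sub (hg.disc_diff hv hw AxSlice.zero (by simp))
    exact h1.clm_comp (differentiableOn_const (ContinuousLinearMap.adjoint (Λ W)))
  · intro t ht
    refine (norm_sum_le _ _).trans (Finset.sum_le_sum fun W _ => ?_)
    refine (ContinuousLinearMap.opNorm_comp_le _ _).trans ?_
    rw [LinearIsometryEquiv.norm_map]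
    gcongr
    have := hg.disc_norm hv hw W.2.1 W.2.2 ht
    have := hg.disc_norm hv hw AxSlice.zero (by simp) ht
    exact (norm_sub_le _ _).trans (by linarith)
  · intro η hη
    obtain ⟨ρ, hρ, hρs⟩ := ax_finset_bound s (fun W => ‖W.1‖) (fun W _ => W.2.2)
    set S := ∑ W ∈ s, ‖Λ W‖ with hS
    have hS0 : 0 ≤ S := Finset.sum_nonneg fun W _ => norm_nonneg _
    obtain ⟨r, hr, H⟩ := hg.core hv hw hρ (η := η / (S + 1)) (by positivity)
    refine ⟨r, hr, fun t h1 h2 => ?_⟩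
    obtain ⟨x, y, -, hy, -, h3⟩ := H t h1 h2
    refine ⟨y, hy, Or.inr ?_⟩
    have : ‖ContinuousLinearMap.adjoint (M t) y‖ ≤ S * (η / (S + 1)) := by
      rw [hadj]
      simp only [_root_.sum_apply, hS, Finset.sum_mul]
      refine (norm_sum_le _ _).trans (Finset.sum_le_sum fun W hW => ?_)
      rw [ContinuousLinearMap.comp_apply, add_zero]
      refine ((Λ W).le_opNorm _).trans ?_
      gcongr
      exact (h3 W.1 W.2.1 (hρs W hW)).2
    refine this.trans ?_
    rw [mul_div_assoc', div_le_iff₀ (by positivity)]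
    nlinarith
end


/-! ### Moebius transformations -/
section
variable {E F E' F' : Type*} [NormedAddCommGroup E] [InnerProductSpace ℂ E]
  [FiniteDimensional ℂ E] [CompleteSpace E]
  [NormedAddCommGroup F] [InnerProductSpace ℂ F] [FiniteDimensional ℂ F] [CompleteSpace F]
  [NormedAddCommGroup E'] [InnerProductSpace ℂ E'] [FiniteDimensional ℂ E'] [CompleteSpace E']
  [NormedAddCommGroup F'] [InnerProductSpace ℂ F'] [FiniteDimensional ℂ F'] [CompleteSpace F']

theorem ax_sqrt (A : E →L[ℂ] E) (hA : A.IsPositive)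
  (hinj : ∀ x, A x = 0 → x = 0) :
  ∃ Q Qi : E →L[ℂ] E, (∀ x y, inner ℂ (Q x) y = inner ℂ x (Q y)) ∧ (∀ x, Q (Q x) = A x) ∧
    (∀ x, Q (Qi x) = x) ∧ (∀ x, Qi (Q x) = x) := by
  have h0 : 0 ≤ A := (ContinuousLinearMap.nonneg_iff_isPositive A).2 hA
  obtain ⟨Q, hs, hn⟩ : ∃ Q : E →L[ℂ] E, Q * Q = A ∧ Q.IsPositive :=
    ⟨CFC.sqrt A, CFC.sqrt_mul_sqrt_self A h0,
      (ContinuousLinearMap.nonneg_iff_isPositive _).1 (CFC.sqrt_nonneg A)⟩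
  have hQQ : ∀ x, Q (Q x) = A x := fun x => by
    conv_rhs => rw [← hs]
    rfl
  have hi : Function.Injective (Q : E →ₗ[ℂ] E) := by
    rw [injective_iff_map_eq_zero]
    intro x hx
    apply hinj
    rw [← hQQ]
    simp only [ContinuousLinearMap.coe_coe] at hx
    rw [hx, map_zero]
  let e := (LinearEquiv.ofInjectiveEndo _ hi)
  refine ⟨Q, e.symm.toLinearMap.toContinuousLinearMap, fun x y => hn.isSymmetric x y, hQQ, ?_, ?_⟩
  · intro x
    exact e.apply_symm_apply x
  · intro x
    exact e.symm_apply_apply x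

theorem ax_sqrt_one_sub (B : E →L[ℂ] F) (hB : ‖B‖ < 1) :
  ∃ Q Qi : E →L[ℂ] E, (∀ x y, inner ℂ (Q x) y = inner ℂ x (Q y)) ∧
    (∀ x, Q (Q x) = x - ContinuousLinearMap.adjoint B (B x)) ∧
    (∀ x, Q (Qi x) = x) ∧ (∀ x, Qi (Q x) = x) ∧ (∀ x, ‖Q x‖ ^ 2 = ‖x‖ ^ 2 - ‖B x‖ ^ 2) := by
  have key : ∀ x : E, inner ℂ (x - ContinuousLinearMap.adjoint B (B x)) x
      = ((‖x‖ ^ 2 - ‖B x‖ ^ 2 : ℝ) : ℂ) := by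
    intro x
    rw [inner_sub_left, ContinuousLinearMap.adjoint_inner_left, inner_self_eq_norm_sq_to_K,
      inner_self_eq_norm_sq_to_K]
    push_cast; rfl
  have hBx : ∀ x, ‖B x‖ ≤ ‖B‖ * ‖x‖ := B.le_opNorm
  obtain ⟨Q, Qi, h1, h2, h3, h4⟩ := ax_sqrt (ContinuousLinearMap.id ℂ E - (ContinuousLinearMap.adjoint B).comp B)
    (by
      rw [ContinuousLinearMap.isPositive_iff_complex]
      intro x
      have := key x
      simp only [_root_.sub_apply, ContinuousLinearMap.id_apply, ContinuousLinearMap.comp_apply]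
      rw [this]
      refine ⟨congrArg _ (Complex.ofReal_re _), ?_⟩
      have h := hBx x
      have : ‖B x‖ ≤ ‖x‖ := h.trans (by nlinarith [norm_nonneg x])
      simp only [RCLike.re_to_complex, Complex.ofReal_re]
      nlinarith [norm_nonneg x, norm_nonneg (B x)])
    (by
      intro x hx
      have := key x
      simp only [_root_.sub_apply, ContinuousLinearMap.id_apply, ContinuousLinearMap.comp_apply] at hx
      rw [hx, inner_zero_left] at this
      have h5 : ‖x‖ ^ 2 - ‖B x‖ ^ 2 = 0 := by exact_mod_cast this.symm
      by_contra hne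
      have hp := norm_pos_iff.2 hne
      have h := hBx x
      have : ‖B x‖ < ‖x‖ := h.trans_lt (by nlinarith)
      nlinarith [norm_nonneg (B x)])
  simp only [_root_.sub_apply, ContinuousLinearMap.id_apply, ContinuousLinearMap.comp_apply] at h2
  refine ⟨Q, Qi, h1, h2, h3, h4, fun x => ?_⟩
  have := key x
  rw [← h2, h1, inner_self_eq_norm_sq_to_K] at this
  apply Complex.ofReal_injective
  rw [← this]
  push_cast
  rfl

theorem ax_mobius_data (B : E →L[ℂ] F) (hB : ‖B‖ < 1) :
  ∃ (Q Qi : E →L[ℂ] E) (P Pi : F →L[ℂ] F) (C : F →L[ℂ] E),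
    (∀ x y, inner ℂ (P x) y = inner ℂ x (P y)) ∧
    (∀ x, Q (Qi x) = x) ∧ (∀ x, Qi (Q x) = x) ∧ (∀ x, P (Pi x) = x) ∧ (∀ x, Pi (P x) = x) ∧
    (∀ ξ η, ‖ξ‖ ^ 2 + ‖η‖ ^ 2 = ‖B ξ + P η‖ ^ 2 + ‖Q ξ - C η‖ ^ 2) ∧ ‖C‖ ≤ 1 := by
  obtain ⟨Q, Qi, q1, q2, q3, q4, q5⟩ := ax_sqrt_one_sub B hB
  obtain ⟨P, Pi, p1, p2, p3, p4, p5⟩ := ax_sqrt_one_sub (ContinuousLinearMap.adjoint B) (by simpa using hB)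
  simp only [ContinuousLinearMap.adjoint_adjoint] at p2
  have hC : ∀ η, ‖P η‖ ^ 2 + ‖Qi (ContinuousLinearMap.adjoint B (P η))‖ ^ 2 = ‖η‖ ^ 2 := by
    intro η
    obtain ⟨ζ, rfl⟩ : ∃ ζ, P ζ = η := ⟨_, p3 η⟩
    have e1 : Qi (ContinuousLinearMap.adjoint B (P (P ζ))) = Q (ContinuousLinearMap.adjoint B ζ) := by
      rw [p2, map_sub, ← q2, q4]
    rw [e1, q5, p5 ζ, p2, @norm_sub_sq ℂ]
    have : inner ℂ ζ (B (ContinuousLinearMap.adjoint B ζ)) = ((‖ContinuousLinearMap.adjoint B ζ‖ ^ 2 : ℝ) : ℂ) := by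
      rw [← ContinuousLinearMap.adjoint_inner_left, inner_self_eq_norm_sq_to_K]
      push_cast; rfl
    rw [this]
    simp only [RCLike.re_to_complex, Complex.ofReal_re]
    ring
  refine ⟨Q, Qi, P, Pi, Qi.comp ((ContinuousLinearMap.adjoint B).comp P), p1, q3, q4, p3, p4, ?_, ?_⟩
  · intro ξ η
    simp only [ContinuousLinearMap.comp_apply]
    rw [@norm_add_sq ℂ, @norm_sub_sq ℂ, q1, q3, ContinuousLinearMap.adjoint_inner_right, q5]
    linarith [hC η]
  · apply ContinuousLinearMap.opNorm_le_bound _ zero_le_one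
    intro η
    simp only [ContinuousLinearMap.comp_apply, one_mul]
    have := hC η
    exact abs_le_of_sq_le_sq' (by nlinarith [sq_nonneg ‖P η‖]) (norm_nonneg _) |>.2


theorem ax_inv_of_inj (U : E →L[ℂ] E) (h : ∀ x, U x = 0 → x = 0) :
    ∃ V : E →L[ℂ] E, U * V = 1 ∧ V * U = 1 := by
  have hi : Function.Injective (U : E →ₗ[ℂ] E) := by
    rw [injective_iff_map_eq_zero]
    intro x hx
    exact h x hx
  let e := (LinearEquiv.ofInjectiveEndo _ hi)
  refine ⟨e.symm.toLinearMap.toContinuousLinearMap, ?_, ?_⟩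
  · ext x
    exact e.apply_symm_apply x
  · ext x
    exact e.symm_apply_apply x

theorem ax_norm_lt_one (A : E →L[ℂ] F) (h : ∀ x, x ≠ 0 → ‖A x‖ < ‖x‖) : ‖A‖ < 1 := by
  by_contra hc
  push Not at hc
  obtain ⟨x, hx, hx2⟩ := ax_exists_norming A (by linarith)
  have := h x (by rintro rfl; simp at hx)
  linarith

theorem ax_mobius (B : E →L[ℂ] F) (hB : ‖B‖ < 1) : ∃ φ : (E →L[ℂ] F) → (E →L[ℂ] F),
    φ 0 = B ∧ DifferentiableOn ℂ φ (Metric.ball 0 1) ∧ (∀ W, ‖W‖ < 1 → ‖φ W‖ < 1) ∧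
    (∀ r : ℝ, r < 1 → ∃ r' : ℝ, r' < 1 ∧ ∀ W, ‖W‖ < 1 → ‖φ W‖ ≤ r → ‖W‖ ≤ r') ∧
    (∀ (v : E) (w : F), v ≠ 0 → w ≠ 0 → ∃ (v1 : E) (w1 : F), v1 ≠ 0 ∧ w1 ≠ 0 ∧
      ∀ A, ‖B + A‖ < 1 → AxSlice v w A → ∃ W, ‖W‖ < 1 ∧ AxSlice v1 w1 W ∧ φ W = B + A) ∧
    Function.Injective (fderiv ℂ φ 0) := by
  obtain ⟨Q, Qi, P, Pi, C, hP, q1, q2, p1, p2, hid, hC⟩ := ax_mobius_data B hB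
  have hunit : ∀ W : E →L[ℂ] F, ‖W‖ < 1 → IsUnit (1 + C.comp W) := by
    intro W hW
    have : ‖-(C.comp W)‖ < 1 := by
      rw [norm_neg]
      calc _ ≤ ‖C‖ * ‖W‖ := C.opNorm_comp_le W
        _ ≤ 1 * ‖W‖ := by gcongr
        _ < 1 := by linarith
    have h := isUnit_one_sub_of_norm_lt_one this
    rwa [sub_neg_eq_add] at h
  let φ : (E →L[ℂ] F) → (E →L[ℂ] F) := fun W =>
    B + (P.comp W).comp ((Ring.inverse (1 + C.comp W)).comp Q)
  have hd : ∀ W : E →L[ℂ] F, ‖W‖ < 1 →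
      DifferentiableAt ℂ (fun W : E →L[ℂ] F => Ring.inverse (1 + C.comp W)) W := by
    intro W hW
    have h1 : DifferentiableAt ℂ (Ring.inverse : (E →L[ℂ] E) → (E →L[ℂ] E)) (1 + C.comp W) :=
      differentiableAt_inverse (hunit W hW)
    have h2 : DifferentiableAt ℂ (fun W : E →L[ℂ] F => 1 + C.comp W) W :=
      ((differentiableAt_const C).clm_comp differentiableAt_id).const_add 1
    exact h1.comp W h2
  have hpar : ∀ W : E →L[ℂ] F, ‖W‖ < 1 → ∀ ξ, ∃ y, ξ = Qi (y + C (W y)) ∧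
      φ W ξ = B ξ + P (W y) := by
    intro W hW ξ
    refine ⟨Ring.inverse (1 + C.comp W) (Q ξ), ?_, by simp [φ]⟩
    have := Ring.mul_inverse_cancel _ (hunit W hW)
    have h2 := congrArg (fun T : E →L[ℂ] E => T (Q ξ)) this
    simp at h2
    rw [h2, q2]
  have hpar2 : ∀ W : E →L[ℂ] F, ‖W‖ < 1 → ∀ ξ, ∃ y, ξ = Qi (y + C (W y)) ∧
      φ W ξ = B ξ + P (W y) ∧ ‖ξ‖ ^ 2 + ‖W y‖ ^ 2 = ‖φ W ξ‖ ^ 2 + ‖y‖ ^ 2 := by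
    intro W hW ξ
    obtain ⟨y, h1, h2⟩ := hpar W hW ξ
    refine ⟨y, h1, h2, ?_⟩
    rw [h2, hid ξ (W y)]
    congr 3
    rw [h1, q1]; abel
  have hpar3 : ∀ W : E →L[ℂ] F, ‖W‖ < 1 → ∀ y, 
      φ W (Qi (y + C (W y))) = B (Qi (y + C (W y))) + P (W y) := by
    intro W hW y
    have := Ring.inverse_mul_cancel _ (hunit W hW)
    have h2 := congrArg (fun T : E →L[ℂ] E => T y) this
    simp only [mul_apply_eq_comp, one_apply_eq_self, _root_.add_apply, ContinuousLinearMap.comp_apply] at h2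
    simp only [φ, _root_.add_apply, ContinuousLinearMap.comp_apply, q1, h2]
  refine ⟨φ, ?_, ?_, ?_, ?_, ?_, ?_⟩
  · simp [φ]
  · intro W hW
    have hW : ‖W‖ < 1 := by simpa using hW
    apply DifferentiableAt.differentiableWithinAt
    apply DifferentiableAt.const_add
    apply DifferentiableAt.clm_comp
    · exact (differentiableAt_const P).clm_comp differentiableAt_id
    · exact (hd W hW).clm_comp (differentiableAt_const Q)
  · intro W hW
    apply ax_norm_lt_one
    intro ξ hξ
    obtain ⟨y, h1, h2, h3⟩ := hpar2 W hW ξ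
    have hy : y ≠ 0 := by rintro rfl; apply hξ; rw [h1]; simp
    have hy' := norm_pos_iff.2 hy
    have : ‖W y‖ < ‖y‖ := (W.le_opNorm y).trans_lt (by nlinarith)
    exact abs_lt_of_sq_lt_sq' (by nlinarith [norm_nonneg (W y)]) (norm_nonneg _) |>.2
  · intro r hr
    by_cases hr0 : r < 0
    · exact ⟨0, one_pos, fun W hW h => absurd h (by have := norm_nonneg (φ W); linarith)⟩
    push Not at hr0
    set K : ℝ := 4 * ‖Pi‖ ^ 2 + 1 with hK
    have hK1 : 1 ≤ K := by nlinarith [sq_nonneg ‖Pi‖]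
    have hδ : 0 < (1 - r ^ 2) / K := by apply div_pos <;> nlinarith
    have hδ1 : (1 - r ^ 2) / K ≤ 1 := by rw [div_le_one (by linarith)]; nlinarith
    refine ⟨Real.sqrt (1 - (1 - r ^ 2) / K), ?_, ?_⟩
    · rw [Real.sqrt_lt' one_pos]; linarith
    · intro W hW h
      apply ContinuousLinearMap.opNorm_le_bound _ (Real.sqrt_nonneg _)
      intro y
      have hb : ‖φ W‖ < 1 := by linarith
      obtain ⟨ξ, hξ⟩ : ∃ ξ, ξ = Qi (y + C (W y)) := ⟨_, rfl⟩
      have h2 : φ W ξ = B ξ + P (W y) := by rw [hξ]; exact hpar3 W hW y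
      have h3 : ‖ξ‖ ^ 2 + ‖W y‖ ^ 2 = ‖φ W ξ‖ ^ 2 + ‖y‖ ^ 2 := by
        rw [h2, hid ξ (W y)]
        congr 3
        rw [hξ, q1]; abel
      have h4 : ‖φ W ξ‖ ≤ r * ‖ξ‖ := (ContinuousLinearMap.le_opNorm _ _).trans (by gcongr)
      have h5 : ‖W y‖ ≤ ‖Pi‖ * (2 * ‖ξ‖) := by
        have : W y = Pi (φ W ξ - B ξ) := by rw [h2]; simp [p2]
        rw [this]
        refine (ContinuousLinearMap.le_opNorm _ _).trans ?_
        gcongr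
        refine (norm_sub_le _ _).trans ?_
        have := B.le_opNorm ξ
        nlinarith [norm_nonneg ξ]
      have h6 : ‖W y‖ ^ 2 ≤ 4 * ‖Pi‖ ^ 2 * ‖ξ‖ ^ 2 := by
        calc _ ≤ (‖Pi‖ * (2 * ‖ξ‖)) ^ 2 := by gcongr
          _ = _ := by ring
      have h7 : ‖φ W ξ‖ ^ 2 ≤ r ^ 2 * ‖ξ‖ ^ 2 := by
        calc _ ≤ (r * ‖ξ‖) ^ 2 := by gcongr
          _ = _ := by ring
      have h8 : ‖y‖ ^ 2 ≤ K * ‖ξ‖ ^ 2 := by nlinarith [sq_nonneg ‖φ W ξ‖]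
      have h9 : (1 - r ^ 2) / K * ‖y‖ ^ 2 ≤ (1 - r ^ 2) * ‖ξ‖ ^ 2 := by
        calc _ ≤ (1 - r ^ 2) / K * (K * ‖ξ‖ ^ 2) := by gcongr
          _ = _ := by field_simp
      have h10 : ‖W y‖ ^ 2 ≤ (1 - (1 - r ^ 2) / K) * ‖y‖ ^ 2 := by nlinarith
      calc ‖W y‖ = Real.sqrt (‖W y‖ ^ 2) := by rw [Real.sqrt_sq (norm_nonneg _)]
        _ ≤ Real.sqrt ((1 - (1 - r ^ 2) / K) * ‖y‖ ^ 2) := Real.sqrt_le_sqrt h10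
        _ = _ := by rw [Real.sqrt_mul (by linarith), Real.sqrt_sq (norm_nonneg _)]
  · intro v w hv hw
    refine ⟨Q v, P w, ?_, ?_, ?_⟩
    · intro h; apply hv; rw [← q2 v, h, map_zero]
    · intro h; apply hw; rw [← p2 w, h, map_zero]
    · intro A hA hs
      obtain ⟨W', hW'⟩ : ∃ W' : E →L[ℂ] F, ∀ y, W' y = Pi (A (Qi y)) :=
        ⟨Pi.comp (A.comp Qi), fun y => rfl⟩
      have key : ∀ y, ‖Qi y‖ ^ 2 + ‖W' y‖ ^ 2 = ‖(B + A) (Qi y)‖ ^ 2 + ‖y - C (W' y)‖ ^ 2 := by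
        intro y
        rw [hid (Qi y) (W' y), q1, hW', p1]
        rfl
      have hlt : ∀ y, y ≠ 0 → ‖(B + A) (Qi y)‖ < ‖Qi y‖ := by
        intro y hy
        have : Qi y ≠ 0 := by intro h; apply hy; rw [← q1 y, h, map_zero]
        have := norm_pos_iff.2 this
        exact (ContinuousLinearMap.le_opNorm _ _).trans_lt (by nlinarith)
      obtain ⟨V, hV1, hV2⟩ := ax_inv_of_inj (1 - C.comp W') (by
        intro y hy
        by_contra hne
        have h1 := hlt y hne
        have h2 := key y
        have h3 : y - C (W' y) = 0 := by simpa using hy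
        rw [h3] at h2
        simp only [norm_zero] at h2
        nlinarith [sq_nonneg ‖W' y‖, norm_nonneg ((B + A) (Qi y))])
      have hV1' : ∀ y, V y - C (W' (V y)) = y := fun y => by
        have := congrArg (fun T : E →L[ℂ] E => T y) hV1
        simpa using this
      have hV2' : ∀ y, V (y - C (W' y)) = y := fun y => by
        have := congrArg (fun T : E →L[ℂ] E => T y) hV2
        simpa using this
      have hW1 : ‖W'.comp V‖ < 1 := by
        apply ax_norm_lt_one
        intro y hy
        have hz : V y ≠ 0 := by intro h; apply hy; rw [← hV1' y, h]; simp
        have h1 := hlt _ hz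
        have h2 := key (V y)
        rw [hV1'] at h2
        simp only [ContinuousLinearMap.comp_apply]
        exact abs_lt_of_sq_lt_sq' (by nlinarith [norm_nonneg ((B + A) (Qi (V y)))]) (norm_nonneg _) |>.2
      refine ⟨W'.comp V, hW1, ⟨?_, ?_⟩, ?_⟩
      · have : V (Q v) = Q v := by
          have h := hV2' (Q v)
          rwa [hW', q2, hs.1, map_zero, map_zero, sub_zero] at h
        rw [ContinuousLinearMap.comp_apply, this, hW', q2, hs.1, map_zero]
      · intro y
        rw [ContinuousLinearMap.comp_apply, hP, hW', p1]
        exact hs.2 _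
      · ext ξ
        have hinv := hpar3 (W'.comp V) hW1 (Q ξ - C (W' (Q ξ)))
        simp only [ContinuousLinearMap.comp_apply, hV2', sub_add_cancel, q2] at hinv
        rw [hinv, hW', p1, q2]
        rfl
  · have h1 : HasFDerivAt (fun W : E →L[ℂ] F => P.comp W) (ContinuousLinearMap.compL ℂ E F F P) 0 :=
      (ContinuousLinearMap.compL ℂ E F F P).hasFDerivAt
    have h2 : DifferentiableAt ℂ (fun W : E →L[ℂ] F => (Ring.inverse (1 + C.comp W)).comp Q) 0 :=
      (hd 0 (by simp)).clm_comp (differentiableAt_const Q)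
    have h3 := (h1.clm_comp h2.hasFDerivAt).const_add B
    have h4 : fderiv ℂ φ 0 = _ := h3.fderiv
    rw [injective_iff_map_eq_zero, h4]
    intro A hA
    simp at hA
    ext x
    have := congrArg (fun T : E →L[ℂ] F => Pi (T (Qi x))) hA
    simpa [p2, q1] using this

end


/-! ### Recentering and slices through arbitrary points -/
section
variable {E F E' F' : Type*} [NormedAddCommGroup E] [InnerProductSpace ℂ E]
  [FiniteDimensional ℂ E] [CompleteSpace E]
  [NormedAddCommGroup F] [InnerProductSpace ℂ F] [FiniteDimensional ℂ F] [CompleteSpace F]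
  [NormedAddCommGroup E'] [InnerProductSpace ℂ E'] [FiniteDimensional ℂ E'] [CompleteSpace E']
  [NormedAddCommGroup F'] [InnerProductSpace ℂ F'] [FiniteDimensional ℂ F'] [CompleteSpace F']

theorem AxPH.recenter {f : (E →L[ℂ] F) → (E' →L[ℂ] F')} (hf : AxPH f) (B : E →L[ℂ] F) (hB : ‖B‖ < 1) :
    ∃ g : (E →L[ℂ] F) → (E' →L[ℂ] F'), AxPH g ∧ g 0 = f B ∧
      (Function.Injective (fderiv ℂ f B) → Function.Injective (fderiv ℂ g 0)) ∧
      ∀ (v : E) (w : F), v ≠ 0 → w ≠ 0 → ∃ (v1 : E) (w1 : F), v1 ≠ 0 ∧ w1 ≠ 0 ∧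
      ∀ A, ‖B + A‖ < 1 → AxSlice v w A → ∃ W, ‖W‖ < 1 ∧ AxSlice v1 w1 W ∧ g W = f (B + A) := by
  obtain ⟨φ, h0, hd, hm, hp, hs, hi⟩ := ax_mobius B hB
  refine ⟨f ∘ φ, ⟨?_, ?_, ?_⟩, by simp [h0], ?_, ?_⟩
  · apply hf.diff.comp hd
    intro W hW
    simpa using hm W (by simpa using hW)
  · exact fun Z hZ => hf.maps _ (hm Z hZ)
  · intro ρ hρ
    obtain ⟨r, hr, h⟩ := hf.proper ρ hρ
    obtain ⟨r', hr', h'⟩ := hp r hr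
    exact ⟨r', hr', fun Z hZ hZ2 => h' Z hZ (h _ (hm Z hZ) hZ2)⟩
  · intro hinj
    have d1 : DifferentiableAt ℂ φ 0 := hd.differentiableAt (Metric.ball_mem_nhds _ one_pos)
    have d2 : DifferentiableAt ℂ f (φ 0) := by rw [h0]; exact hf.diffAt hB
    rw [fderiv_comp _ d2 d1, h0]
    exact hinj.comp hi
  · intro v w hv hw
    obtain ⟨v1, w1, hv1, hw1, h⟩ := hs v w hv hw
    refine ⟨v1, w1, hv1, hw1, fun A hA hs => ?_⟩
    obtain ⟨W, a, b, c⟩ := h A hA hs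
    exact ⟨W, a, b, by simp [c]⟩

theorem AxSlice.scale {v : E} {w : F} {W : E →L[ℂ] F} (h : AxSlice v w W) (a b : ℂ) :
    AxSlice (a • v) (b • w) W :=
  ⟨by rw [map_smul, h.1, smul_zero], fun y => by rw [inner_smul_left, h.2, mul_zero]⟩

theorem AxPH.lemB {f : (E →L[ℂ] F) → (E' →L[ℂ] F')} (hf : AxPH f) {B : E →L[ℂ] F} (hB : ‖B‖ < 1)
    {v : E} {w : F} (hv : v ≠ 0) (hw : w ≠ 0) :
    (∃ v' : E', v' ≠ 0 ∧ ∀ A, ‖B + A‖ < 1 → AxSlice v w A → (f (B + A) - f B) v' = 0) ∧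
    (∃ w' : F', w' ≠ 0 ∧ ∀ A, ‖B + A‖ < 1 → AxSlice v w A →
      ∀ y, inner ℂ w' ((f (B + A) - f B) y) = 0) := by
  obtain ⟨g, hg, h0, -, h⟩ := hf.recenter B hB
  obtain ⟨v1, w1, hv1, hw1, h⟩ := h v w hv hw
  have hv2 : ‖((‖v1‖⁻¹ : ℝ) : ℂ) • v1‖ = 1 := by
    rw [norm_smul]; simp [norm_ne_zero_iff.2 hv1]
  have hw2 : ‖((‖w1‖⁻¹ : ℝ) : ℂ) • w1‖ = 1 := by
    rw [norm_smul]; simp [norm_ne_zero_iff.2 hw1]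
  obtain ⟨v', hv', hv''⟩ := hg.B0_v hv2 hw2
  obtain ⟨w', hw', hw''⟩ := hg.B0_w hv2 hw2
  refine ⟨⟨v', hv', fun A hA hs => ?_⟩, ⟨w', hw', fun A hA hs => ?_⟩⟩
  · obtain ⟨W, a, b, c⟩ := h A hA hs
    rw [← c, ← h0]
    exact hv'' W (b.scale _ _) a
  · obtain ⟨W, a, b, c⟩ := h A hA hs
    rw [← c, ← h0]
    exact hw'' W (b.scale _ _) a

theorem ax_deriv_zero {X Y G : Type*} [NormedAddCommGroup X] [NormedSpace ℂ X]
    [NormedAddCommGroup Y] [NormedSpace ℂ Y] [NormedAddCommGroup G] [NormedSpace ℂ G]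
    {f : X → Y} {B A : X} (hf : DifferentiableAt ℂ f B) (ψ : Y →L[ℂ] G)
    (h : ∀ᶠ t : ℂ in nhds 0, ψ (f (B + t • A)) = ψ (f B)) : ψ (fderiv ℂ f B A) = 0 := by
  have h1 := (hf.hasFDerivAt.hasLineDerivAt A)
  have h2 : HasDerivAt (fun t : ℂ => ψ (f (B + t • A))) (ψ (fderiv ℂ f B A)) 0 :=
    ψ.hasFDerivAt.comp_hasDerivAt (0 : ℂ) h1
  have h3 : HasDerivAt (fun t : ℂ => ψ (f (B + t • A))) 0 0 :=
    (hasDerivAt_const (0 : ℂ) (ψ (f B))).congr_of_eventuallyEq h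
  exact h2.unique h3

theorem ax_near {X : Type*} [NormedAddCommGroup X] [NormedSpace ℂ X] {B A : X} (hB : ‖B‖ < 1) :
    ∀ᶠ t : ℂ in nhds 0, ‖B + t • A‖ < 1 := by
  have : Filter.Tendsto (fun t : ℂ => ‖B + t • A‖) (nhds 0) (nhds ‖B + (0 : ℂ) • A‖) :=
    Continuous.tendsto (by fun_prop) 0
  rw [zero_smul, add_zero] at this
  exact this.eventually (gt_mem_nhds hB)

theorem AxPH.lemB' {f : (E →L[ℂ] F) → (E' →L[ℂ] F')} (hf : AxPH f) {B : E →L[ℂ] F} (hB : ‖B‖ < 1)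
    {v : E} {w : F} (hv : v ≠ 0) (hw : w ≠ 0) :
    ∃ (v' : E') (w' : F'), v' ≠ 0 ∧ w' ≠ 0 ∧
      (∀ A, ‖B + A‖ < 1 → AxSlice v w A → (f (B + A) - f B) v' = 0) ∧
      ∀ A, AxSlice v w A → fderiv ℂ f B A v' = 0 ∧ ∀ y, inner ℂ w' (fderiv ℂ f B A y) = 0 := by
  obtain ⟨⟨v', hv', h1⟩, w', hw', h2⟩ := hf.lemB hB hv hw
  refine ⟨v', w', hv', hw', h1, fun A hA => ⟨?_, fun y => ?_⟩⟩
  · apply ax_deriv_zero (hf.diffAt hB) (ContinuousLinearMap.apply ℂ F' v')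
    filter_upwards [ax_near (A := A) hB] with t ht
    have := h1 _ ht (hA.smul t)
    simpa [sub_eq_zero] using this
  · apply ax_deriv_zero (hf.diffAt hB) ((innerSL ℂ w').comp (ContinuousLinearMap.apply ℂ F' y))
    filter_upwards [ax_near (A := A) hB] with t ht
    have := h2 _ ht (hA.smul t) y
    simpa [sub_eq_zero, inner_sub_right] using this

/-- injectivity of the derivative is stable near the origin -/
theorem AxPH.inj_near {f : (E →L[ℂ] F) → (E' →L[ℂ] F')} (hf : AxPH f)
    (h : Function.Injective (fderiv ℂ f 0)) :
    ∃ ε : ℝ, 0 < ε ∧ ε ≤ 1 ∧ ∀ Z, ‖Z‖ < ε → Function.Injective (fderiv ℂ f Z) := by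
  have hc := ax_fderiv_cont f hf.diff
  have ho : IsOpen {L : (E →L[ℂ] F) →L[ℂ] (E' →L[ℂ] F') | Function.Injective L} :=
    ContinuousLinearMap.isOpen_injective
  have := hc.eventually (ho.mem_nhds h)
  obtain ⟨ε, hε, h2⟩ := Metric.eventually_nhds_iff.1 this
  refine ⟨min ε 1, by positivity, min_le_right _ _, fun Z hZ => h2 ?_⟩
  rw [dist_zero_right]
  exact hZ.trans_le (min_le_left _ _)

end


/-! ### Linear algebra of the differential -/
section
variable {E F E' F' : Type*} [NormedAddCommGroup E] [InnerProductSpace ℂ E]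
  [FiniteDimensional ℂ E] [CompleteSpace E]
  [NormedAddCommGroup F] [InnerProductSpace ℂ F] [FiniteDimensional ℂ F] [CompleteSpace F]
  [NormedAddCommGroup E'] [InnerProductSpace ℂ E'] [FiniteDimensional ℂ E'] [CompleteSpace E']
  [NormedAddCommGroup F'] [InnerProductSpace ℂ F'] [FiniteDimensional ℂ F'] [CompleteSpace F']

theorem ax_mem_orth {ι : Type*} (w : ι → F) (y : F) :
    y ∈ (Submodule.span ℂ (Set.range w))ᗮ ↔ ∀ i, inner ℂ (w i) y = 0 := by
  constructor
  · intro h i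
    exact (Submodule.mem_orthogonal _ _).1 h _ (Submodule.subset_span ⟨i, rfl⟩)
  · intro h
    rw [Submodule.mem_orthogonal]
    intro u hu
    induction hu using Submodule.span_induction with
    | mem x hx => obtain ⟨i, rfl⟩ := hx; exact h i
    | zero => simp
    | add a b _ _ ha hb => rw [inner_add_left, ha, hb, add_zero]
    | smul c a _ ha => rw [inner_smul_left, ha, mul_zero]

theorem ax_zero_on_span {ι : Type*} (x : ι → E) (A : E →L[ℂ] F) (h : ∀ i, A (x i) = 0) {u : E}
    (hu : u ∈ Submodule.span ℂ (Set.range x)) : A u = 0 := by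
  induction hu using Submodule.span_induction with
  | mem x hx => obtain ⟨i, rfl⟩ := hx; exact h i
  | zero => simp
  | add a b _ _ ha hb => rw [map_add, ha, hb, add_zero]
  | smul c a _ ha => rw [map_smul, ha, smul_zero]

theorem ax_dimF (L : (E →L[ℂ] F) →L[ℂ] (E' →L[ℂ] F')) (hL : Function.Injective L)
    {ι κ ι' κ' : Type} [Fintype ι] [Fintype κ] [Fintype ι'] [Fintype κ']
    {x : ι → E} {w : κ → F} {x' : ι' → E'} {w' : κ' → F'}
    (hx : LinearIndependent ℂ x) (hw : LinearIndependent ℂ w)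
    (hx' : LinearIndependent ℂ x') (hw' : LinearIndependent ℂ w')
    (h : ∀ A, (∀ i, A (x i) = 0) → (∀ i y, inner ℂ (w i) (A y) = 0) →
      (∀ i, L A (x' i) = 0) ∧ ∀ i y, inner ℂ (w' i) (L A y) = 0) :
    (Module.finrank ℂ E - Fintype.card ι) * (Module.finrank ℂ F - Fintype.card κ) ≤
    (Module.finrank ℂ E' - Fintype.card ι') * (Module.finrank ℂ F' - Fintype.card κ') := by
  let V := Submodule.span ℂ (Set.range x)
  let W := Submodule.span ℂ (Set.range w)
  let V' := Submodule.span ℂ (Set.range x')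
  let W' := Submodule.span ℂ (Set.range w')
  have dV := Submodule.finrank_add_finrank_orthogonal V
  have dW := Submodule.finrank_add_finrank_orthogonal W
  have dV' := Submodule.finrank_add_finrank_orthogonal V'
  have dW' := Submodule.finrank_add_finrank_orthogonal W'
  rw [finrank_span_eq_card hx] at dV
  rw [finrank_span_eq_card hw] at dW
  rw [finrank_span_eq_card hx'] at dV'
  rw [finrank_span_eq_card hw'] at dW'
  have e1 : Module.finrank ℂ E - Fintype.card ι = Module.finrank ℂ Vᗮ := by omega
  have e2 : Module.finrank ℂ F - Fintype.card κ = Module.finrank ℂ Wᗮ := by omega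
  have e3 : Module.finrank ℂ E' - Fintype.card ι' = Module.finrank ℂ V'ᗮ := by omega
  have e4 : Module.finrank ℂ F' - Fintype.card κ' = Module.finrank ℂ W'ᗮ := by omega
  rw [e1, e2, e3, e4, ← Module.finrank_linearMap ℂ ℂ, ← Module.finrank_linearMap ℂ ℂ]
  let a : (Vᗮ →ₗ[ℂ] Wᗮ) → (E →L[ℂ] F) := fun T =>
    ((Wᗮ).subtypeL).comp ((LinearMap.toContinuousLinearMap T).comp (Vᗮ).orthogonalProjectionOnto)
  have ha : ∀ T z, a T z = (T ((Vᗮ).orthogonalProjectionOnto z) : F) := fun T z => rfl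
  let Φ : (Vᗮ →ₗ[ℂ] Wᗮ) →ₗ[ℂ] (V'ᗮ →ₗ[ℂ] W'ᗮ) :=
    { toFun := fun T => (((W'ᗮ).orthogonalProjectionOnto.comp (L (a T))).comp (V'ᗮ).subtypeL : V'ᗮ →L[ℂ] W'ᗮ)
      map_add' := by
        intro T1 T2
        have : a (T1 + T2) = a T1 + a T2 := by ext z; simp [ha]
        rw [this, map_add]
        ext z; simp
      map_smul' := by
        intro c T
        have : a (c • T) = c • a T := by ext z; simp [ha]
        rw [this, map_smul]
        ext z; simp }
  apply LinearMap.finrank_le_finrank_of_injective (f := Φ)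
  rw [injective_iff_map_eq_zero]
  intro T hT
  have h0 := h (a T) (by
    intro i
    rw [ha]
    have : (Vᗮ).orthogonalProjectionOnto (x i) = 0 := by
      rw [Submodule.orthogonalProjectionOnto_eq_zero_iff]
      apply Submodule.le_orthogonal_orthogonal
      exact Submodule.subset_span ⟨i, rfl⟩
    rw [this, map_zero]; rfl) (by
    intro i y
    rw [ha]
    exact (ax_mem_orth w _).1 (T _).2 i)
  have hz : L (a T) = 0 := by
    ext z
    have h1 : ∀ u ∈ V'ᗮ, L (a T) u = 0 := by
      intro u hu
      have h2 : (W'ᗮ).orthogonalProjectionOnto (L (a T) u) = 0 :=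
        congrArg (fun S : V'ᗮ →ₗ[ℂ] W'ᗮ => S ⟨u, hu⟩) hT
      have h3 : L (a T) u ∈ W'ᗮ := (ax_mem_orth w' _).2 (fun i => h0.2 i u)
      have h4 := Submodule.orthogonalProjectionOnto_mem_subspace_eq_self (⟨_, h3⟩ : W'ᗮ)
      rw [h2] at h4
      exact (congrArg Subtype.val h4).symm
    obtain ⟨y, hy, u, hu, rfl⟩ := Submodule.exists_add_mem_mem_orthogonal (K := V') z
    rw [map_add, h1 u hu, ax_zero_on_span x' _ h0.1 hy]
    simp
  have hz' : a T = 0 := hL (by rw [hz, map_zero])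
  ext z
  have := congrArg (fun S : E →L[ℂ] F => S z) hz'
  simp only [ha] at this
  rw [Submodule.orthogonalProjectionOnto_mem_subspace_eq_self] at this
  simpa using this

/-- the dimension hypotheses in the critical case -/
structure AxDims (E F E' F' : Type*) [NormedAddCommGroup E] [InnerProductSpace ℂ E]
    [NormedAddCommGroup F] [InnerProductSpace ℂ F]
    [NormedAddCommGroup E'] [InnerProductSpace ℂ E']
    [NormedAddCommGroup F'] [InnerProductSpace ℂ F'] (k l q : ℕ) : Prop where
  hE : Module.finrank ℂ E = q
  hF : Module.finrank ℂ F = q + k + 2 * l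
  hE' : Module.finrank ℂ E' = q + l
  hF' : Module.finrank ℂ F' = q + k + l
  hl : 1 ≤ l
  hq : l * (k + l) + 2 * k + 4 * l + 3 ≤ q

/-- the property of the differential coming from the boundary behaviour -/
def AxH (L : (E →L[ℂ] F) →L[ℂ] (E' →L[ℂ] F')) : Prop :=
  ∀ (v : E) (w : F), v ≠ 0 → w ≠ 0 → ∃ (v' : E') (w' : F'), v' ≠ 0 ∧ w' ≠ 0 ∧
    ∀ A, AxSlice v w A → L A v' = 0 ∧ ∀ y, inner ℂ w' (L A y) = 0

theorem ax_LI_one {v : E} (hv : v ≠ 0) : LinearIndependent ℂ ![v] := by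
  rw [linearIndependent_unique_iff]; simpa using hv

theorem ax_LI_zero : LinearIndependent ℂ (![] : Fin 0 → E) := linearIndependent_empty_type

theorem ax_ne_of_dim (h : 0 < Module.finrank ℂ E) : ∃ x : E, ‖x‖ = 1 := by
  have := Module.nontrivial_of_finrank_pos h
  obtain ⟨x, hx⟩ := exists_ne (0 : E)
  exact ⟨((‖x‖⁻¹ : ℝ) : ℂ) • x, by rw [norm_smul]; simp [norm_ne_zero_iff.2 hx]⟩

variable {k l q : ℕ} {L : (E →L[ℂ] F) →L[ℂ] (E' →L[ℂ] F')}

theorem axC_unique (D : AxDims E F E' F' k l q) (hL : Function.Injective L) (hH : AxH L)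
    {x : E} {w : F} (hx : x ≠ 0) (hw : w ≠ 0) {a b : E'} (ha : a ≠ 0)
    (hka : ∀ A, AxSlice x w A → L A a = 0) (hkb : ∀ A, AxSlice x w A → L A b = 0) :
    ∃ c : ℂ, b = c • a := by
  by_contra hc
  push Not at hc
  obtain ⟨v', w', hv', hw', h⟩ := hH x w hx hw
  have hli : LinearIndependent ℂ ![a, b] := (LinearIndependent.pair_iff' ha).2 fun c h => hc c h.symm
  have := ax_dimF L hL (ax_LI_one hx) (ax_LI_one hw) hli (ax_LI_one hw') (by
    intro A h1 h2
    have hs : AxSlice x w A := ⟨h1 0, h2 0⟩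
    refine ⟨?_, ?_⟩
    · intro i; fin_cases i
      · exact hka A hs
      · exact hkb A hs
    · intro i y; fin_cases i; exact (h A hs).2 y)
  rw [D.hE, D.hF, D.hE', D.hF'] at this
  simp only [Fintype.card_fin] at this
  have hq := D.hq
  have hl := D.hl
  obtain ⟨q, rfl⟩ : ∃ r, q = r + 2 := ⟨q - 2, by omega⟩
  have e1 : q + 2 + k + 2 * l - 1 = q + 1 + k + 2 * l := by omega
  have e2 : q + 2 + l - 2 = q + l := by omega
  have e3 : q + 2 + k + l - 1 = q + 1 + k + l := by omega
  have e4 : q + 2 - 1 = q + 1 := by omega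
  rw [e1, e2, e3, e4] at this
  nlinarith

theorem axC_kill (D : AxDims E F E' F' k l q) (hL : Function.Injective L) (hH : AxH L)
    {x : E} (hx : x ≠ 0) : ∃ v' : E', v' ≠ 0 ∧ ∀ A, A x = 0 → L A v' = 0 := by
  by_contra hc
  push Not at hc
  have hq := D.hq
  have hl := D.hl
  let b := stdOrthonormalBasis ℂ F
  let w : Fin (l + 2) → F := fun i => b (Fin.castLE (by rw [D.hF]; omega) i)
  have hw : Orthonormal ℂ w := b.orthonormal.comp _ (Fin.castLE_injective _)
  have hw0 : ∀ i, w i ≠ 0 := hw.ne_zero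
  choose v' w' hv' hw' h using fun i => hH x (w i) hx (hw0 i)
  have hli : LinearIndependent ℂ v' := by
    rw [linearIndependent_iff_notMem_span]
    intro i hi
    obtain ⟨A, hA, hne⟩ := hc (v' i) (hv' i)
    apply hne
    have h1 : L (A - (axR (w i) (w i)).comp A) (v' i) = 0 := by
      refine (h i _ ⟨by simp [hA], fun y => ?_⟩).1
      simp [inner_sub_right, hw.1 i]
    have h2 : L ((axR (w i) (w i)).comp A) (v' i) = 0 := by
      have : v' '' (Set.univ \ {i}) = Set.range (fun j : {j // j ≠ i} => v' j) := by
        ext z; simp [Set.mem_image]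
      rw [this] at hi
      refine ax_zero_on_span _ _ ?_ hi
      rintro ⟨j, hj⟩
      refine (h j _ ⟨by simp [hA], fun y => ?_⟩).1
      simp [hw.2 hj]
    rw [map_sub, _root_.sub_apply, h2, sub_zero] at h1
    exact h1
  have := ax_dimF L hL (ax_LI_one hx) hw.linearIndependent hli (ax_LI_one (hw' 0)) (by
    intro A h1 h2
    refine ⟨fun i => (h i A ⟨h1 0, h2 i⟩).1, ?_⟩
    intro i y
    fin_cases i
    exact (h 0 A ⟨h1 0, h2 0⟩).2 y)
  rw [D.hE, D.hF, D.hE', D.hF'] at this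
  simp only [Fintype.card_fin] at this
  obtain ⟨q, rfl⟩ : ∃ r, q = r + 2 := ⟨q - 2, by omega⟩
  have e1 : q + 2 + k + 2 * l - (l + 2) = q + k + l := by omega
  have e2 : q + 2 + l - (l + 2) = q := by omega
  have e3 : q + 2 + k + l - 1 = q + 1 + k + l := by omega
  have e4 : q + 2 - 1 = q + 1 := by omega
  rw [e1, e2, e3, e4] at this
  nlinarith

/-- no nonzero vector is killed by all `L A` -/
theorem axC_nokill (D : AxDims E F E' F' k l q) (hL : Function.Injective L)
    {a : E'} (h : ∀ A, L A a = 0) : a = 0 := by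
  by_contra ha
  have := ax_dimF L hL ax_LI_zero ax_LI_zero (ax_LI_one ha) ax_LI_zero (by
    intro A h1 h2
    refine ⟨?_, fun i => i.elim0⟩
    intro i; fin_cases i; exact h A)
  rw [D.hE, D.hF, D.hE', D.hF'] at this
  simp only [Fintype.card_fin] at this
  have hq := D.hq
  have hl := D.hl
  obtain ⟨q, rfl⟩ : ∃ r, q = r + 2 := ⟨q - 2, by omega⟩
  have e2 : q + 2 + l - 1 = q + 1 + l := by omega
  simp only [Nat.sub_zero] at this
  rw [e2] at this
  nlinarith

theorem ax_functional {x y : E} (h : LinearIndependent ℂ ![x, y]) (a b : ℂ) :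
    ∃ f : E →L[ℂ] ℂ, f x = a ∧ f y = b := by
  have hx : x ∉ Submodule.span ℂ {y} := by
    intro hm
    obtain ⟨c, hc⟩ := Submodule.mem_span_singleton.1 hm
    have := (LinearIndependent.pair_iff.1 h) 1 (-c) (by rw [hc.symm]; simp)
    simp at this
  have hy : y ∉ Submodule.span ℂ {x} := by
    intro hm
    obtain ⟨c, hc⟩ := Submodule.mem_span_singleton.1 hm
    have := (LinearIndependent.pair_iff.1 h) (-c) 1 (by rw [hc.symm]; simp)
    simp at this
  obtain ⟨f, hf1, hf2⟩ := Submodule.exists_le_ker_of_notMem hx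
  obtain ⟨g, hg1, hg2⟩ := Submodule.exists_le_ker_of_notMem hy
  have hf3 : f y = 0 := hf2 (Submodule.mem_span_singleton_self y)
  have hg3 : g x = 0 := hg2 (Submodule.mem_span_singleton_self x)
  refine ⟨LinearMap.toContinuousLinearMap ((a / f x) • f + (b / g y) • g), ?_, ?_⟩
  · simp [hg3, hf1]
  · simp [hf3, hg1]

theorem axC_indep (D : AxDims E F E' F' k l q) (hL : Function.Injective L)
    {x y : E} (hxy : LinearIndependent ℂ ![x, y]) {a : E'} (h1 : ∀ A, A x = 0 → L A a = 0)
    (h2 : ∀ A, A y = 0 → L A a = 0) : a = 0 := by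
  apply axC_nokill D hL
  intro A
  obtain ⟨f, hf1, hf2⟩ := ax_functional hxy 1 0
  have e : A = (A - f.smulRight (A x)) + f.smulRight (A x) := by abel
  rw [e, map_add, _root_.add_apply, h1 _ (by simp [hf1]), h2 _ (by simp [hf2]), add_zero]

theorem axC_span (D : AxDims E F E' F' k l q) (hL : Function.Injective L)
    {x y : E} (hxy : LinearIndependent ℂ ![x, y]) {a b c : E'} (ha : a ≠ 0) (hb : b ≠ 0)
    (h1 : ∀ A, A x = 0 → L A a = 0)
    (h2 : ∀ A, A y = 0 → L A b = 0) (h3 : ∀ A, A (x + y) = 0 → L A c = 0) :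
    ∃ α β : ℂ, c = α • a + β • b := by
  by_contra hcon
  push Not at hcon
  have hab : LinearIndependent ℂ ![a, b] := by
    rw [LinearIndependent.pair_iff' ha]
    rintro d rfl
    have hd : d ≠ 0 := by rintro rfl; simp at hb
    apply ha
    refine axC_indep D hL hxy h1 (fun A hA => ?_)
    have := h2 A hA
    rw [map_smul] at this
    exact (smul_eq_zero.1 this).resolve_left hd
  have h3' : LinearIndependent ℂ (Fin.cons c ![a, b] : Fin 3 → E') := by
    rw [linearIndependent_finCons]
    refine ⟨hab, fun hm => ?_⟩
    obtain ⟨g, hg⟩ := (Submodule.mem_span_range_iff_exists_fun ℂ).1 hm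
    exact hcon (g 0) (g 1) (by rw [← hg]; simp)
  have := ax_dimF L hL hxy ax_LI_zero h3' ax_LI_zero (by
    intro A k1 k2
    have kx : A x = 0 := k1 0
    have ky : A y = 0 := k1 1
    refine ⟨?_, fun i => i.elim0⟩
    intro i; fin_cases i
    · exact h3 A (by rw [map_add, kx, ky, add_zero])
    · exact h1 A kx
    · exact h2 A ky)
  rw [D.hE, D.hF, D.hE', D.hF'] at this
  simp only [Fintype.card_fin] at this
  have hq := D.hq
  have hl := D.hl
  obtain ⟨q, rfl⟩ : ∃ r, q = r + 3 := ⟨q - 3, by omega⟩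
  have e2 : q + 3 + l - 3 = q + l := by omega
  have e4 : q + 3 - 2 = q + 1 := by omega
  simp only [Nat.sub_zero] at this
  rw [e2, e4] at this
  nlinarith

/-- structure of the differential -/
theorem axC_main (D : AxDims E F E' F' k l q) (hL : Function.Injective L) (hH : AxH L) :
    ∃ (S : E →ₗ[ℂ] E') (T : F →ₗ[ℂ] F'), Function.Injective S ∧
      (∀ A x, L A (S x) = T (A x)) ∧ (∃ w : F, ‖w‖ = 1 ∧ T w = 0) ∧
      ∀ (x : E) (w : F) (v' : E'), x ≠ 0 → w ≠ 0 → (∀ A, AxSlice x w A → L A v' = 0) →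
        ∃ c : ℂ, v' = c • S x := by
  have hq := D.hq
  have hl := D.hl
  obtain ⟨x0, hx0⟩ := ax_ne_of_dim (E := E) (by rw [D.hE]; omega)
  have hx0' : x0 ≠ 0 := by rintro rfl; simp at hx0
  obtain ⟨a0, ha0, hk0⟩ := axC_kill D hL hH hx0'
  let T : F →ₗ[ℂ] F' :=
    { toFun := fun u => L (axR u x0) a0
      map_add' := by
        intro u v
        have : axR (u + v) x0 = axR u x0 + axR v x0 := by ext z; simp
        rw [this, map_add]; rfl
      map_smul' := by
        intro c u
        have : axR (c • u) x0 = c • axR u x0 := by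
          ext z; rw [axR_apply, _root_.smul_apply, axR_apply, smul_comm]
        rw [this, map_smul]; rfl }
  have hT0 : ∀ A, L A a0 = T (A x0) := by
    intro A
    have := hk0 (A - axR (A x0) x0) (by simp [hx0])
    rw [map_sub, _root_.sub_apply, sub_eq_zero] at this
    exact this
  have hex : ∀ x, ∃ a, ∀ A, L A a = T (A x) := by
    intro x
    by_cases hx : ∃ c : ℂ, c • x0 = x
    · obtain ⟨c, rfl⟩ := hx
      exact ⟨c • a0, fun A => by rw [map_smul, map_smul, map_smul, hT0]⟩
    push Not at hx
    have hli : LinearIndependent ℂ ![x0, x] := (LinearIndependent.pair_iff' hx0').2 hx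
    have hxn : x ≠ 0 := fun h => hx 0 (by simp [h])
    have hsn : x0 + x ≠ 0 := fun h => hx (-1) (by
      rw [neg_one_smul]; exact (neg_eq_of_add_eq_zero_right h))
    obtain ⟨b, hb, hkb⟩ := axC_kill D hL hH hxn
    obtain ⟨c, hc, hkc⟩ := axC_kill D hL hH hsn
    obtain ⟨α, β, hαβ⟩ := axC_span D hL hli ha0 hb hk0 hkb hkc
    have hα : α ≠ 0 := by
      rintro rfl
      rw [zero_smul, zero_add] at hαβ
      have hl2 : LinearIndependent ℂ ![x0 + x, x] := by
        rw [LinearIndependent.pair_iff] at hli ⊢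
        intro s t hst
        have := hli s (s + t) (by rw [← hst]; module)
        refine ⟨this.1, ?_⟩
        simpa [this.1] using this.2
      exact hc (axC_indep D hL hl2 hkc (fun A hA => by rw [hαβ, map_smul, hkb A hA, smul_zero]))
    have key : ∀ A, α • T (A x) = β • L A b := by
      intro A
      obtain ⟨f, hf1, hf2⟩ := ax_functional hli (-1) 1
      have h1 := hkc (f.smulRight (A x)) (by simp [hf1, hf2])
      have h2 := hkb (A - f.smulRight (A x)) (by simp [hf2])
      rw [hαβ, map_add, map_smul, map_smul, hT0] at h1
      rw [map_sub, _root_.sub_apply, sub_eq_zero] at h2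
      rw [← h2] at h1
      simp only [ContinuousLinearMap.smulRight_apply, hf1, neg_smul, one_smul, map_neg, smul_neg] at h1
      exact (neg_add_eq_zero.1 h1)
    refine ⟨(β / α) • b, fun A => ?_⟩
    rw [map_smul, div_eq_inv_mul, mul_smul, ← key, smul_smul, inv_mul_cancel₀ hα, one_smul]
  choose s hs using hex
  have huniq : ∀ a b, (∀ A, L A a = L A b) → a = b := by
    intro a b h
    rw [← sub_eq_zero]
    exact axC_nokill D hL (fun A => by rw [map_sub, h, sub_self])
  let S : E →ₗ[ℂ] E' :=
    { toFun := s
      map_add' := fun x y => huniq _ _ fun A => by rw [map_add, hs, hs, hs, map_add, map_add]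
      map_smul' := fun c x => huniq _ _ fun A => by
        rw [RingHom.id_apply, map_smul, hs, hs, map_smul, map_smul] }
  have hS : ∀ A x, L A (S x) = T (A x) := fun A x => hs x A
  have hinj : Function.Injective S := by
    rw [injective_iff_map_eq_zero]
    intro x hx
    by_contra hne
    apply ha0
    apply axC_nokill D hL
    intro A
    rw [hT0]
    have h1 := hS (axR (A x0) x) x
    rw [hx, map_zero, axR_apply, map_smul] at h1
    exact (smul_eq_zero.1 h1.symm).resolve_left (by simpa using hne)
  refine ⟨S, T, hinj, hS, ?_, ?_⟩
  · have : T.ker ≠ ⊥ := by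
      intro h
      have := LinearMap.finrank_le_finrank_of_injective (LinearMap.ker_eq_bot.1 h)
      rw [D.hF, D.hF'] at this
      omega
    obtain ⟨w, hw, hw0⟩ := Submodule.exists_mem_ne_zero_of_ne_bot this
    refine ⟨((‖w‖⁻¹ : ℝ) : ℂ) • w, by rw [norm_smul]; simp [norm_ne_zero_iff.2 hw0], ?_⟩
    rw [map_smul, LinearMap.mem_ker.1 hw, smul_zero]
  · intro x w v' hx hw h
    refine axC_unique D hL hH hx hw (fun h0 => hx (hinj (by rw [h0, map_zero]))) (fun A hA => ?_) h
    rw [hS, hA.1, map_zero]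

end


/-! ### Local structure of the map -/
section
variable {E F E' F' : Type*} [NormedAddCommGroup E] [InnerProductSpace ℂ E]
  [FiniteDimensional ℂ E] [CompleteSpace E]
  [NormedAddCommGroup F] [InnerProductSpace ℂ F] [FiniteDimensional ℂ F] [CompleteSpace F]
  [NormedAddCommGroup E'] [InnerProductSpace ℂ E'] [FiniteDimensional ℂ E'] [CompleteSpace E']
  [NormedAddCommGroup F'] [InnerProductSpace ℂ F'] [FiniteDimensional ℂ F'] [CompleteSpace F']

variable {k l q : ℕ} {f : (E →L[ℂ] F) → (E' →L[ℂ] F')}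

theorem ax_exists_perp (h : Module.finrank ℂ E < Module.finrank ℂ F) (A : E →L[ℂ] F) :
    ∃ w : F, w ≠ 0 ∧ ∀ y, inner ℂ w (A y) = 0 := by
  have h1 := Submodule.finrank_add_finrank_orthogonal (A : E →ₗ[ℂ] F).range
  have h2 := LinearMap.finrank_range_le (A : E →ₗ[ℂ] F)
  have h3 : ((A : E →ₗ[ℂ] F).range)ᗮ ≠ ⊥ := by
    intro h4
    rw [h4] at h1
    simp only [finrank_bot] at h1
    omega
  obtain ⟨w, hw, hw0⟩ := Submodule.exists_mem_ne_zero_of_ne_bot h3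
  refine ⟨w, hw0, fun y => ?_⟩
  exact (Submodule.mem_orthogonal' _ _).1 hw _ ⟨y, rfl⟩

theorem AxPH.localS (hf : AxPH f) (D : AxDims E F E' F' k l q)
    (hinj : Function.Injective (fderiv ℂ f 0)) :
    ∃ (ε : ℝ) (S : (E →L[ℂ] F) → (E →ₗ[ℂ] E')), 0 < ε ∧ ε ≤ 1 ∧
      (∀ Z, ‖Z‖ < ε → Function.Injective (S Z)) ∧
      (∀ Z, ‖Z‖ < ε → ∀ A x, A x = 0 → ‖Z + A‖ < 1 → f (Z + A) (S Z x) = f Z (S Z x)) ∧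
      (∀ Z Z', ‖Z‖ < ε → ‖Z'‖ < ε → ∀ x, x ≠ 0 → Z x = Z' x → ∃ c : ℂ, c ≠ 0 ∧ S Z' x = c • S Z x) ∧
      (∃ w : F, ‖w‖ = 1 ∧ ∀ A x, A x = w → fderiv ℂ f 0 A (S 0 x) = 0) ∧
      (∀ (x : E) (w : F) (v' : E'), x ≠ 0 → w ≠ 0 → (∀ A, AxSlice x w A → fderiv ℂ f 0 A v' = 0) →
        ∃ c : ℂ, v' = c • S 0 x) := by
  obtain ⟨ε, hε, hε1, hi⟩ := hf.inj_near hinj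
  have hH : ∀ Z, ‖Z‖ < ε → AxH (fderiv ℂ f Z) := by
    intro Z hZ v w hv hw
    obtain ⟨v', w', a, b, -, c⟩ := hf.lemB' (hZ.trans_le hε1) hv hw
    exact ⟨v', w', a, b, c⟩
  have hex : ∀ Z, ∃ (S : E →ₗ[ℂ] E'), ‖Z‖ < ε → Function.Injective S ∧
      (∀ A x, A x = 0 → fderiv ℂ f Z A (S x) = 0) ∧
      (∃ w : F, ‖w‖ = 1 ∧ ∀ A x, A x = w → fderiv ℂ f Z A (S x) = 0) ∧
      ∀ (x : E) (w : F) (v' : E'), x ≠ 0 → w ≠ 0 → (∀ A, AxSlice x w A → fderiv ℂ f Z A v' = 0) →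
        ∃ c : ℂ, v' = c • S x := by
    intro Z
    by_cases hZ : ‖Z‖ < ε
    · obtain ⟨S, T, h1, h2, ⟨w, hw1, hw2⟩, h4⟩ := axC_main D (hi Z hZ) (hH Z hZ)
      exact ⟨S, fun _ => ⟨h1, fun A x h => by rw [h2, h, map_zero], ⟨w, hw1, fun A x h => by rw [h2, h, hw2]⟩, h4⟩⟩
    · exact ⟨0, fun h => absurd h hZ⟩
  choose S hS using hex
  have hq := D.hq
  have hl := D.hl
  have ha : ∀ Z, ‖Z‖ < ε → ∀ A x, A x = 0 → ‖Z + A‖ < 1 → f (Z + A) (S Z x) = f Z (S Z x) := by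
    intro Z hZ A x hAx hA
    by_cases hx : x = 0
    · simp [hx]
    obtain ⟨w, hw, hwA⟩ := ax_exists_perp (by rw [D.hE, D.hF]; omega) A
    obtain ⟨v', w', hv', hw', h1, h2⟩ := hf.lemB' (hZ.trans_le hε1) hx hw
    obtain ⟨c, hc⟩ := (hS Z hZ).2.2.2 x w v' hx hw (fun A hA => (h2 A hA).1)
    have hc0 : c ≠ 0 := by rintro rfl; simp at hc; exact hv' hc
    have := h1 A hA ⟨hAx, hwA⟩
    rw [hc, map_smul] at this
    have := (smul_eq_zero.1 this).resolve_left hc0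
    rwa [_root_.sub_apply, sub_eq_zero] at this
  refine ⟨ε, S, hε, hε1, fun Z hZ => (hS Z hZ).1, ha, ?_, (hS 0 (by simpa using hε)).2.2.1,
    (hS 0 (by simpa using hε)).2.2.2⟩
  intro Z Z' hZ hZ' x hx hxx
  obtain ⟨w, hw, -⟩ := ax_exists_perp (by rw [D.hE, D.hF]; omega) (0 : E →L[ℂ] F)
  have hk : ∀ A, AxSlice x w A → fderiv ℂ f Z' A (S Z x) = 0 := by
    intro A hA
    apply ax_deriv_zero (hf.diffAt (hZ'.trans_le hε1)) (ContinuousLinearMap.apply ℂ F' (S Z x))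
    filter_upwards [ax_near (A := A) (hZ'.trans_le hε1)] with t ht
    have e1 : Z' + t • A = Z + ((Z' - Z) + t • A) := by abel
    have e2 : f (Z' + t • A) (S Z x) = f Z (S Z x) := by
      rw [e1]
      apply ha Z hZ
      · simp [hxx, hA.1]
      · rw [← e1]; exact ht
    have e3 : f Z' (S Z x) = f Z (S Z x) := by
      have := ha Z hZ (Z' - Z) x (by simp [hxx]) (by simpa using hZ'.trans_le hε1)
      simpa using this
    simp only [ContinuousLinearMap.apply_apply]
    rw [e2, e3]
  obtain ⟨c, hc⟩ := (hS Z' hZ').2.2.2 x w _ hx hw hk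
  have hc0 : c ≠ 0 := by
    rintro rfl
    rw [zero_smul] at hc
    exact hx ((hS Z hZ).1 (by rw [hc, map_zero]))
  exact ⟨c⁻¹, inv_ne_zero hc0, by rw [hc, smul_smul, inv_mul_cancel₀ hc0, one_smul]⟩

theorem ax_additive {G : Type*} [NormedAddCommGroup G] [NormedSpace ℂ G] {e0 e1 e2 : E} {w : F}
    (h0 : ‖e0‖ = 1) (h1 : ‖e1‖ = 1) (h2 : ‖e2‖ = 1) (h01 : inner ℂ e0 e1 = 0) (h02 : inner ℂ e0 e2 = 0)
    (h12 : inner ℂ e1 e2 = 0) (hw : ‖w‖ = 1) {ε : ℝ} (hε : 0 < ε)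
    (Ψ : (E →L[ℂ] F) → (E →ₗ[ℂ] G))
    (hΨ : ∀ Z Z' x, ‖Z‖ < ε → ‖Z'‖ < ε → Z e0 = 0 → Z' e0 = 0 → inner ℂ e0 x = 0 → x ≠ 0 → Z x = Z' x →
      Ψ Z x = Ψ Z' x) (a0 : ℂ) (ha0 : ‖a0‖ < ε) (n : ℕ) :
    Ψ ((a0 / (n + 1)) • axR w e1) e1 = Ψ 0 e1 + (1 / (n + 1) : ℂ) • (Ψ (a0 • axR w e1) e1 - Ψ 0 e1) := by
  have h10 : inner ℂ e1 e0 = 0 := inner_eq_zero_symm.1 h01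
  have h20 : inner ℂ e2 e0 = 0 := inner_eq_zero_symm.1 h02
  have h21 : inner ℂ e2 e1 = 0 := inner_eq_zero_symm.1 h12
  have e1n : e1 ≠ 0 := by rintro rfl; simp at h1
  have e2n : e2 ≠ 0 := by rintro rfl; simp at h2
  have e12n : e1 + e2 ≠ 0 := by
    intro h
    have := congrArg (fun x => inner ℂ e1 x) h
    simp [inner_add_right, h12, h1] at this
  have hnorm : ∀ a b : ℂ, ‖a‖ + ‖b‖ < ε → ‖a • axR w e1 + b • axR w e2‖ < ε := by
    intro a b hab
    refine lt_of_le_of_lt (norm_add_le _ _) ?_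
    have m1 := ax_norm_slice h1 hw (AxSlice.zero (v := e1) (w := w)) a le_rfl (by simp)
    have m2 := ax_norm_slice h2 hw (AxSlice.zero (v := e2) (w := w)) b le_rfl (by simp)
    rw [add_zero] at m1 m2
    linarith
  have key : ∀ a b : ℂ, ‖a‖ + ‖b‖ < ε → Ψ ((a + b) • axR w e1) e1 - Ψ 0 e1
      = (Ψ (a • axR w e1) e1 - Ψ 0 e1) + (Ψ (b • axR w e1) e1 - Ψ 0 e1) := by
    have k2 : ∀ a b : ℂ, ‖a‖ + ‖b‖ < ε → Ψ (a • axR w e1) e1 + Ψ (b • axR w e2) e2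
        = Ψ ((a + b) • axR w e1) e1 + Ψ 0 e2 := by
      intro a b hab
      have n1 := hnorm a b hab
      have n2 : ‖a • axR w e1‖ < ε := by
        simpa using hnorm a 0 (by simp; linarith [norm_nonneg b])
      have n3 : ‖b • axR w e2‖ < ε := by
        simpa using hnorm 0 b (by simp; linarith [norm_nonneg a])
      have n4 : ‖(a + b) • axR w e1‖ < ε := by
        simpa using hnorm (a + b) 0 (by simp; linarith [norm_add_le a b])
      have i1 := hΨ _ _ e1 n1 n2 (by simp [h10, h20]) (by simp [h10]) h01 e1n (by simp [h21])
      have i2 := hΨ _ _ e2 n1 n3 (by simp [h10, h20]) (by simp [h20]) h02 e2n (by simp [h12])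
      have i3 := hΨ _ _ (e1 + e2) n1 n4 (by simp [h10, h20]) (by simp [h10])
        (by rw [inner_add_right, h01, h02, add_zero]) e12n (by simp [inner_add_right, h1, h2, h12, h21, add_smul])
      have i4 := hΨ _ 0 e2 n4 (by simpa using hε) (by simp [h10]) (by simp) h02 e2n (by simp [h12])
      rw [map_add, map_add, i1, i2, i4] at i3
      exact i3
    intro a b hab
    have j1 := k2 a b hab
    have j2 := k2 0 b (by simp; linarith [norm_nonneg a])
    simp only [zero_smul, zero_add] at j2
    rw [eq_sub_of_add_eq j1.symm, ← sub_eq_zero]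
    rw [eq_sub_of_add_eq' j2]
    abel
  have hn : ((n : ℂ) + 1) ≠ 0 := Nat.cast_add_one_ne_zero n
  have hmul : ∀ m : ℕ, m ≤ n + 1 → Ψ (((m : ℂ) * (a0 / (n + 1))) • axR w e1) e1 - Ψ 0 e1
      = (m : ℂ) • (Ψ ((a0 / (n + 1)) • axR w e1) e1 - Ψ 0 e1) := by
    intro m
    induction m with
    | zero => intro _; simp
    | succ m ih =>
      intro hm
      have hb : ‖(m : ℂ) * (a0 / (n + 1))‖ + ‖a0 / (n + 1)‖ < ε := by
        have hnn : ‖(n : ℂ) + 1‖ = n + 1 := by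
          have := Complex.norm_natCast (n + 1); push_cast at this; exact this
        rw [norm_mul, norm_div, Complex.norm_natCast, hnn]
        have : (m : ℝ) * (‖a0‖ / (n + 1)) + ‖a0‖ / (n + 1) = ((m + 1 : ℕ) : ℝ) / ((n + 1 : ℕ) : ℝ) * ‖a0‖ := by
          push_cast; field_simp
        rw [this]
        have h3 : ((m + 1 : ℕ) : ℝ) / ((n + 1 : ℕ) : ℝ) ≤ 1 := by
          rw [div_le_one (by positivity)]; exact_mod_cast hm
        nlinarith [norm_nonneg a0]
      have := key _ _ hb
      rw [ih (by omega)] at this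
      have e : ((m + 1 : ℕ) : ℂ) * (a0 / (n + 1)) = (m : ℂ) * (a0 / (n + 1)) + a0 / (n + 1) := by
        push_cast; ring
      rw [e, this]
      push_cast
      rw [add_smul, one_smul]
  have := hmul (n + 1) le_rfl
  push_cast at this
  rw [mul_div_cancel₀ _ hn] at this
  rw [this, smul_smul, one_div, inv_mul_cancel₀ hn, one_smul]
  abel


theorem AxPH.special (hf : AxPH f) (D : AxDims E F E' F' k l q)
    (hinj : Function.Injective (fderiv ℂ f 0)) :
    ∃ (v : E) (w : F) (x0 : E') (t : ℕ → ℂ), ‖v‖ = 1 ∧ ‖w‖ = 1 ∧ x0 ≠ 0 ∧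
      Filter.Tendsto t Filter.atTop (nhds 0) ∧ (∀ n, t n ≠ 0) ∧
      (∀ v', (∀ W, AxSlice v w W → ‖W‖ < 1 → f W v' = f 0 v') → ∃ c : ℂ, v' = c • x0) ∧
      ∀ n, ‖t n‖ < 1 ∧ ∃ x, x ≠ 0 ∧ f (t n • axR w v) x = f 0 x ∧
        ∀ W, AxSlice v w W → ‖W‖ < 1 → f (t n • axR w v + W) x = f (t n • axR w v) x := by
  obtain ⟨ε, S, hε, hε1, hSi, ha, hb, ⟨w, hw, hT⟩, hu⟩ := hf.localS D hinj
  have hq := D.hq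
  have hl := D.hl
  let b := stdOrthonormalBasis ℂ E
  let i0 : Fin (Module.finrank ℂ E) := ⟨0, by rw [D.hE]; omega⟩
  let i1 : Fin (Module.finrank ℂ E) := ⟨1, by rw [D.hE]; omega⟩
  let i2 : Fin (Module.finrank ℂ E) := ⟨2, by rw [D.hE]; omega⟩
  obtain ⟨e0, he0⟩ : ∃ e0, e0 = b i0 := ⟨_, rfl⟩
  obtain ⟨e1, he1⟩ : ∃ e1, e1 = b i1 := ⟨_, rfl⟩
  obtain ⟨e2, he2⟩ : ∃ e2, e2 = b i2 := ⟨_, rfl⟩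
  have h0 : ‖e0‖ = 1 := by rw [he0]; exact b.orthonormal.1 _
  have h1 : ‖e1‖ = 1 := by rw [he1]; exact b.orthonormal.1 _
  have h2 : ‖e2‖ = 1 := by rw [he2]; exact b.orthonormal.1 _
  have h01 : inner ℂ e0 e1 = 0 := by rw [he0, he1]; exact b.orthonormal.2 (by simp [i0, i1])
  have h02 : inner ℂ e0 e2 = 0 := by rw [he0, he2]; exact b.orthonormal.2 (by simp [i0, i2])
  have h12 : inner ℂ e1 e2 = 0 := by rw [he1, he2]; exact b.orthonormal.2 (by simp [i1, i2])
  have h10 : inner ℂ e1 e0 = 0 := inner_eq_zero_symm.1 h01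
  have e0n : e0 ≠ 0 := by rintro rfl; simp at h0
  have e1n : e1 ≠ 0 := by rintro rfl; simp at h1
  have wn : w ≠ 0 := by rintro rfl; simp at hw
  have z0 : ‖(0 : E →L[ℂ] F)‖ < ε := by simpa using hε
  -- normalization
  have hN : ∀ Z, ∃ c : ℂ, c ≠ 0 ∧ (‖Z‖ < ε → Z e0 = 0 → c • S Z e0 = S 0 e0) := by
    intro Z
    by_cases h : ‖Z‖ < ε ∧ Z e0 = 0
    · obtain ⟨c, hc, hc2⟩ := hb Z 0 h.1 z0 e0 e0n (by simp [h.2])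
      exact ⟨c, hc, fun _ _ => hc2.symm⟩
    · exact ⟨1, one_ne_zero, fun h1 h2 => absurd ⟨h1, h2⟩ h⟩
  choose c hc0 hc using hN
  have hΨ : ∀ Z Z' x, ‖Z‖ < ε → ‖Z'‖ < ε → Z e0 = 0 → Z' e0 = 0 → inner ℂ e0 x = 0 → x ≠ 0 → Z x = Z' x →
      (c Z • S Z) x = (c Z' • S Z') x := by
    intro Z Z' x hZ hZ' hZ0 hZ0' hx hxn hxx
    have hy : x + e0 ≠ 0 := by
      intro h
      have := congrArg (fun y => inner ℂ e0 y) h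
      simp [hx, h0] at this
    obtain ⟨d1, hd1, hd1'⟩ := hb Z Z' hZ hZ' x hxn hxx
    obtain ⟨d2, hd2, hd2'⟩ := hb Z Z' hZ hZ' (x + e0) hy (by rw [map_add, map_add, hxx, hZ0, hZ0'])
    have g1 := hc Z hZ hZ0
    have g2 := hc Z' hZ' hZ0'
    have r1 : S Z ((c Z' * d1) • x + c Z • e0) = S Z ((c Z' * d2) • (x + e0)) := by
      rw [map_add, map_smul, map_smul, map_smul, g1, ← g2, mul_smul, mul_smul, ← hd1', ← hd2', map_add, smul_add]
    have r2 := hSi Z hZ r1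
    have hxe : inner ℂ x e0 = 0 := inner_eq_zero_symm.1 hx
    have r3 : c Z = c Z' * d2 := by
      have := congrArg (fun y => inner ℂ e0 y) r2
      simpa [inner_add_right, inner_smul_right, hx, h0] using this
    have r4 : c Z' * d1 = c Z' * d2 := by
      rw [r3, smul_add] at r2
      exact smul_left_injective ℂ hxn (add_right_cancel r2)
    rw [LinearMap.smul_apply, LinearMap.smul_apply, hd1', smul_smul, r4, r3]
  have hR : ∀ Z Z' x, ‖Z‖ < ε → ‖Z'‖ < ε → Z e0 = 0 → Z' e0 = 0 → inner ℂ e0 x = 0 → x ≠ 0 → Z x = Z' x →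
      ((f Z : E' →ₗ[ℂ] F') ∘ₗ (c Z • S Z)) x = ((f Z' : E' →ₗ[ℂ] F') ∘ₗ (c Z' • S Z')) x := by
    intro Z Z' x hZ hZ' hZ0 hZ0' hx hxn hxx
    have g := hΨ Z Z' x hZ hZ' hZ0 hZ0' hx hxn hxx
    rw [LinearMap.comp_apply, LinearMap.comp_apply, ← g]
    have := ha Z hZ (Z' - Z) x (by simp [hxx]) (by simpa using hZ'.trans_le hε1)
    rw [add_sub_cancel] at this
    simp only [LinearMap.smul_apply, map_smul, ContinuousLinearMap.coe_coe]
    rw [this]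
  obtain ⟨a0, ha0, ha1⟩ : ∃ a0 : ℂ, a0 ≠ 0 ∧ ‖a0‖ < ε :=
    ⟨((ε / 2 : ℝ) : ℂ), by exact_mod_cast (by positivity : ε / 2 ≠ 0), by
      rw [Complex.norm_real, Real.norm_of_nonneg (by positivity)]; linarith⟩
  have A1 := fun n => ax_additive h0 h1 h2 h01 h02 h12 hw hε (fun Z => c Z • S Z) hΨ a0 ha1 n
  have A2 := fun n => ax_additive h0 h1 h2 h01 h02 h12 hw hε
    (fun Z => (f Z : E' →ₗ[ℂ] F') ∘ₗ (c Z • S Z)) hR a0 ha1 n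
  let t : ℕ → ℂ := fun n => a0 / (n + 1)
  have ht : ∀ n, t n = a0 / (n + 1) := fun n => rfl
  have hnn : ∀ n : ℕ, ((n : ℂ) + 1) ≠ 0 := Nat.cast_add_one_ne_zero
  have htn : ∀ n, t n ≠ 0 := fun n => div_ne_zero ha0 (hnn n)
  have htt : Filter.Tendsto t Filter.atTop (nhds 0) := by
    have := (tendsto_one_div_add_atTop_nhds_zero_nat (𝕜 := ℂ)).const_mul a0
    rw [mul_zero] at this
    refine this.congr (fun n => ?_)
    rw [ht]; ring
  have htε : ∀ n, ‖t n‖ < ε := by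
    intro n
    refine lt_of_le_of_lt ?_ ha1
    have : ‖(n : ℂ) + 1‖ = n + 1 := by
      have := Complex.norm_natCast (n + 1); push_cast at this; exact this
    rw [ht, norm_div, this]
    exact div_le_self (norm_nonneg _) (by linarith [Nat.cast_nonneg (α := ℝ) n])
  have htZ : ∀ n, ‖t n • axR w e1‖ < ε := by
    intro n
    have m1 := ax_norm_slice h1 hw (AxSlice.zero (v := e1) (w := w)) (t n) le_rfl (by simp)
    rw [add_zero] at m1
    exact m1.trans_lt (htε n)
  obtain ⟨σ, hσ⟩ : ∃ σ, σ = c 0 • S 0 e1 := ⟨_, rfl⟩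
  obtain ⟨Γ1, hΓ1⟩ : ∃ Γ, Γ = a0⁻¹ • (c (a0 • axR w e1) • S (a0 • axR w e1) e1 - σ) := ⟨_, rfl⟩
  obtain ⟨Γ2, hΓ2⟩ : ∃ Γ, Γ = a0⁻¹ • (f (a0 • axR w e1) (c (a0 • axR w e1) • S (a0 • axR w e1) e1) - f 0 σ) :=
    ⟨_, rfl⟩
  have B1 : ∀ n, c (t n • axR w e1) • S (t n • axR w e1) e1 = σ + t n • Γ1 := by
    intro n
    have := A1 n
    simp only [LinearMap.smul_apply] at this
    rw [ht, this, hΓ1, hσ, smul_smul]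
    congr 2
    field_simp
  have B2 : ∀ n, f (t n • axR w e1) (σ + t n • Γ1) = f 0 σ + t n • Γ2 := by
    intro n
    have := A2 n
    simp only [LinearMap.smul_apply, LinearMap.comp_apply, ContinuousLinearMap.coe_coe] at this
    rw [← B1, ht, this, hΓ2, hσ, smul_smul]
    congr 2
    field_simp
  have hlim : fderiv ℂ f 0 (axR w e1) σ + f 0 Γ1 = Γ2 := by
    have hd0 : DifferentiableAt ℂ f 0 := hf.diffAt (by simp)
    have l1 := (hd0.hasFDerivAt.hasLineDerivAt (axR w e1))
    have l2 : HasDerivAt (fun s : ℂ => f (0 + s • axR w e1) σ) (fderiv ℂ f 0 (axR w e1) σ) 0 :=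
      (ContinuousLinearMap.apply ℂ F' σ).hasFDerivAt.comp_hasDerivAt (0 : ℂ) l1
    have l3 := l2.tendsto_slope_zero
    have htt' : Filter.Tendsto t Filter.atTop (nhdsWithin 0 {0}ᶜ) :=
      tendsto_nhdsWithin_iff.2 ⟨htt, Filter.Eventually.of_forall htn⟩
    have l4 := l3.comp htt'
    have l5 : Filter.Tendsto (fun n => f (t n • axR w e1) Γ1) Filter.atTop (nhds (f 0 Γ1)) := by
      have c1 : ContinuousAt f ((0 : ℂ) • axR w e1) := by rw [zero_smul]; exact hd0.continuousAt
      have c2 : ContinuousAt (fun s : ℂ => f (s • axR w e1)) 0 :=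
        ContinuousAt.comp (f := fun s : ℂ => s • axR w e1) c1 (by fun_prop)
      have c3 : ContinuousAt (fun s : ℂ => f (s • axR w e1) Γ1) 0 := c2.clm_apply continuousAt_const
      have := c3.tendsto.comp htt
      simpa [Function.comp_def] using this
    have l6 := l4.add l5
    refine tendsto_nhds_unique l6 ?_
    refine tendsto_const_nhds.congr (fun n => ?_)
    have := B2 n
    rw [map_add, map_smul] at this
    simp only [Function.comp_def, zero_add, zero_smul]
    have e : f (t n • axR w e1) σ - f 0 σ = t n • Γ2 - t n • f (t n • axR w e1) Γ1 := by
      rw [sub_eq_sub_iff_add_eq_add, this]; abel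
    rw [e, smul_sub, smul_smul, smul_smul, inv_mul_cancel₀ (htn n), one_smul, one_smul]
    abel
  have hz : fderiv ℂ f 0 (axR w e1) σ = 0 := by
    rw [hσ, map_smul, hT _ _ (by simp [h1]), smul_zero]
  rw [hz, zero_add] at hlim
  refine ⟨e1, w, S 0 e1, t, h1, hw, ?_, htt, htn, ?_, ?_⟩
  · intro h; exact e1n (hSi 0 z0 (by rw [h, map_zero]))
  · intro v' hv'
    refine hu e1 w v' e1n wn (fun A hA => ?_)
    apply ax_deriv_zero (hf.diffAt (by simp)) (ContinuousLinearMap.apply ℂ F' v')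
    filter_upwards [ax_near (B := (0 : E →L[ℂ] F)) (A := A) (by simp)] with s hs
    rw [zero_add] at hs ⊢
    exact hv' _ (hA.smul s) hs
  · intro n
    have hSn : S (t n • axR w e1) e1 ≠ 0 := fun h => e1n (hSi _ (htZ n) (by rw [h, map_zero]))
    refine ⟨(htε n).trans_le hε1, c (t n • axR w e1) • S (t n • axR w e1) e1,
      smul_ne_zero (hc0 _) hSn, ?_, ?_⟩
    · rw [B1, B2, ← hlim, map_add, map_smul]
    · intro W hW hW1
      rw [map_smul, map_smul]
      congr 1
      apply ha _ (htZ n) _ _ hW.1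
      obtain ⟨m, hm1, hm2⟩ : ∃ m : ℝ, max ‖t n‖ ‖W‖ ≤ m ∧ m < 1 :=
        ⟨_, le_rfl, max_lt ((htε n).trans_le hε1) hW1⟩
      exact (ax_norm_slice h1 hw hW _ ((le_max_left _ _).trans hm1) ((le_max_right _ _).trans hm1)).trans_lt hm2

end


/-! ### Final contradiction -/
section
variable {E F E' F' : Type*} [NormedAddCommGroup E] [InnerProductSpace ℂ E]
  [FiniteDimensional ℂ E] [CompleteSpace E]
  [NormedAddCommGroup F] [InnerProductSpace ℂ F] [FiniteDimensional ℂ F] [CompleteSpace F]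
  [NormedAddCommGroup E'] [InnerProductSpace ℂ E'] [FiniteDimensional ℂ E'] [CompleteSpace E']
  [NormedAddCommGroup F'] [InnerProductSpace ℂ F'] [FiniteDimensional ℂ F'] [CompleteSpace F']

variable {k l q : ℕ} {f : (E →L[ℂ] F) → (E' →L[ℂ] F')}

theorem AxPH.propagate (hf : AxPH f) {v : E} {w : F} (hv : ‖v‖ = 1) (hw : ‖w‖ = 1) (t : ℕ → ℂ)
    (ht : Filter.Tendsto t Filter.atTop (nhds 0)) (ht0 : ∀ n, t n ≠ 0)
    (h : ∀ n, ‖t n‖ < 1 ∧ ∃ x, x ≠ 0 ∧ f (t n • axR w v) x = f 0 x ∧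
        ∀ W, AxSlice v w W → ‖W‖ < 1 → f (t n • axR w v + W) x = f (t n • axR w v) x)
    (t1 : ℂ) (ht1 : ‖t1‖ < 1) : ∃ x, ‖x‖ = 1 ∧ f (t1 • axR w v) x = f 0 x ∧
        ∀ W, AxSlice v w W → ‖W‖ < 1 → f (t1 • axR w v + W) x = f (t1 • axR w v) x := by
  suffices hs : ∃ x, x ≠ 0 ∧ f (t1 • axR w v) x = f 0 x ∧
        ∀ W, AxSlice v w W → ‖W‖ < 1 → f (t1 • axR w v + W) x = f (t1 • axR w v) x by
    obtain ⟨x, hx, h1, h2⟩ := hs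
    refine ⟨((‖x‖⁻¹ : ℝ) : ℂ) • x, by rw [norm_smul]; simp [norm_ne_zero_iff.2 hx], ?_, ?_⟩
    · rw [map_smul, h1, map_smul]
    · intro W a b
      rw [map_smul, map_smul, h2 W a b]
  by_contra hno
  push Not at hno
  let ι := {W : E →L[ℂ] F // AxSlice v w W ∧ ‖W‖ < 1}
  let T : ℂ → Option ι → (E' →L[ℂ] F') := fun t i => match i with
    | none => f (t • axR w v + 0) - f 0
    | some W => f (t • axR w v + W.1) - f (t • axR w v + 0)
  obtain ⟨s, Λ, hΛ⟩ := ax_select (T t1) (ContinuousLinearMap.id ℂ E')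
    (by
      intro x hx
      by_contra hx0
      have g1 : f (t1 • axR w v) x = f 0 x := by
        have : (f (t1 • axR w v + 0) - f 0) x = 0 := hx none
        simpa [sub_eq_zero] using this
      obtain ⟨W, h1, h2, h3⟩ := hno x (by simpa using hx0) g1
      apply h3
      have : (f (t1 • axR w v + W) - f (t1 • axR w v + 0)) x = 0 := hx (some ⟨W, h1, h2⟩)
      simpa [sub_eq_zero] using this)
  let M : ℂ → (E' →L[ℂ] E') := fun t => ∑ i ∈ s, (Λ i) ∘L (T t i)
  have hM1 : M t1 = ContinuousLinearMap.id ℂ E' := by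
    ext x
    rw [hΛ x]
    simp [M]
  have hMd : DifferentiableOn ℂ M (Metric.ball 0 1) := by
    refine DifferentiableOn.fun_sum fun i _ => ?_
    refine (differentiableOn_const (Λ i)).clm_comp ?_
    have h0 := hf.disc_diff hv hw (AxSlice.zero (v := v) (w := w)) (by simp)
    cases i with
    | none => exact h0.sub (differentiableOn_const _)
    | some W => exact (hf.disc_diff hv hw W.2.1 W.2.2).sub h0
  have hdd : DifferentiableOn ℂ (fun t => LinearMap.det (M t : E' →ₗ[ℂ] E')) (Metric.ball 0 1) :=
    (ax_continuous_det (V := E')).comp_differentiableOn hMd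
  have han := hdd.analyticOnNhd Metric.isOpen_ball
  have hfreq : ∃ᶠ t in nhdsWithin (0 : ℂ) {0}ᶜ, LinearMap.det (M t : E' →ₗ[ℂ] E') = 0 := by
    have htt' : Filter.Tendsto t Filter.atTop (nhdsWithin 0 {0}ᶜ) :=
      tendsto_nhdsWithin_iff.2 ⟨ht, Filter.Eventually.of_forall ht0⟩
    refine htt'.frequently (Filter.Frequently.of_forall fun n => ?_)
    obtain ⟨_, x, hx, g1, g2⟩ := h n
    apply ax_det_ne_of_inj hx
    simp only [M, _root_.sum_apply]
    refine Finset.sum_eq_zero fun i _ => ?_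
    rw [ContinuousLinearMap.comp_apply]
    have : T (t n) i x = 0 := by
      cases i with
      | none => simp [T, g1]
      | some W => simp [T, g2 W.1 W.2.1 W.2.2]
    rw [this, map_zero]
  have := han.eqOn_zero_of_preconnected_of_frequently_eq_zero
    (convex_ball (0 : ℂ) 1).isPreconnected (by simp) hfreq (by simpa using ht1 : t1 ∈ Metric.ball (0 : ℂ) 1)
  simp only [hM1] at this
  simp at this

theorem AxPH.final (hf : AxPH f) (D : AxDims E F E' F' k l q)
    (hinj : Function.Injective (fderiv ℂ f 0)) : False := by
  obtain ⟨v, w, x0, t, hv, hw, hx0, ht, ht0, hu, h⟩ := hf.special D hinj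
  have hprop := hf.propagate hv hw t ht ht0 h
  let ℓ : E' →L[ℂ] ℂ := (inner ℂ x0 x0)⁻¹ • innerSL ℂ x0
  have hℓ : ℓ x0 = 1 := by
    have : inner ℂ x0 x0 ≠ (0 : ℂ) := inner_self_ne_zero.2 hx0
    show (inner ℂ x0 x0)⁻¹ * inner ℂ x0 x0 = 1
    exact inv_mul_cancel₀ this
  let ι := {W : E →L[ℂ] F // AxSlice v w W ∧ ‖W‖ < 1}
  obtain ⟨s, Λ, hΛ⟩ := ax_select (ι := ι) (fun W => f W.1 - f 0)
    (ContinuousLinearMap.id ℂ E' - ℓ.smulRight x0)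
    (by
      intro x hx
      obtain ⟨c, rfl⟩ := hu x (fun W h1 h2 => by
        have := hx ⟨W, h1, h2⟩
        rwa [_root_.sub_apply, sub_eq_zero] at this)
      simp [hℓ])
  let N : ℂ → (E' →L[ℂ] E') := fun t =>
    ∑ W ∈ s, (Λ W) ∘L (f (t • axR w v + W.1) - f (t • axR w v + 0))
  let M : ℂ → (E' →L[ℂ] E') := fun t => N t + ℓ.smulRight x0
  have hM0 : M 0 = ContinuousLinearMap.id ℂ E' := by
    ext x
    have := hΛ x
    simp only [_root_.sub_apply, ContinuousLinearMap.id_apply, sub_eq_iff_eq_add] at this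
    rw [ContinuousLinearMap.id_apply]
    conv_rhs => rw [this]
    simp [M, N]
  set S := ∑ W ∈ s, ‖Λ W‖ with hS
  have hS0 : 0 ≤ S := Finset.sum_nonneg fun W _ => norm_nonneg _
  have hd := ax_det_lemma M ?_ (∑ W ∈ s, ‖Λ W‖ * 2 + ‖ℓ.smulRight x0‖) ?_ ?_
  · rw [hM0] at hd
    simp at hd
  · refine DifferentiableOn.add_const _ (DifferentiableOn.fun_sum fun W _ => ?_)
    have h1 := (hf.disc_diff hv hw W.2.1 W.2.2).sub (hf.disc_diff hv hw AxSlice.zero (by simp))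
    exact (differentiableOn_const (Λ W)).clm_comp h1
  · intro t ht
    refine (norm_add_le _ _).trans ?_
    gcongr
    refine (norm_sum_le _ _).trans (Finset.sum_le_sum fun W _ => ?_)
    refine (ContinuousLinearMap.opNorm_comp_le _ _).trans ?_
    gcongr
    have := hf.disc_norm hv hw W.2.1 W.2.2 ht
    have := hf.disc_norm hv hw AxSlice.zero (by simp) ht
    exact (norm_sub_le _ _).trans (by linarith)
  · intro η hη
    obtain ⟨ρ, hρ, hρs⟩ := ax_finset_bound s (fun W => ‖W.1‖) (fun W _ => W.2.2)
    have hκ : ‖f 0‖ < 1 := hf.maps 0 (by simp)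
    set γ := (1 - ‖f 0‖) / 4 with hγ
    have hγ0 : 0 < γ := by rw [hγ]; linarith
    obtain ⟨r, hr, H⟩ := hf.core hv hw hρ (η := min (η * γ / (S + 1)) ((1 - ‖f 0‖) / 2))
      (lt_min (by positivity) (by linarith))
    set η' := min (η * γ / (S + 1)) ((1 - ‖f 0‖) / 2) with hη'
    have hη1 : η' ≤ η * γ / (S + 1) := min_le_left _ _
    have hη2 : η' ≤ (1 - ‖f 0‖) / 2 := min_le_right _ _
    refine ⟨r, hr, fun t h1 h2 => ?_⟩
    obtain ⟨x', y, hx', -, hbig, h3⟩ := H t h1 h2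
    obtain ⟨xt, hxt, hxt1, hxt2⟩ := hprop t h2
    have hNx : ‖N t x'‖ ≤ S * η' := by
      simp only [N, _root_.sum_apply, hS, Finset.sum_mul]
      refine (norm_sum_le _ _).trans (Finset.sum_le_sum fun W hW => ?_)
      rw [ContinuousLinearMap.comp_apply, add_zero]
      refine ((Λ W).le_opNorm _).trans ?_
      gcongr
      exact (h3 W.1 W.2.1 (hρs W hW)).1
    have hNt : N t xt = 0 := by
      simp only [N, _root_.sum_apply]
      refine Finset.sum_eq_zero fun W _ => ?_
      rw [ContinuousLinearMap.comp_apply, add_zero, _root_.sub_apply, hxt2 W.1 W.2.1 W.2.2, sub_self, map_zero]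
    have hfar : ∀ c : ℂ, γ ≤ ‖x' - c • xt‖ := by
      intro c
      set z := x' - c • xt with hz
      have e : f (t • axR w v) x' = f (t • axR w v) z + f 0 (x' - z) := by
        have : x' - z = c • xt := by rw [hz]; abel
        rw [this, map_smul, ← hxt1, ← map_smul, ← map_add, hz]
        congr 1; abel
      have hn : ‖f (t • axR w v)‖ < 1 := by
        have := hf.disc_norm hv hw (AxSlice.zero (v := v) (w := w)) (by simp) h2
        rwa [add_zero] at this
      have b1 : ‖f (t • axR w v) z‖ ≤ 1 * ‖z‖ := (ContinuousLinearMap.le_opNorm _ _).trans (by gcongr)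
      have b2 : ‖f 0 (x' - z)‖ ≤ ‖f 0‖ * (1 + ‖z‖) := by
        refine (ContinuousLinearMap.le_opNorm _ _).trans ?_
        gcongr
        refine (norm_sub_le _ _).trans ?_
        rw [hx']
      have b3 : ‖f (t • axR w v) x'‖ ≤ ‖f (t • axR w v) z‖ + ‖f 0 (x' - z)‖ := by
        rw [e]; exact norm_add_le _ _
      have b4 : ‖f 0‖ * (1 + ‖z‖) ≤ ‖f 0‖ + ‖z‖ := by nlinarith [norm_nonneg z]
      rw [hγ]
      linarith
    by_cases hl0 : ℓ xt = 0
    · refine ⟨xt, hxt, Or.inl ?_⟩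
      have : M t xt = 0 := by simp [M, hNt, hl0]
      rw [this, norm_zero]; exact hη.le
    · set y := x' - (ℓ x' / ℓ xt) • xt with hy
      have hyγ : γ ≤ ‖y‖ := hfar _
      have hy0 : 0 < ‖y‖ := hγ0.trans_le hyγ
      have hMy : M t y = N t x' := by
        have hly : ℓ y = 0 := by
          rw [hy, map_sub, map_smul, smul_eq_mul, div_mul_cancel₀ _ hl0, sub_self]
        simp only [M, _root_.add_apply, ContinuousLinearMap.smulRight_apply, hly, zero_smul, add_zero]
        rw [hy, map_sub, map_smul, hNt, smul_zero, sub_zero]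
      refine ⟨((‖y‖⁻¹ : ℝ) : ℂ) • y, by rw [norm_smul]; simp [hy0.ne'], Or.inl ?_⟩
      rw [map_smul, hMy, norm_smul, Complex.norm_real, norm_inv, norm_norm, inv_mul_le_iff₀ hy0]
      have : S * η' ≤ η * γ := by
        calc S * η' ≤ S * (η * γ / (S + 1)) := by gcongr
          _ ≤ η * γ := by
            rw [mul_div_assoc', div_le_iff₀ (by positivity)]
            nlinarith [mul_pos hη hγ0]
      nlinarith

/-- main nonexistence result in coordinate free form -/
theorem AxPH.false_of_dims (hf : AxPH f) (D : AxDims E F E' F' k l q) : False := by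
  obtain ⟨Z, hZ, hi⟩ := hf.exists_inj
  obtain ⟨g, hg, -, h, -⟩ := hf.recenter Z hZ
  exact hg.final D (h hi)

theorem AxPH.dim_le (hf : AxPH f) :
    Module.finrank ℂ E * Module.finrank ℂ F ≤ Module.finrank ℂ E' * Module.finrank ℂ F' := by
  obtain ⟨Z, hZ, hi⟩ := hf.exists_inj
  have := ax_dimF (fderiv ℂ f Z) hi ax_LI_zero ax_LI_zero ax_LI_zero ax_LI_zero
    (fun A _ _ => ⟨fun i => i.elim0, fun i => i.elim0⟩)
  simpa using this

end


/-! ### Transfer to matrices -/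

noncomputable def axL (m n : ℕ) : Matrix (Fin m) (Fin n) ℂ ≃ₗ[ℂ]
    (EuclideanSpace ℂ (Fin n) →L[ℂ] EuclideanSpace ℂ (Fin m)) :=
  Matrix.toEuclideanLin.trans LinearMap.toContinuousLinearMap

noncomputable def axCL (m n : ℕ) : Matrix (Fin m) (Fin n) ℂ ≃L[ℂ]
    (EuclideanSpace ℂ (Fin n) →L[ℂ] EuclideanSpace ℂ (Fin m)) :=
  (axL m n).toContinuousLinearEquiv

theorem axCL_apply (m n : ℕ) (Z : Matrix (Fin m) (Fin n) ℂ) (x : EuclideanSpace ℂ (Fin n)) :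
    axCL m n Z x = WithLp.toLp 2 (Z *ᵥ x.ofLp) := rfl

theorem ax_star_dot {n : ℕ} (v : Fin n → ℂ) :
    star v ⬝ᵥ v = ((‖(WithLp.toLp 2 v : EuclideanSpace ℂ (Fin n))‖ ^ 2 : ℝ) : ℂ) := by
  rw [EuclideanSpace.norm_sq_eq]
  simp [dotProduct, Complex.conj_mul']

theorem ax_form {m n : ℕ} (Z : Matrix (Fin m) (Fin n) ℂ) (x : Fin n → ℂ) :
    star x ⬝ᵥ ((1 - Zᴴ * Z) *ᵥ x) =
      ((‖(WithLp.toLp 2 x : EuclideanSpace ℂ (Fin n))‖ ^ 2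
        - ‖axCL m n Z (WithLp.toLp 2 x)‖ ^ 2 : ℝ) : ℂ) := by
  rw [Complex.ofReal_sub, axCL_apply, ← ax_star_dot, ← ax_star_dot, Matrix.sub_mulVec,
    dotProduct_sub, Matrix.one_mulVec, ← Matrix.mulVec_mulVec, Matrix.star_mulVec,
    Matrix.dotProduct_mulVec]

theorem ax_mem_iff {m n : ℕ} (Z : Matrix (Fin m) (Fin n) ℂ) :
    Z ∈ typeIDomain m n ↔ ‖axCL m n Z‖ < 1 := by
  constructor
  · intro h
    have h : (1 - Zᴴ * Z).PosDef := h
    apply ax_norm_lt_one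
    intro x hx
    have hx' : x.ofLp ≠ 0 := fun h0 => hx (by ext i; simp [h0])
    have h1 := h.dotProduct_mulVec_pos hx'
    rw [ax_form] at h1
    have h2 := Complex.zero_lt_real.1 h1
    have h3 : ‖axCL m n Z x‖ ^ 2 < ‖x‖ ^ 2 := by
      have h4 : WithLp.toLp 2 x.ofLp = x := rfl
      rw [h4] at h2
      linarith
    exact lt_of_pow_lt_pow_left₀ 2 (norm_nonneg _) h3
  · intro h
    show (1 - Zᴴ * Z).PosDef
    apply PosDef.of_dotProduct_mulVec_pos
    · rw [Matrix.IsHermitian, Matrix.conjTranspose_sub, Matrix.conjTranspose_mul,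
        Matrix.conjTranspose_conjTranspose, Matrix.conjTranspose_one]
    · intro x hx
      rw [ax_form]
      have hx0 : (WithLp.toLp 2 x : EuclideanSpace ℂ (Fin n)) ≠ 0 := by
        intro h0
        exact hx (by simpa using congrArg WithLp.ofLp h0)
      have hp : 0 < ‖(WithLp.toLp 2 x : EuclideanSpace ℂ (Fin n))‖ := norm_pos_iff.2 hx0
      have h1 := (axCL m n Z).le_opNorm (WithLp.toLp 2 x)
      have h2 : ‖axCL m n Z (WithLp.toLp 2 x)‖ < ‖(WithLp.toLp 2 x : EuclideanSpace ℂ (Fin n))‖ := by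
        nlinarith
      have h3 := pow_lt_pow_left₀ h2 (norm_nonneg _) (two_ne_zero)
      have h4 := sub_pos.2 h3
      exact_mod_cast h4

theorem ax_transfer {m n m' n' : ℕ} (f : Matrix (Fin m) (Fin n) ℂ → Matrix (Fin m') (Fin n') ℂ)
    (hd : DifferentiableOn ℂ f (typeIDomain m n))
    (hp : ProperOn f (typeIDomain m n) (typeIDomain m' n')) :
    AxPH (fun A => axCL m' n' (f ((axCL m n).symm A))) := by
  obtain ⟨hm, hK⟩ := hp
  have hmem : ∀ A, ‖A‖ < 1 → (axCL m n).symm A ∈ typeIDomain m n := by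
    intro A hA
    rw [ax_mem_iff]
    simpa using hA
  refine ⟨?_, ?_, ?_⟩
  · apply (axCL m' n').differentiable.comp_differentiableOn
    apply hd.comp (axCL m n).symm.differentiable.differentiableOn
    intro A hA
    exact hmem A (by simpa using hA)
  · intro A hA
    exact (ax_mem_iff _).1 (hm (hmem A hA))
  · intro ρ hρ
    have hc := hK ((axCL m' n').symm '' Metric.closedBall 0 ρ) (by
      rintro _ ⟨B, hB, rfl⟩
      rw [ax_mem_iff]
      have : ‖B‖ ≤ ρ := by simpa using hB
      simpa using this.trans_lt hρ)
      ((isCompact_closedBall _ _).image (axCL m' n').symm.continuous)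
    have key : ∀ A, ‖A‖ < 1 → ‖axCL m' n' (f ((axCL m n).symm A))‖ ≤ ρ →
        (axCL m n).symm A ∈ typeIDomain m n ∩
          f ⁻¹' ((axCL m' n').symm '' Metric.closedBall 0 ρ) := by
      intro A hA hA2
      refine ⟨hmem A hA, axCL m' n' (f ((axCL m n).symm A)), by simpa using hA2, by simp⟩
    rcases Set.eq_empty_or_nonempty (typeIDomain m n ∩
          f ⁻¹' ((axCL m' n').symm '' Metric.closedBall 0 ρ)) with he | hne
    · refine ⟨0, one_pos, fun A hA hA2 => ?_⟩
      have := key A hA hA2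
      rw [he] at this
      exact this.elim
    · obtain ⟨Z, hZ, hmax⟩ := hc.exists_isMaxOn hne
        ((axCL m n).continuous.norm.continuousOn)
      refine ⟨‖axCL m n Z‖, (ax_mem_iff _).1 hZ.1, fun A hA hA2 => ?_⟩
      have := hmax (key A hA hA2)
      simpa using this

/-- For all integers `k ≥ 0`, `l ≥ 1` there is a positive integer `N'` such that for all
`p ≥ N'` and all `q` with `2 ≤ q`, `p - k - 2l ≤ q` and `q < p - k - l`, there is no
proper holomorphic map from `D^I_{p,q}` to `D^I_{p-l,p-k-l}`. -/
theorem stmt_5 (k l : ℕ) (hl : 1 ≤ l) :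
    ∃ N' : ℕ, 0 < N' ∧ ∀ p q : ℕ, N' ≤ p → 2 ≤ q → p - k - 2 * l ≤ q → q < p - k - l →
      ¬ ∃ f : Matrix (Fin p) (Fin q) ℂ → Matrix (Fin (p - l)) (Fin (p - k - l)) ℂ,
          DifferentiableOn ℂ f (typeIDomain p q) ∧
          ProperOn f (typeIDomain p q) (typeIDomain (p - l) (p - k - l)) := by
  refine ⟨l * (k + l) + 2 * k + 4 * l + 3 + k + 2 * l, by omega, ?_⟩
  rintro p q hp - h1 h2 ⟨f, hd, hf⟩
  have g := ax_transfer f hd hf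
  obtain ⟨j, hj⟩ : ∃ j, p = q + j + k + l := ⟨p - k - l - q, by omega⟩
  have hq : l * (k + l) + 2 * k + 4 * l + 3 ≤ q := by omega
  rcases Nat.lt_or_ge j l with hjl | hjl
  · have h3 := g.dim_le
    simp only [finrank_euclideanSpace_fin] at h3
    have e1 : p - l = q + j + k := by omega
    have e2 : p - k - l = q + j := by omega
    rw [e1, e2, hj] at h3
    obtain ⟨d, rfl⟩ : ∃ d, l = j + 1 + d := ⟨l - j - 1, by omega⟩
    nlinarith [Nat.zero_le (j * d), Nat.zero_le (k * d), Nat.zero_le (q * d), Nat.zero_le (d * d)]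
  · have hjl' : j = l := by omega
    subst hjl'
    refine g.false_of_dims (k := k) (l := j) (q := q) ⟨?_, ?_, ?_, ?_, hl, hq⟩ <;>
      rw [finrank_euclideanSpace_fin] <;> omega
end

section
/- Let r, s, r', s' be positive integers and let L : ℂ^{r+s} → ℂ^{r'+s'} be a ℂ-linear map such that: (i) for every z ∈ ℂ^{r+s} with H_{r,s}(z) > 0, one has L(z) ≠ 0 and H_{r',s'}(L(z)) > 0; (ii) for every z ≠ 0 with H_{r,s}(z) = 0 and L(z) ≠ 0, one has H_{r',s'}(L(z)) = 0. Then r ≤ r', s ≤ s', and there exist a generalized unitary matrix Q of signature (r,s), a generalized unitary matrix M of signature (r',s'), and a scalar c ∈ ℂ∖{0}, such that L(z·Q) = c·ι(z)·M for every row vector z ∈ ℂ^{r+s}, where ι : ℂ^{r+s} → ℂ^{r'+s'} is the padding map ι(z₁,…,z_r,w₁,…,w_s) := (z₁,…,z_r,0,…,0,w₁,…,w_s,0,…,0) with r'−r zeros after the first r entries and s'−s zeros at the end. -/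
open Matrix

/-- The standard Hermitian form of signature `(m,n)` on `ℂ^{m+n}`:
`H_{m,n}(z) = Σ_{i<m} |z_i|² − Σ_{i≥m} |z_i|²`. -/
noncomputable def hermSig (m n : ℕ) (z : Fin (m + n) → ℂ) : ℝ :=
  ∑ i : Fin (m + n), (if (i : ℕ) < m then (1 : ℝ) else -1) * ‖z i‖ ^ 2

/-- The matrix `I_{m,n} = diag(I_m, -I_n)`. -/
def sigMatrix (m n : ℕ) : Matrix (Fin (m + n)) (Fin (m + n)) ℂ :=
  Matrix.diagonal fun i => if (i : ℕ) < m then 1 else -1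

/-- The padding map `ι : ℂ^{r+s} → ℂ^{r'+s'}` sending `(z₁,…,z_r,w₁,…,w_s)` to
`(z₁,…,z_r,0,…,0,w₁,…,w_s,0,…,0)` with `r'-r` zeros after the first `r` entries and
`s'-s` zeros at the end. -/
def padSig (r s r' s' : ℕ) (z : Fin (r + s) → ℂ) : Fin (r' + s') → ℂ :=
  fun i =>
    if h : (i : ℕ) < r then z ⟨(i : ℕ), by omega⟩
    else if h2 : r' ≤ (i : ℕ) ∧ (i : ℕ) < r' + s then z ⟨(i : ℕ) - r' + r, by omega⟩
    else 0

open scoped ComplexConjugate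

/-- Diagonal sesquilinear form. -/
noncomputable def sesq {κ : Type*} [Fintype κ] (ε : κ → ℝ) (x y : κ → ℂ) : ℂ :=
  ∑ k, (ε k : ℂ) * x k * conj (y k)

section sesqLemmas
variable {κ : Type*} [Fintype κ] (ε : κ → ℝ)

lemma sesq_add_left (x y z : κ → ℂ) : sesq ε (x + y) z = sesq ε x z + sesq ε y z := by
  simp only [sesq, Pi.add_apply, ← Finset.sum_add_distrib]
  exact Finset.sum_congr rfl fun _ _ => by ring

lemma sesq_add_right (x y z : κ → ℂ) : sesq ε x (y + z) = sesq ε x y + sesq ε x z := by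
  simp only [sesq, Pi.add_apply, ← Finset.sum_add_distrib, map_add]
  exact Finset.sum_congr rfl fun _ _ => by ring

lemma sesq_smul_left (a : ℂ) (x z : κ → ℂ) : sesq ε (a • x) z = a * sesq ε x z := by
  simp only [sesq, Pi.smul_apply, Finset.mul_sum, smul_eq_mul]
  exact Finset.sum_congr rfl fun _ _ => by ring

lemma sesq_smul_right (a : ℂ) (x z : κ → ℂ) : sesq ε x (a • z) = conj a * sesq ε x z := by
  simp only [sesq, Pi.smul_apply, Finset.mul_sum, smul_eq_mul, map_mul]
  exact Finset.sum_congr rfl fun _ _ => by ring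

lemma sesq_conj (x y : κ → ℂ) : conj (sesq ε x y) = sesq ε y x := by
  simp only [sesq, map_sum, map_mul, Complex.conj_ofReal, Complex.conj_conj]
  exact Finset.sum_congr rfl fun _ _ => by ring

lemma sesq_zero_left (z : κ → ℂ) : sesq ε 0 z = 0 := by simp [sesq]

lemma sesq_sum_left {ι : Type*} (S : Finset ι) (g : ι → κ → ℂ) (z : κ → ℂ) :
    sesq ε (∑ i ∈ S, g i) z = ∑ i ∈ S, sesq ε (g i) z := by
  classical
  induction S using Finset.induction_on with
  | empty => simp [sesq_zero_left]
  | insert a S ha ih => rw [Finset.sum_insert ha, Finset.sum_insert ha, sesq_add_left, ih]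

lemma sesq_sum_right {ι : Type*} (S : Finset ι) (g : ι → κ → ℂ) (z : κ → ℂ) :
    sesq ε z (∑ i ∈ S, g i) = ∑ i ∈ S, sesq ε z (g i) := by
  rw [← sesq_conj, sesq_sum_left, map_sum]
  exact Finset.sum_congr rfl fun _ _ => sesq_conj _ _ _

lemma sesq_self (x : κ → ℂ) : sesq ε x x = ((∑ k, ε k * ‖x k‖ ^ 2 : ℝ) : ℂ) := by
  simp only [sesq, Complex.ofReal_sum, Complex.ofReal_mul, Complex.ofReal_pow]
  exact Finset.sum_congr rfl fun _ _ => by rw [mul_assoc, Complex.mul_conj']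

lemma sesq_single [DecidableEq κ] (i j : κ) :
    sesq ε (Pi.single i 1) (Pi.single j 1) = if i = j then (ε i : ℂ) else 0 := by
  unfold sesq
  rw [Finset.sum_eq_single i]
  · by_cases h : i = j
    · subst h; simp
    · simp [h]
  · intro b _ hb; simp [hb]
  · simp

/-- Inertia bound. -/
lemma inertia (σ : ℝ) (hσ : σ = 1 ∨ σ = -1) (hε : ∀ k, ε k = 1 ∨ ε k = -1)
    {ι : Type*} [Fintype ι] [DecidableEq ι] (u : ι → κ → ℂ)
    (hu : ∀ i j, sesq ε (u i) (u j) = if i = j then (σ : ℂ) else 0) :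
    Fintype.card ι ≤ Fintype.card {k // ε k = σ} := by
  classical
  let T : (ι → ℂ) →ₗ[ℂ] ({k // ε k = σ} → ℂ) :=
    (LinearMap.funLeft ℂ ℂ (Subtype.val : {k // ε k = σ} → κ)) ∘ₗ (Fintype.linearCombination ℂ u)
  have hT : Function.Injective T := by
    rw [← LinearMap.ker_eq_bot, LinearMap.ker_eq_bot']
    intro c hc
    set x : κ → ℂ := ∑ i, c i • u i with hx
    have hx0 : ∀ k, ε k = σ → x k = 0 := by
      intro k hk
      have := congrFun hc ⟨k, hk⟩
      simpa [T, LinearMap.funLeft_apply, Fintype.linearCombination_apply, hx] using this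
    have h1 : sesq ε x x = ((σ * ∑ i, ‖c i‖ ^ 2 : ℝ) : ℂ) := by
      rw [hx, sesq_sum_left]
      simp only [sesq_sum_right, sesq_smul_left, sesq_smul_right, hu]
      simp only [mul_ite, mul_zero, Finset.sum_ite_eq, Finset.mem_univ, if_true]
      push_cast
      rw [Finset.mul_sum]
      refine Finset.sum_congr rfl fun i _ => ?_
      rw [← Complex.mul_conj']; ring
    rw [sesq_self] at h1
    have h2 : ∑ k, ε k * ‖x k‖ ^ 2 = σ * ∑ i, ‖c i‖ ^ 2 := by exact_mod_cast h1
    have h3 : ∑ k, ε k * ‖x k‖ ^ 2 = -σ * ∑ k, ‖x k‖ ^ 2 := by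
      rw [Finset.mul_sum]
      refine Finset.sum_congr rfl fun k _ => ?_
      by_cases hk : ε k = σ
      · simp [hx0 k hk]
      · have : ε k = -σ := by
          rcases hσ with h | h <;> rcases hε k with h' | h'
          · exact absurd (h'.trans h.symm) hk
          · rw [h, h']
          · rw [h, h', neg_neg]
          · exact absurd (h'.trans h.symm) hk
        rw [this]
    have h4 : 0 ≤ ∑ k, ‖x k‖ ^ 2 := Finset.sum_nonneg fun _ _ => by positivity
    have h5 : 0 ≤ ∑ i, ‖c i‖ ^ 2 := Finset.sum_nonneg fun _ _ => by positivity
    have h6 : ∑ i, ‖c i‖ ^ 2 = 0 := by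
      rcases hσ with h | h <;> subst h <;> linarith
    rw [Finset.sum_eq_zero_iff_of_nonneg (fun _ _ => by positivity)] at h6
    funext i
    simpa using h6 i (Finset.mem_univ i)
  have := LinearMap.finrank_le_finrank_of_injective hT
  simpa using this

/-- An anisotropic vector orthogonal to a partial pseudo-orthonormal family. -/
lemma exists_anisotropic [DecidableEq κ] (hε : ∀ k, ε k = 1 ∨ ε k = -1) (S : Finset κ)
    (hS : S ≠ Finset.univ)
    (f : κ → κ → ℂ)
    (hf : ∀ i ∈ S, ∀ j ∈ S, sesq ε (f i) (f j) = if i = j then (ε i : ℂ) else 0) :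
    ∃ w, (∀ i ∈ S, sesq ε w (f i) = 0) ∧ sesq ε w w ≠ 0 := by
  by_contra hcon
  push Not at hcon
  have hεε : ∀ k, (ε k : ℂ) * ε k = 1 := by
    intro k; rcases hε k with h | h <;> simp [h]
  let q : (κ → ℂ) → (κ → ℂ) := fun x => ∑ i ∈ S, ((ε i : ℂ) * sesq ε x (f i)) • f i
  have hq : ∀ x, ∀ j ∈ S, sesq ε (x + (-1 : ℂ) • q x) (f j) = 0 := by
    intro x j hj
    rw [sesq_add_left, sesq_smul_left]
    simp only [q, sesq_sum_left, sesq_smul_left]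
    rw [Finset.sum_eq_single j]
    · rw [hf j hj j hj, if_pos rfl]
      linear_combination (-sesq ε x (f j)) * hεε j
    · intro i hi hij
      rw [hf i hi j hj, if_neg hij, mul_zero]
    · intro h; exact absurd hj h
  have hspan : ∀ x, x + (-1 : ℂ) • q x = 0 := by
    intro x
    set a := x + (-1 : ℂ) • q x with ha
    let y : κ → ℂ := fun k => (ε k : ℂ) * a k
    set b := y + (-1 : ℂ) • q y with hb
    have haq : sesq ε a (q y) = 0 := by
      simp only [q, sesq_sum_right, sesq_smul_right]
      exact Finset.sum_eq_zero fun i hi => by rw [hq x i hi, mul_zero]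
    have hay : sesq ε a y = ((∑ k, ‖a k‖ ^ 2 : ℝ) : ℂ) := by
      simp only [sesq, y]
      push_cast
      refine Finset.sum_congr rfl fun k _ => ?_
      rw [← Complex.mul_conj', map_mul, Complex.conj_ofReal]
      linear_combination (a k * conj (a k)) * hεε k
    have hab : sesq ε a b = ((∑ k, ‖a k‖ ^ 2 : ℝ) : ℂ) := by
      rw [hb, sesq_add_right, sesq_smul_right, haq, hay]; simp
    have hba : sesq ε b a = ((∑ k, ‖a k‖ ^ 2 : ℝ) : ℂ) := by
      rw [← sesq_conj, hab, Complex.conj_ofReal]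
    have haa := hcon a (hq x)
    have hbb := hcon b (hq y)
    have habab := hcon (a + b) (fun i hi => by
      rw [sesq_add_left, hq x i hi, hq y i hi, add_zero])
    rw [sesq_add_left, sesq_add_right ε a a b, sesq_add_right ε b a b, haa, hbb, hab, hba] at habab
    have h6 : ∑ k, ‖a k‖ ^ 2 = 0 := by
      have : (∑ k, ‖a k‖ ^ 2) + (∑ k, ‖a k‖ ^ 2) = 0 := by
        simp only [zero_add, add_zero] at habab
        exact_mod_cast habab
      linarith
    rw [Finset.sum_eq_zero_iff_of_nonneg (fun _ _ => by positivity)] at h6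
    funext i
    simpa using h6 i (Finset.mem_univ i)
  have htop : Submodule.span ℂ ((S.image f : Finset (κ → ℂ)) : Set (κ → ℂ)) = ⊤ := by
    rw [eq_top_iff]
    intro x _
    have : x = q x := by
      have := hspan x
      rw [neg_one_smul, ← sub_eq_add_neg, sub_eq_zero] at this
      exact this
    rw [this]
    refine Submodule.sum_mem _ fun i hi => Submodule.smul_mem _ _ (Submodule.subset_span ?_)
    exact_mod_cast Finset.mem_image_of_mem f hi
  have h1 := finrank_span_finset_le_card (R := ℂ) (S.image f)
  rw [Set.finrank, htop, finrank_top, Module.finrank_fintype_fun_eq_card] at h1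
  have h2 : (S.image f).card ≤ S.card := Finset.card_image_le
  exact hS ((Finset.card_eq_iff_eq_univ S).1 (le_antisymm (Finset.card_le_univ S) (h1.trans h2)))

lemma extend_one [DecidableEq κ] (hε : ∀ k, ε k = 1 ∨ ε k = -1) (S : Finset κ)
    (hS : S ≠ Finset.univ)
    (f : κ → κ → ℂ)
    (hf : ∀ i ∈ S, ∀ j ∈ S, sesq ε (f i) (f j) = if i = j then (ε i : ℂ) else 0) :
    ∃ k, k ∉ S ∧ ∃ w, (∀ i ∈ S, sesq ε w (f i) = 0) ∧ sesq ε w w = (ε k : ℂ) := by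
  obtain ⟨w, hw, hww⟩ := exists_anisotropic ε hε S hS f hf
  obtain ⟨t, ht⟩ : ∃ t : ℝ, sesq ε w w = (t : ℂ) := ⟨_, sesq_self ε w⟩
  have ht0 : t ≠ 0 := by rintro rfl; exact hww (by simpa using ht)
  obtain ⟨σ, hσ, hσt⟩ : ∃ σ : ℝ, (σ = 1 ∨ σ = -1) ∧ t = σ * |t| := by
    rcases lt_or_gt_of_ne ht0 with h | h
    · exact ⟨-1, Or.inr rfl, by rw [abs_of_neg h]; ring⟩
    · exact ⟨1, Or.inl rfl, by rw [abs_of_pos h]; ring⟩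
  have hsq : (√|t| : ℝ) ≠ 0 := by
    rw [Real.sqrt_ne_zero']; positivity
  set w' : κ → ℂ := (((√|t|)⁻¹ : ℝ) : ℂ) • w with hw'
  have hw'S : ∀ i ∈ S, sesq ε w' (f i) = 0 := fun i hi => by
    rw [hw', sesq_smul_left, hw i hi, mul_zero]
  have hw'w' : sesq ε w' w' = (σ : ℂ) := by
    rw [hw', sesq_smul_left, sesq_smul_right, ht, Complex.conj_ofReal]
    have : (√|t|)⁻¹ * ((√|t|)⁻¹ * t) = σ := by
      have h1 : √|t| * √|t| = |t| := Real.mul_self_sqrt (abs_nonneg t)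
      field_simp
      rw [sq, h1, mul_comm]; linarith
    exact_mod_cast this
  by_cases hex : ∃ k, k ∉ S ∧ ε k = σ
  · obtain ⟨k, hk, hkσ⟩ := hex
    exact ⟨k, hk, w', hw'S, by rw [hw'w', hkσ]⟩
  · exfalso
    push Not at hex
    have hin : ∀ k : {k // ε k = σ}, k.1 ∈ S := fun k => by
      by_contra h; exact hex k.1 h k.2
    let u : Option {k // ε k = σ} → κ → ℂ := fun o => o.elim w' (fun k => f k.1)
    have := inertia ε σ hσ hε u (by
      rintro (_ | i) (_ | j)
      · simpa [u] using hw'w'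
      · simpa [u] using hw'S j.1 (hin j)
      · have h := hw'S i.1 (hin i)
        have h2 : sesq ε (f i.1) w' = 0 := by rw [← sesq_conj, h, map_zero]
        simpa [u] using h2
      · have h := hf i.1 (hin i) j.1 (hin j)
        rw [i.2] at h
        simpa [u, Subtype.ext_iff] using h)
    rw [Fintype.card_option] at this
    omega

lemma extend_all [DecidableEq κ] (hε : ∀ k, ε k = 1 ∨ ε k = -1) (n : ℕ) : ∀ (S : Finset κ)
    (_ : (Sᶜ).card = n)
    (f : κ → κ → ℂ)
    (_ : ∀ i ∈ S, ∀ j ∈ S, sesq ε (f i) (f j) = if i = j then (ε i : ℂ) else 0),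
    ∃ g : κ → κ → ℂ, (∀ i ∈ S, g i = f i) ∧
      ∀ i j, sesq ε (g i) (g j) = if i = j then (ε i : ℂ) else 0 := by
  induction n with
  | zero =>
    intro S hn f hf
    have : S = Finset.univ := by simpa using hn
    subst this
    exact ⟨f, fun _ _ => rfl, fun i j => hf i (Finset.mem_univ _) j (Finset.mem_univ _)⟩
  | succ n ih =>
    intro S hn f hf
    have hS : S ≠ Finset.univ := by rintro rfl; simp at hn
    obtain ⟨k, hk, w, hw, hww⟩ := extend_one ε hε S hS f hf
    have hne : ∀ i ∈ S, i ≠ k := fun i hi h => hk (h ▸ hi)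
    obtain ⟨g, hg, hgg⟩ := ih (insert k S) (by
        rw [Finset.card_compl] at hn ⊢
        rw [Finset.card_insert_of_notMem hk]; omega) (Function.update f k w) (by
      intro i hi j hj
      rw [Finset.mem_insert] at hi hj
      rcases hi with rfl | hi <;> rcases hj with rfl | hj
      · simpa using hww
      · rw [Function.update_self, Function.update_of_ne (hne j hj), hw j hj,
          if_neg (hne j hj).symm]
      · rw [Function.update_self, Function.update_of_ne (hne i hi), ← sesq_conj, hw i hi,
          if_neg (hne i hi), map_zero]
      · rw [Function.update_of_ne (hne j hj), Function.update_of_ne (hne i hi), hf i hi j hj])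
    refine ⟨g, fun i hi => ?_, hgg⟩
    rw [hg i (Finset.mem_insert_of_mem hi), Function.update_of_ne (hne i hi)]

lemma null_rigid [DecidableEq κ] {κ' : Type*} [Fintype κ'] (ε' : κ' → ℝ)
    (hε : ∀ k, ε k = 1 ∨ ε k = -1) (L : (κ → ℂ) →ₗ[ℂ] (κ' → ℂ))
    (hL : ∀ z, sesq ε z z = 0 → sesq ε' (L z) (L z) = 0)
    (p m : κ) (hp : ε p = 1) (hm : ε m = -1) (i j : κ) :
    sesq ε' (L (Pi.single i 1)) (L (Pi.single j 1)) =
      if i = j then (ε i : ℂ) * sesq ε' (L (Pi.single p 1)) (L (Pi.single p 1)) else 0 := by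
  set C : κ → κ → ℂ := fun i j => sesq ε' (L (Pi.single i 1)) (L (Pi.single j 1)) with hC
  have two : ∀ i j, ε i = -ε j → C i i + C j j = 0 ∧ C i j = 0 := by
    intro i j hij
    have hne : i ≠ j := by
      rintro rfl
      rcases hε i with h | h <;> rw [h] at hij <;> norm_num at hij
    have key : ∀ u : ℂ, u * conj u = 1 → C i i + conj u * C i j + u * C j i + C j j = 0 := by
      intro u hu
      have h := hL (Pi.single i 1 + u • Pi.single j 1) (by
        simp only [sesq_add_left, sesq_add_right, sesq_smul_left, sesq_smul_right, sesq_single,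
          if_true, if_neg hne, if_neg hne.symm, hij]
        push_cast
        linear_combination (ε j : ℂ) * hu)
      simp only [map_add, map_smul, sesq_add_left, sesq_add_right, sesq_smul_left,
        sesq_smul_right] at h
      simp only [hC]
      linear_combination h - sesq ε' (L (Pi.single j 1)) (L (Pi.single j 1)) * hu
    have h1 := key 1 (by simp)
    have h2 := key (-1) (by simp)
    have h3 := key Complex.I (by simp)
    simp only [map_one, map_neg, Complex.conj_I] at h1 h2 h3
    refine ⟨by linear_combination (h1 + h2) / 2, ?_⟩
    have h4 : C i j + C j i = 0 := by linear_combination (h1 - h2) / 2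
    have h5 : Complex.I * (C j i - C i j) = 0 := by linear_combination h3 - (h1 + h2) / 2
    have h6 := (mul_eq_zero.1 h5).resolve_left Complex.I_ne_zero
    linear_combination (h4 - h6) / 2
  have three : ∀ i k j, i ≠ k → ε i = ε k → ε i = -ε j → C i k = 0 := by
    intro i k j hik hεik hij
    have hne : ∀ i, ε i = -ε j → i ≠ j := by
      rintro i h rfl
      rcases hε i with h' | h' <;> rw [h'] at h <;> norm_num at h
    have hij' := hne i hij
    have hkj' := hne k (hεik ▸ hij)
    obtain ⟨a1, a2⟩ := two i j hij
    obtain ⟨b1, b2⟩ := two k j (hεik ▸ hij)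
    obtain ⟨-, a3⟩ := two j i (by linarith)
    obtain ⟨-, b3⟩ := two j k (by linarith)
    have key : ∀ u : ℂ, u * conj u = 1 → conj u * C i k + u * C k i = 0 := by
      intro u hu
      have h := hL ((3 : ℂ) • Pi.single i 1 + ((4 : ℂ) * u) • Pi.single k 1
          + (5 : ℂ) • Pi.single j 1) (by
        simp only [sesq_add_left, sesq_add_right, sesq_smul_left, sesq_smul_right, sesq_single,
          if_true, if_neg hik, if_neg hik.symm, if_neg hij', if_neg hij'.symm, if_neg hkj',
          if_neg hkj'.symm, ← hεik, hij, map_mul, map_ofNat]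
        push_cast
        linear_combination -16 * (ε j : ℂ) * hu)
      simp only [map_add, map_smul, sesq_add_left, sesq_add_right, sesq_smul_left,
        sesq_smul_right, map_mul, map_ofNat] at h
      simp only [hC] at a1 a2 a3 b1 b2 b3 ⊢
      linear_combination (h - 16 * sesq ε' (L (Pi.single k 1)) (L (Pi.single k 1)) * hu
        - 9 * a1 - 16 * b1 - 15 * a2 - 15 * a3 - 20 * u * b2 - 20 * conj u * b3) / 12
    have h1 := key 1 (by simp)
    have h3 := key Complex.I (by simp)
    simp only [map_one, Complex.conj_I] at h1 h3
    have h5 : Complex.I * (C k i - C i k) = 0 := by linear_combination h3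
    have h6 := (mul_eq_zero.1 h5).resolve_left Complex.I_ne_zero
    linear_combination (h1 - h6) / 2
  change C i j = if i = j then (ε i : ℂ) * C p p else 0
  have hpm := (two p m (by rw [hp, hm]; norm_num)).1
  split_ifs with hij
  · subst hij
    rcases hε i with h | h
    · have := (two i m (by rw [h, hm]; norm_num)).1
      rw [h]; push_cast; linear_combination this - hpm
    · have := (two p i (by rw [h, hp]; norm_num)).1
      rw [h]; push_cast; linear_combination this
  · rcases hε i with h | h <;> rcases hε j with h' | h'
    · exact three i j m hij (by rw [h, h']) (by rw [h, hm]; norm_num)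
    · exact (two i j (by rw [h, h']; norm_num)).2
    · exact (two i j (by rw [h, h'])).2
    · exact three i j p hij (by rw [h, h']) (by rw [h, hp])

end sesqLemmas

/-- The sign function of signature `(m,n)`. -/
noncomputable def sgnSig (m n : ℕ) (i : Fin (m + n)) : ℝ := if (i : ℕ) < m then 1 else -1

lemma sgnSig_or (m n : ℕ) (i : Fin (m + n)) : sgnSig m n i = 1 ∨ sgnSig m n i = -1 := by
  unfold sgnSig; split_ifs <;> simp

lemma sesq_hermSig (m n : ℕ) (z : Fin (m + n) → ℂ) :
    sesq (sgnSig m n) z z = (hermSig m n z : ℂ) := sesq_self _ _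

/-- The slot embedding. -/
def slotSig (r s r' s' : ℕ) (hr : r ≤ r') (hs : s ≤ s') (i : Fin (r + s)) : Fin (r' + s') :=
  if h : (i : ℕ) < r then ⟨i, by omega⟩ else ⟨i - r + r', by omega⟩

lemma slotSig_inj (r s r' s' : ℕ) (hr : r ≤ r') (hs : s ≤ s') :
    Function.Injective (slotSig r s r' s' hr hs) := by
  intro i j h
  unfold slotSig at h
  split_ifs at h <;> simp only [Fin.mk.injEq] at h <;> ext <;> omega

lemma slotSig_sgn (r s r' s' : ℕ) (hr : r ≤ r') (hs : s ≤ s') (i : Fin (r + s)) :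
    sgnSig r' s' (slotSig r s r' s' hr hs i) = sgnSig r s i := by
  unfold slotSig sgnSig
  by_cases h : (i : ℕ) < r
  · have : (i : ℕ) < r' := by omega
    simp [h, this]
  · simp [h]

lemma padSig_slot (r s r' s' : ℕ) (hr : r ≤ r') (hs : s ≤ s') (z : Fin (r + s) → ℂ)
    (i : Fin (r + s)) : padSig r s r' s' z (slotSig r s r' s' hr hs i) = z i := by
  unfold slotSig padSig
  by_cases h : (i : ℕ) < r
  · simp [h]
  · have h1 : ¬ ((i : ℕ) - r + r' < r) := by omega
    have h2 : (i : ℕ) - r + r' < r' + s := by omega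
    simp only [h, dif_neg, not_false_eq_true, h1]
    rw [dif_pos ⟨by omega, h2⟩]
    congr 1
    ext
    simp only
    omega

lemma padSig_off (r s r' s' : ℕ) (hr : r ≤ r') (hs : s ≤ s') (z : Fin (r + s) → ℂ)
    (k : Fin (r' + s')) (hk : k ∉ Set.range (slotSig r s r' s' hr hs)) :
    padSig r s r' s' z k = 0 := by
  unfold padSig
  split_ifs with h1 h2
  · exact absurd ⟨⟨k, by omega⟩, by ext; simp [slotSig, h1]⟩ hk
  · exact absurd ⟨⟨k - r' + r, by omega⟩, by ext; simp [slotSig]; omega⟩ hk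
  · rfl

lemma card_pos_sig (m n : ℕ) : Fintype.card {k // sgnSig m n k = 1} = m := by
  have e : {k // sgnSig m n k = 1} ≃ Fin m :=
    { toFun := fun k => ⟨k.1, by
        by_contra h
        have := k.2
        rw [sgnSig, if_neg h] at this
        norm_num at this⟩
      invFun := fun i => ⟨⟨i, by omega⟩, by simp [sgnSig]⟩
      left_inv := fun k => by ext; rfl
      right_inv := fun k => by ext; rfl }
  rw [Fintype.card_congr e, Fintype.card_fin]

lemma card_neg_sig (m n : ℕ) : Fintype.card {k // sgnSig m n k = -1} = n := by
  have e : {k // sgnSig m n k = -1} ≃ Fin n :=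
    { toFun := fun k => ⟨k.1 - m, by
        have h1 : ¬ ((k.1 : ℕ) < m) := by
          intro h
          have := k.2
          rw [sgnSig, if_pos h] at this
          norm_num at this
        omega⟩
      invFun := fun i => ⟨⟨m + i, by omega⟩, by simp [sgnSig]⟩
      left_inv := fun k => by
        have h1 : ¬ ((k.1 : ℕ) < m) := by
          intro h
          have := k.2
          rw [sgnSig, if_pos h] at this
          norm_num at this
        ext; simp only; omega
      right_inv := fun k => by ext; simp }
  rw [Fintype.card_congr e, Fintype.card_fin]

/-- Rigidity of sign-preserving linear maps between generalized balls: a linear map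
`L : ℂ^{r+s} → ℂ^{r'+s'}` sending the positive cone of `H_{r,s}` into the positive cone
of `H_{r',s'}` and (away from its kernel) the null cone into the null cone is, up to
generalized unitary matrices of signatures `(r,s)` and `(r',s')` and a nonzero scalar,
the standard zero-padding map; in particular `r ≤ r'` and `s ≤ s'`. -/
theorem stmt_12 (r s r' s' : ℕ) (h0r : 0 < r) (h0s : 0 < s) (h0r' : 0 < r') (h0s' : 0 < s')
    (L : (Fin (r + s) → ℂ) →ₗ[ℂ] (Fin (r' + s') → ℂ))
    (hpos : ∀ z : Fin (r + s) → ℂ, 0 < hermSig r s z → L z ≠ 0 ∧ 0 < hermSig r' s' (L z))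
    (hnull : ∀ z : Fin (r + s) → ℂ, z ≠ 0 → hermSig r s z = 0 → L z ≠ 0 →
      hermSig r' s' (L z) = 0) :
    r ≤ r' ∧ s ≤ s' ∧
    ∃ (Q : Matrix (Fin (r + s)) (Fin (r + s)) ℂ)
      (M : Matrix (Fin (r' + s')) (Fin (r' + s')) ℂ) (c : ℂ),
      c ≠ 0 ∧ IsUnit Q ∧ IsUnit M ∧
      Q * sigMatrix r s * Qᴴ = sigMatrix r s ∧
      M * sigMatrix r' s' * Mᴴ = sigMatrix r' s' ∧
      ∀ z : Fin (r + s) → ℂ, L (z ᵥ* Q) = c • ((padSig r s r' s' z) ᵥ* M) := by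
  classical
  have hL : ∀ z, sesq (sgnSig r s) z z = 0 → sesq (sgnSig r' s') (L z) (L z) = 0 := by
    intro z hz
    by_cases h : L z = 0
    · rw [h, sesq_zero_left]
    · rw [sesq_hermSig] at hz ⊢
      have hz0 : z ≠ 0 := by rintro rfl; exact h (map_zero L)
      rw [hnull z hz0 (by exact_mod_cast hz) h, Complex.ofReal_zero]
  let p : Fin (r + s) := ⟨0, by omega⟩
  let m : Fin (r + s) := ⟨r, by omega⟩
  have hp : sgnSig r s p = 1 := by simp [sgnSig, p, h0r]
  have hm : sgnSig r s m = -1 := by simp [sgnSig, m]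
  have hrig := null_rigid (sgnSig r s) (sgnSig r' s') (sgnSig_or r s) L hL p m hp hm
  obtain ⟨lam, hlam, hlam0⟩ : ∃ lam : ℝ,
      sesq (sgnSig r' s') (L (Pi.single p 1)) (L (Pi.single p 1)) = (lam : ℂ) ∧ 0 < lam := by
    refine ⟨_, sesq_hermSig _ _ _, (hpos _ ?_).2⟩
    have h := sesq_hermSig r s (Pi.single p 1)
    rw [sesq_single, if_pos rfl, hp] at h
    have h' : (1 : ℝ) = hermSig r s (Pi.single p 1) := by exact_mod_cast h
    rw [← h']; norm_num
  rw [hlam] at hrig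
  have hsq : √lam ≠ 0 := (Real.sqrt_pos.2 hlam0).ne'
  have hsqC : ((√lam : ℝ) : ℂ) ≠ 0 := by exact_mod_cast hsq
  let v : Fin (r + s) → Fin (r' + s') → ℂ := fun i => (((√lam)⁻¹ : ℝ) : ℂ) • L (Pi.single i 1)
  have hv : ∀ i j, sesq (sgnSig r' s') (v i) (v j) =
      if i = j then (sgnSig r s i : ℂ) else 0 := by
    intro i j
    simp only [v, sesq_smul_left, sesq_smul_right, hrig, Complex.conj_ofReal]
    split_ifs
    · have h1 : √lam * √lam = lam := Real.mul_self_sqrt hlam0.le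
      have : (√lam)⁻¹ * ((√lam)⁻¹ * (sgnSig r s i * lam)) = sgnSig r s i := by
        field_simp
        rw [sq, h1, mul_comm]
      exact_mod_cast this
    · simp
  have hrr : r ≤ r' := by
    have := inertia (sgnSig r' s') 1 (Or.inl rfl) (sgnSig_or r' s')
      (fun i : {k // sgnSig r s k = 1} => v i.1) (fun i j => by
        rw [hv, i.2]; simp [Subtype.ext_iff])
    rwa [card_pos_sig, card_pos_sig] at this
  have hss : s ≤ s' := by
    have := inertia (sgnSig r' s') (-1) (Or.inr rfl) (sgnSig_or r' s')
      (fun i : {k // sgnSig r s k = -1} => v i.1) (fun i j => by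
        rw [hv, i.2]; simp [Subtype.ext_iff])
    rwa [card_neg_sig, card_neg_sig] at this
  refine ⟨hrr, hss, ?_⟩
  set e := slotSig r s r' s' hrr hss with he
  have einj : Function.Injective e := slotSig_inj r s r' s' hrr hss
  obtain ⟨g, hg, hgg⟩ := extend_all (sgnSig r' s') (sgnSig_or r' s') _ (Finset.univ.image e) rfl
    (Function.extend e v 0) (by
      intro a ha b hb
      obtain ⟨i, -, rfl⟩ := Finset.mem_image.1 ha
      obtain ⟨j, -, rfl⟩ := Finset.mem_image.1 hb
      rw [einj.extend_apply, einj.extend_apply, hv, he, slotSig_sgn, ← he]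
      simp [einj.eq_iff])
  have hge : ∀ i, g (e i) = v i := fun i => by
    rw [hg _ (Finset.mem_image_of_mem e (Finset.mem_univ i)), einj.extend_apply]
  have hsig : ∀ a b i, (sigMatrix a b) i i = (sgnSig a b i : ℂ) := fun a b i => by
    simp only [sigMatrix, sgnSig, Matrix.diagonal_apply_eq]
    split_ifs <;> simp
  have hM : (Matrix.of g) * sigMatrix r' s' * (Matrix.of g)ᴴ = sigMatrix r' s' := by
    ext i j
    have h1 : ((Matrix.of g) * sigMatrix r' s' * (Matrix.of g)ᴴ) i j
        = sesq (sgnSig r' s') (g i) (g j) := by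
      rw [Matrix.mul_apply, sesq]
      refine Finset.sum_congr rfl fun k _ => ?_
      rw [← hsig]
      simp only [sigMatrix, Matrix.mul_diagonal, Matrix.diagonal_apply_eq,
        Matrix.conjTranspose_apply, Matrix.of_apply]
      rw [mul_comm (g i k)]; rfl
    rw [h1, hgg]
    split_ifs with h
    · subst h; rw [hsig]
    · rw [sigMatrix, Matrix.diagonal_apply_ne _ h]
  have hJJ : sigMatrix r' s' * sigMatrix r' s' = 1 := by
    rw [sigMatrix, Matrix.diagonal_mul_diagonal, ← Matrix.diagonal_one]
    congr 1
    funext i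
    split_ifs <;> simp
  have hMu : IsUnit (Matrix.of g) := by
    have : (Matrix.of g) * (sigMatrix r' s' * (Matrix.of g)ᴴ * sigMatrix r' s') = 1 := by
      rw [← Matrix.mul_assoc, ← Matrix.mul_assoc, hM, hJJ]
    exact IsUnit.of_mul_eq_one _ this
  refine ⟨1, Matrix.of g, ((√lam : ℝ) : ℂ), hsqC, isUnit_one, hMu, by simp, hM, ?_⟩
  intro z
  have h1 : (padSig r s r' s' z) ᵥ* (Matrix.of g) = ∑ i, z i • v i := by
    rw [Matrix.vecMul_eq_sum]
    symm
    refine Fintype.sum_of_injective e einj _ _ (fun k hk => ?_) (fun i => ?_)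
    · rw [padSig_off r s r' s' hrr hss z k hk, zero_smul]
    · rw [he, padSig_slot, ← he]
      change _ = z i • g (e i)
      rw [hge]
  rw [h1, Matrix.vecMul_one, Finset.smul_sum]
  conv_lhs => rw [pi_eq_sum_univ' z, map_sum]
  refine Finset.sum_congr rfl fun i _ => ?_
  rw [map_smul]
  simp only [v]
  rw [smul_comm (z i), smul_smul]
  push_cast
  rw [mul_inv_cancel₀ hsqC, one_smul]
end
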